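/- There exists a universal constant c > 0 with the following property. For every k ≥ 1, every finite family P = {P_1,…,P_s} ⊆ ℝ[X_1,…,X_k] with deg P_i ≤ d for all i, and every set S ⊆ ℝ^k which is a finite union of realizations of sign conditions on P, each connected component C of S can be written as a finite union of realizations of sign conditions on some finite family of polynomials in ℝ[X_1,…,X_k], each of degree at most d^{c·k³}. -/

import Mathlib

open MvPolynomial Set

/-- The realization `R(σ)` of a sign condition `σ` on the finite family of polynomials
`A = (A 0, …, A (n-1))` in `ℝ[X_1,…,X_k]`. -/
def signRealization {k n : ℕ} (A : Fin n → MvPolynomial (Fin k) ℝ)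
    (σ : Fin n → SignType) : Set (Fin k → ℝ) :=
  {x | ∀ i, SignType.sign (eval x (A i)) = σ i}

namespace SemialgComp

variable {ι κ α β γ : Type}

/-- A finite set of polynomials of degree at most `D`. -/
def FinDeg (D : ℕ) (F : Set (MvPolynomial ι ℝ)) : Prop :=
  F.Finite ∧ ∀ f ∈ F, f.totalDegree ≤ D

/-- Two points at which all polynomials of `F` have the same sign. -/
def SameSign (F : Set (MvPolynomial ι ℝ)) (z z' : ι → ℝ) : Prop :=
  ∀ f ∈ F, SignType.sign (eval z f) = SignType.sign (eval z' f)

/-- A function on the affine space is decided in degree `D` if it only depends on the signs of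
finitely many polynomials of degree at most `D`. -/
def Decided (D : ℕ) (φ : (ι → ℝ) → α) : Prop :=
  ∃ F : Set (MvPolynomial ι ℝ), FinDeg D F ∧ ∀ z z', SameSign F z z' → φ z = φ z'

/-- A function on the affine space given by a polynomial of degree at most `D`. -/
def PolyFn (D : ℕ) (f : (ι → ℝ) → ℝ) : Prop :=
  ∃ q : MvPolynomial ι ℝ, q.totalDegree ≤ D ∧ ∀ z, f z = eval z q

lemma SameSign.symm {F : Set (MvPolynomial ι ℝ)} {z z' : ι → ℝ} (h : SameSign F z z') :
    SameSign F z' z := fun f hf => (h f hf).symm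

lemma SameSign.mono {F G : Set (MvPolynomial ι ℝ)} {z z' : ι → ℝ} (h : SameSign F z z')
    (hG : G ⊆ F) : SameSign G z z' := fun f hf => h f (hG hf)

lemma FinDeg.mono {D E : ℕ} {F : Set (MvPolynomial ι ℝ)} (h : FinDeg D F) (hD : D ≤ E) :
    FinDeg E F := ⟨h.1, fun f hf => (h.2 f hf).trans hD⟩

lemma FinDeg.union {D : ℕ} {F G : Set (MvPolynomial ι ℝ)} (h : FinDeg D F) (h' : FinDeg D G) :
    FinDeg D (F ∪ G) := ⟨h.1.union h'.1, fun f hf => hf.elim (h.2 f) (h'.2 f)⟩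

lemma FinDeg.iUnion {D : ℕ} [Finite γ] {F : γ → Set (MvPolynomial ι ℝ)}
    (h : ∀ i, FinDeg D (F i)) : FinDeg D (⋃ i, F i) :=
  ⟨Set.finite_iUnion fun i => (h i).1, fun f hf => by
    obtain ⟨i, hi⟩ := Set.mem_iUnion.1 hf
    exact (h i).2 f hi⟩

namespace Decided

lemma mono {D E : ℕ} {φ : (ι → ℝ) → α} (h : Decided D φ) (hD : D ≤ E) : Decided E φ := by
  obtain ⟨F, hF, h⟩ := h
  exact ⟨F, hF.mono hD, h⟩

lemma comp {D : ℕ} {φ : (ι → ℝ) → α} (h : Decided D φ) (g : α → β) :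
    Decided D (fun z => g (φ z)) := by
  obtain ⟨F, hF, h⟩ := h
  exact ⟨F, hF, fun z z' hz => congrArg g (h z z' hz)⟩

lemma of_fun_eq {D : ℕ} {φ : (ι → ℝ) → α} {ψ : (ι → ℝ) → β} (h : Decided D φ)
    (hψ : ∀ z z', φ z = φ z' → ψ z = ψ z') : Decided D ψ := by
  obtain ⟨F, hF, h⟩ := h
  exact ⟨F, hF, fun z z' hz => hψ z z' (h z z' hz)⟩

lemma const (D : ℕ) (a : α) : Decided D (fun _ : ι → ℝ => a) :=
  ⟨∅, ⟨Set.finite_empty, by simp⟩, fun _ _ _ => rfl⟩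

lemma pi [Finite γ] {D : ℕ} {α : γ → Type} {φ : ∀ i, (ι → ℝ) → α i}
    (h : ∀ i, Decided D (φ i)) : Decided D (fun z i => φ i z) := by
  choose F hF h using h
  exact ⟨⋃ i, F i, FinDeg.iUnion hF, fun z z' hz => funext fun i =>
    h i z z' (hz.mono (Set.subset_iUnion F i))⟩

lemma prodMk {D : ℕ} {φ : (ι → ℝ) → α} {ψ : (ι → ℝ) → β} (h : Decided D φ) (h' : Decided D ψ) :
    Decided D (fun z => (φ z, ψ z)) := by
  obtain ⟨F, hF, h⟩ := h
  obtain ⟨G, hG, h'⟩ := h'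
  exact ⟨F ∪ G, hF.union hG, fun z z' hz =>
    Prod.ext (h z z' (hz.mono subset_union_left)) (h' z z' (hz.mono subset_union_right))⟩

lemma comp₂ {D : ℕ} {φ : (ι → ℝ) → α} {ψ : (ι → ℝ) → β} (h : Decided D φ) (h' : Decided D ψ)
    (g : α → β → γ) : Decided D (fun z => g (φ z) (ψ z)) :=
  (h.prodMk h').comp (fun p => g p.1 p.2)

lemma sum {D : ℕ} [AddCommMonoid α] (s : Finset γ) {φ : γ → (ι → ℝ) → α}
    (h : ∀ i ∈ s, Decided D (φ i)) : Decided D (fun z => ∑ i ∈ s, φ i z) := by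
  have := Decided.pi (γ := s) (φ := fun i => φ i.1) (D := D) fun i => h i.1 i.2
  refine (this.comp (fun f => ∑ i, f i)).of_fun_eq fun z z' hz => ?_
  have e := fun z => Finset.sum_coe_sort s (fun i => φ i z)
  rw [← e, ← e]
  exact hz

lemma sameSign {D : ℕ} {G : Set (MvPolynomial ι ℝ)} (hG : FinDeg D G) :
    Decided D (fun z => fun f : G => SignType.sign (eval z f.1)) :=
  ⟨G, hG, fun _ _ hz => funext fun f => hz f.1 f.2⟩

end Decided

namespace PolyFn

lemma mono {D E : ℕ} {f : (ι → ℝ) → ℝ} (h : PolyFn D f) (hD : D ≤ E) : PolyFn E f := by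
  obtain ⟨q, hq, h⟩ := h
  exact ⟨q, hq.trans hD, h⟩

lemma congr {D : ℕ} {f g : (ι → ℝ) → ℝ} (h : PolyFn D f) (hg : ∀ z, g z = f z) : PolyFn D g := by
  obtain ⟨q, hq, h⟩ := h
  exact ⟨q, hq, fun z => (hg z).trans (h z)⟩

lemma decided {D : ℕ} {f : (ι → ℝ) → ℝ} (h : PolyFn D f) :
    Decided D (fun z => SignType.sign (f z)) := by
  obtain ⟨q, hq, h⟩ := h
  exact ⟨{q}, ⟨Set.finite_singleton _, by simpa using hq⟩, fun z z' hz => by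
    simpa [h] using hz q rfl⟩

lemma const (D : ℕ) (c : ℝ) : PolyFn D (fun _ : ι → ℝ => c) :=
  ⟨C c, by simp, by simp⟩

lemma eval {D : ℕ} {q : MvPolynomial ι ℝ} (h : q.totalDegree ≤ D) :
    PolyFn D (fun z => MvPolynomial.eval z q) := ⟨q, h, fun _ => rfl⟩

lemma coord {D : ℕ} (hD : 1 ≤ D) (i : ι) : PolyFn D (fun z : ι → ℝ => z i) :=
  ⟨X i, by simpa using hD, by simp⟩

lemma add {D : ℕ} {f g : (ι → ℝ) → ℝ} (hf : PolyFn D f) (hg : PolyFn D g) :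
    PolyFn D (fun z => f z + g z) := by
  obtain ⟨p, hp, hf⟩ := hf
  obtain ⟨q, hq, hg⟩ := hg
  exact ⟨p + q, (totalDegree_add _ _).trans (max_le hp hq), fun z => by simp [hf, hg]⟩

lemma mul {D E : ℕ} {f g : (ι → ℝ) → ℝ} (hf : PolyFn D f) (hg : PolyFn E g) :
    PolyFn (D + E) (fun z => f z * g z) := by
  obtain ⟨p, hp, hf⟩ := hf
  obtain ⟨q, hq, hg⟩ := hg
  exact ⟨p * q, (totalDegree_mul _ _).trans (add_le_add hp hq), fun z => by simp [hf, hg]⟩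

lemma const_mul {D : ℕ} {f : (ι → ℝ) → ℝ} (hf : PolyFn D f) (c : ℝ) :
    PolyFn D (fun z => c * f z) :=
  ((const 0 c).mul hf).mono (by omega)

lemma neg {D : ℕ} {f : (ι → ℝ) → ℝ} (hf : PolyFn D f) : PolyFn D (fun z => - f z) :=
  (hf.const_mul (-1)).congr fun z => by ring

lemma sub {D : ℕ} {f g : (ι → ℝ) → ℝ} (hf : PolyFn D f) (hg : PolyFn D g) :
    PolyFn D (fun z => f z - g z) :=
  (hf.add hg.neg).congr fun z => by ring

lemma sum {D : ℕ} (s : Finset γ) {f : γ → (ι → ℝ) → ℝ} (hf : ∀ i ∈ s, PolyFn D (f i)) :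
    PolyFn D (fun z => ∑ i ∈ s, f i z) := by
  classical
  induction s using Finset.induction_on with
  | empty => simpa using const D 0
  | insert a s ha ih =>
    simp only [Finset.sum_insert ha]
    exact (hf a (by simp)).add (ih fun i hi => hf i (by simp [hi]))

lemma prod (s : Finset γ) {D : γ → ℕ} {f : γ → (ι → ℝ) → ℝ} (hf : ∀ i ∈ s, PolyFn (D i) (f i)) :
    PolyFn (∑ i ∈ s, D i) (fun z => ∏ i ∈ s, f i z) := by
  classical
  induction s using Finset.induction_on with
  | empty => simpa using const 0 1
  | insert a s ha ih =>
    simp only [Finset.prod_insert ha, Finset.sum_insert ha]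
    exact (hf a (by simp)).mul (ih fun i hi => hf i (by simp [hi]))

lemma pow {D : ℕ} {f : (ι → ℝ) → ℝ} (hf : PolyFn D f) (n : ℕ) :
    PolyFn (n * D) (fun z => f z ^ n) := by
  have := prod (Finset.range n) (D := fun _ => D) (f := fun _ => f) (fun _ _ => hf)
  simpa using this

lemma det {n : Type} [Fintype n] [DecidableEq n] {D : ℕ} {M : (ι → ℝ) → Matrix n n ℝ}
    (hM : ∀ i j, PolyFn D (fun z => M z i j)) :
    PolyFn (Fintype.card n * D) (fun z => (M z).det) := by
  simp only [Matrix.det_apply']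
  refine sum _ fun σ _ => const_mul ?_ _
  have := prod Finset.univ (D := fun _ : n => D) (f := fun i z => M z (σ i) i) (fun i _ => hM _ _)
  simpa using this

end PolyFn

end SemialgComp

namespace SemialgComp

open Filter Topology

variable {ι κ α β γ : Type}

/-- Extend a point by one more coordinate. -/
def ext (z : ι → ℝ) (u : ℝ) : Option ι → ℝ := fun o => o.elim u z

@[simp] lemma ext_none (z : ι → ℝ) (u : ℝ) : ext z u none = u := rfl
@[simp] lemma ext_some (z : ι → ℝ) (u : ℝ) (i : ι) : ext z u (some i) = z i := rfl

lemma ext_eta (w : Option ι → ℝ) : ext (fun i => w (some i)) (w none) = w := by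
  funext o; cases o <;> rfl

/-- The univariate polynomial obtained by fixing all but the distinguished coordinate. -/
noncomputable def slice (q : MvPolynomial (Option ι) ℝ) (z : ι → ℝ) : Polynomial ℝ :=
  (optionEquivLeft ℝ ι q).map (eval z)

lemma eval_slice (q : MvPolynomial (Option ι) ℝ) (z : ι → ℝ) (u : ℝ) :
    (slice q z).eval u = eval (ext z u) q := by
  rw [slice, ← optionEquivLeft_elim_eval]
  rfl

lemma coeff_slice (q : MvPolynomial (Option ι) ℝ) (z : ι → ℝ) (i : ℕ) :
    (slice q z).coeff i = eval z ((optionEquivLeft ℝ ι q).coeff i) := by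
  simp [slice]

lemma polyFn_coeff_slice {D : ℕ} {q : MvPolynomial (Option ι) ℝ} (hq : q.totalDegree ≤ D)
    (i : ℕ) : PolyFn D (fun z => (slice q z).coeff i) :=
  ⟨_, (totalDegree_coeff_optionEquivLeft_le ..).trans hq, fun z => coeff_slice q z i⟩

lemma natDegree_slice_le {D : ℕ} {q : MvPolynomial (Option ι) ℝ} (hq : q.totalDegree ≤ D)
    (z : ι → ℝ) : (slice q z).natDegree ≤ D := by
  refine (Polynomial.natDegree_map_le).trans ?_
  rw [natDegree_optionEquivLeft]
  exact (degreeOf_le_totalDegree _ _).trans hq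

lemma eventually_sign_small (p : Polynomial ℝ) :
    ∀ᶠ η in 𝓝[>] (0 : ℝ), SignType.sign (p.eval η) = SignType.sign p.trailingCoeff := by
  by_cases hp : p = 0
  · simp [hp]
  obtain ⟨q, hq⟩ : Polynomial.X ^ p.natTrailingDegree ∣ p :=
    Polynomial.X_pow_dvd_iff.2 fun d hd => Polynomial.coeff_eq_zero_of_lt_natTrailingDegree hd
  have hc : q.eval 0 = p.trailingCoeff := by
    have h0 := congrArg (fun r => r.coeff p.natTrailingDegree) hq
    have h1 := Polynomial.coeff_X_pow_mul q p.natTrailingDegree 0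
    rw [zero_add] at h1
    rw [← Polynomial.coeff_zero_eq_eval_zero, Polynomial.trailingCoeff, ← h1]
    exact h0.symm
  have hne : q.eval 0 ≠ 0 := by rw [hc]; exact Polynomial.trailingCoeff_nonzero_iff_nonzero.2 hp
  have ht : Tendsto (fun η => q.eval η) (𝓝[>] 0) (𝓝 (q.eval 0)) :=
    q.continuous.continuousAt.tendsto.mono_left nhdsWithin_le_nhds
  have hs : ∀ᶠ η in 𝓝[>] (0 : ℝ), SignType.sign (q.eval η) = SignType.sign (q.eval 0) := by
    rcases lt_or_gt_of_ne hne with h | h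
    · filter_upwards [ht.eventually (gt_mem_nhds h)] with η hη
      rw [sign_neg hη, sign_neg h]
    · filter_upwards [ht.eventually (lt_mem_nhds h)] with η hη
      rw [sign_pos hη, sign_pos h]
  filter_upwards [hs, self_mem_nhdsWithin] with η h1 h2
  have : 0 < η ^ p.natTrailingDegree := pow_pos h2 _
  have h0 := congrArg (Polynomial.eval η) hq
  simp only [Polynomial.eval_mul, Polynomial.eval_pow, Polynomial.eval_X] at h0
  rw [← hc, ← h1, h0, sign_mul, sign_pos this, one_mul]

lemma eventually_sign_large (p : Polynomial ℝ) :
    ∀ᶠ η in atTop, SignType.sign (p.eval η) = SignType.sign p.leadingCoeff := by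
  by_cases hp : p = 0
  · simp [hp]
  obtain ⟨φ, hφ, h⟩ := p.isEquivalent_atTop_lead.exists_eq_mul
  filter_upwards [h, eventually_gt_atTop (0 : ℝ), hφ.eventually (lt_mem_nhds one_pos)]
    with η h1 h2 h3
  rw [h1]
  simp [sign_mul, sign_pos (pow_pos h2 _), sign_pos h3]

lemma support_eq_of_sign {p q : Polynomial ℝ}
    (h : ∀ i, SignType.sign (p.coeff i) = SignType.sign (q.coeff i)) : p.support = q.support := by
  ext i
  have := h i
  rw [Polynomial.mem_support_iff, Polynomial.mem_support_iff, ← sign_ne_zero, this, sign_ne_zero]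

lemma natDegree_eq_of_sign {p q : Polynomial ℝ}
    (h : ∀ i, SignType.sign (p.coeff i) = SignType.sign (q.coeff i)) :
    p.natDegree = q.natDegree := by
  rw [Polynomial.natDegree, Polynomial.degree, support_eq_of_sign h]
  rfl

lemma trailingCoeff_sign_congr {p q : Polynomial ℝ}
    (h : ∀ i, SignType.sign (p.coeff i) = SignType.sign (q.coeff i)) :
    SignType.sign p.trailingCoeff = SignType.sign q.trailingCoeff := by
  have : p.natTrailingDegree = q.natTrailingDegree := by
    rw [Polynomial.natTrailingDegree, Polynomial.trailingDegree, support_eq_of_sign h]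
    rfl
  rw [Polynomial.trailingCoeff, Polynomial.trailingCoeff, this, h]

lemma leadingCoeff_sign_congr {p q : Polynomial ℝ}
    (h : ∀ i, SignType.sign (p.coeff i) = SignType.sign (q.coeff i)) :
    SignType.sign p.leadingCoeff = SignType.sign q.leadingCoeff := by
  rw [Polynomial.leadingCoeff, Polynomial.leadingCoeff, natDegree_eq_of_sign h, h]

lemma Decided.of_germ {D : ℕ} {φ : (Option ι → ℝ) → α} (h : Decided D φ) (l : Filter ℝ) [l.NeBot]
    (lc : Polynomial ℝ → ℝ)
    (h1 : ∀ p : Polynomial ℝ, ∀ᶠ η in l, SignType.sign (p.eval η) = SignType.sign (lc p))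
    (h2 : ∀ p q : Polynomial ℝ, (∀ i, SignType.sign (p.coeff i) = SignType.sign (q.coeff i)) →
      SignType.sign (lc p) = SignType.sign (lc q)) :
    ∃ Φ : (ι → ℝ) → α, Decided D Φ ∧ ∀ z, ∀ᶠ η in l, φ (ext z η) = Φ z := by
  obtain ⟨G, hG, h⟩ := h
  have key : ∀ z, ∀ᶠ η in l, ∀ q ∈ G,
      SignType.sign (eval (ext z η) q) = SignType.sign (lc (slice q z)) := by
    intro z
    rw [hG.1.eventually_all]
    intro q hq
    filter_upwards [h1 (slice q z)] with η hη
    rw [← hη, eval_slice]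
  choose η hη using fun z => (key z).exists
  refine ⟨fun z => φ (ext z (η z)), ?_, fun z => ?_⟩
  · have := hG.1.to_subtype
    refine ⟨⋃ q : G, (fun i => (optionEquivLeft ℝ ι q.1).coeff i) '' (Set.Iic D),
      FinDeg.iUnion fun q => ⟨(Set.finite_Iic D).image _, ?_⟩, fun z z' hz => ?_⟩
    · rintro _ ⟨i, -, rfl⟩
      exact (totalDegree_coeff_optionEquivLeft_le ..).trans (hG.2 _ q.2)
    · refine h _ _ fun q hq => ?_
      rw [hη z q hq, hη z' q hq]
      refine h2 _ _ fun i => ?_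
      rcases le_or_gt i D with hi | hi
      · rw [coeff_slice, coeff_slice]
        exact hz _ (Set.mem_iUnion.2 ⟨⟨q, hq⟩, i, hi, rfl⟩)
      · rw [Polynomial.coeff_eq_zero_of_natDegree_lt ((natDegree_slice_le (hG.2 q hq) z).trans_lt hi),
          Polynomial.coeff_eq_zero_of_natDegree_lt ((natDegree_slice_le (hG.2 q hq) z').trans_lt hi)]
  · filter_upwards [key z] with t ht
    exact h _ _ fun q hq => (ht q hq).trans (hη z q hq).symm

lemma Decided.small {D : ℕ} {φ : (Option ι → ℝ) → α} (h : Decided D φ) :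
    ∃ Φ : (ι → ℝ) → α, Decided D Φ ∧ ∀ z, ∀ᶠ η in 𝓝[>] 0, φ (ext z η) = Φ z :=
  h.of_germ _ Polynomial.trailingCoeff eventually_sign_small fun _ _ => trailingCoeff_sign_congr

lemma Decided.large {D : ℕ} {φ : (Option ι → ℝ) → α} (h : Decided D φ) :
    ∃ Φ : (ι → ℝ) → α, Decided D Φ ∧ ∀ z, ∀ᶠ η in atTop, φ (ext z η) = Φ z :=
  h.of_germ _ Polynomial.leadingCoeff eventually_sign_large fun _ _ => leadingCoeff_sign_congr

/-- Polynomials with few degrees composed with polynomial functions. -/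
lemma PolyFn.comp {D K : ℕ} {f : (κ → ℝ) → ℝ} (hf : PolyFn D f) {ψ : κ → (ι → ℝ) → ℝ}
    (hψ : ∀ l, PolyFn K (ψ l)) : PolyFn (D * K) (fun z => f (fun l => ψ l z)) := by
  obtain ⟨q, hq, hf⟩ := hf
  have : ∀ z, f (fun l => ψ l z) = ∑ m ∈ q.support, q.coeff m * ∏ l ∈ m.support, ψ l z ^ m l := by
    intro z
    rw [hf, eval_eq]
  refine PolyFn.congr (PolyFn.sum _ fun m hm => PolyFn.const_mul ?_ _) this
  refine (PolyFn.prod _ fun l _ => (hψ l).pow (m l)).mono ?_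
  rw [← Finset.sum_mul]
  exact Nat.mul_le_mul_right _ ((le_totalDegree hm).trans hq)

lemma Decided.comp_polyFn {D K : ℕ} {φ : (κ → ℝ) → α} (hφ : Decided D φ) {ψ : κ → (ι → ℝ) → ℝ}
    (hψ : ∀ l, PolyFn K (ψ l)) : Decided (D * K) (fun z => φ (fun l => ψ l z)) := by
  obtain ⟨G, hG, h⟩ := hφ
  choose q hq hq' using fun f : G => (PolyFn.eval (hG.2 f.1 f.2)).comp hψ
  have := hG.1.to_subtype
  refine ⟨Set.range q, ⟨Set.finite_range _, ?_⟩, fun z z' hz => h _ _ fun f hf => ?_⟩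
  · rintro _ ⟨f, rfl⟩; exact hq f
  · have e1 := hq' ⟨f, hf⟩ z
    have e2 := hq' ⟨f, hf⟩ z'
    dsimp at e1 e2
    rw [e1, e2]
    exact hz _ ⟨_, rfl⟩

/-- Rational pullback of a polynomial function, after clearing an even power of the denominator. -/
lemma PolyFn.comp_div {D K : ℕ} {f : (κ → ℝ) → ℝ} (hf : PolyFn D f) {ψ : κ → (ι → ℝ) → ℝ}
    {f₀ : (ι → ℝ) → ℝ} (hψ : ∀ l, PolyFn K (ψ l)) (hf₀ : PolyFn K f₀) :
    ∃ g, PolyFn (2 * D * K) g ∧ ∀ z, f₀ z ≠ 0 →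
      SignType.sign (f (fun l => ψ l z / f₀ z)) = SignType.sign (g z) := by
  obtain ⟨q, hq, hf⟩ := hf
  refine ⟨fun z => ∑ m ∈ q.support, q.coeff m * (f₀ z ^ (2 * D - ∑ l ∈ m.support, m l) *
    ∏ l ∈ m.support, ψ l z ^ m l), ?_, fun z hz => ?_⟩
  · refine PolyFn.sum _ fun m hm => PolyFn.const_mul ?_ _
    have hle : ∑ l ∈ m.support, m l ≤ D := (le_totalDegree hm).trans hq
    refine ((hf₀.pow (2 * D - ∑ l ∈ m.support, m l)).mul
      (PolyFn.prod _ fun l _ => (hψ l).pow (m l))).mono ?_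
    rw [← Finset.sum_mul, ← add_mul]
    exact Nat.mul_le_mul_right _ (by omega)
  · have : ∑ m ∈ q.support, q.coeff m * (f₀ z ^ (2 * D - ∑ l ∈ m.support, m l) *
        ∏ l ∈ m.support, ψ l z ^ m l) = f₀ z ^ (2 * D) * f (fun l => ψ l z / f₀ z) := by
      rw [hf, eval_eq, Finset.mul_sum]
      refine Finset.sum_congr rfl fun m hm => ?_
      have hle : ∑ l ∈ m.support, m l ≤ 2 * D := ((le_totalDegree hm).trans hq).trans (by omega)
      rw [Finset.prod_congr rfl fun l _ => div_pow (ψ l z) (f₀ z) (m l), Finset.prod_div_distrib,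
        Finset.prod_pow_eq_pow_sum]
      have h2 : f₀ z ^ (2 * D) = f₀ z ^ (2 * D - ∑ l ∈ m.support, m l) *
          f₀ z ^ (∑ l ∈ m.support, m l) := by rw [← pow_add]; congr 1; omega
      rw [h2]
      field_simp
    dsimp only
    rw [this, sign_mul, pow_mul, sign_pos (pow_pos (by positivity) _), one_mul]

lemma Decided.comp_div {D K : ℕ} {φ : (κ → ℝ) → α} (hφ : Decided D φ) {ψ : κ → (ι → ℝ) → ℝ}
    {f₀ : (ι → ℝ) → ℝ} (hψ : ∀ l, PolyFn K (ψ l)) (hf₀ : PolyFn K f₀) (hD : 1 ≤ D) :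
    ∃ Φ : (ι → ℝ) → Option α, Decided (2 * D * K) Φ ∧
      (∀ z, f₀ z ≠ 0 → Φ z = some (φ (fun l => ψ l z / f₀ z))) ∧ ∀ z, f₀ z = 0 → Φ z = none := by
  classical
  refine ⟨fun z => if f₀ z = 0 then none else some (φ (fun l => ψ l z / f₀ z)), ?_,
    fun z hz => by simp [hz], fun z hz => by simp [hz]⟩
  obtain ⟨G, hG, h⟩ := hφ
  choose g hg hg' using fun f : G => (PolyFn.eval (hG.2 f.1 f.2)).comp_div hψ hf₀
  have := hG.1.to_subtype
  have h0 : Decided (2 * D * K) (fun z => SignType.sign (f₀ z)) :=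
    hf₀.decided.mono (by nlinarith)
  refine (h0.prodMk (Decided.pi fun f => (hg f).decided)).of_fun_eq fun z z' hz => ?_
  obtain ⟨hz0, hz1⟩ := Prod.ext_iff.1 hz
  have hiff : f₀ z = 0 ↔ f₀ z' = 0 := by
    rw [← sign_eq_zero_iff, ← sign_eq_zero_iff (a := f₀ z')]
    exact Eq.congr_left hz0
  by_cases hz : f₀ z = 0
  · simp [hz, hiff.1 hz]
  · have hz' := fun h => hz (hiff.2 h)
    rw [if_neg hz, if_neg hz']
    refine congrArg some (h _ _ fun f hf => ?_)
    have e1 := hg' ⟨f, hf⟩ z hz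
    have e2 := hg' ⟨f, hf⟩ z' hz'
    dsimp at e1 e2
    rw [e1, e2]
    exact congrFun hz1 ⟨f, hf⟩

end SemialgComp

namespace SemialgComp

section SignVariations

open Polynomial

lemma eraseLead_comp_neg_X (P : ℝ[X]) : (P.comp (-Polynomial.X)).eraseLead = P.eraseLead.comp (-Polynomial.X) := by
  have h : ∀ (Q : ℝ[X]) i, (Q.comp (-Polynomial.X)).coeff i = Q.coeff i * (-1) ^ i := by
    intro Q i
    have := comp_C_mul_X_coeff (p := Q) (r := -1) (n := i)
    simpa using this
  ext i
  rw [eraseLead_coeff, h, h, eraseLead_coeff, natDegree_comp, natDegree_neg, natDegree_X, mul_one]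
  split_ifs <;> simp

lemma signVariations_add_comp_neg_X_le (P : ℝ[X]) (hP : P ≠ 0) (t : ℕ)
    (ht : ∀ i < t, P.coeff i = 0) :
    P.signVariations + (P.comp (-Polynomial.X)).signVariations + t ≤ P.natDegree := by
  induction h : P.support.card using Nat.strong_induction_on generalizing P with
  | _ n ih =>
  have hP' : P.comp (-Polynomial.X) ≠ 0 := by
    intro h0
    have := congrArg (fun q => q.comp (-Polynomial.X)) h0
    simp [comp_assoc] at this
    exact hP this
  have htd : t ≤ P.natDegree := by
    by_contra hlt
    exact hP (leadingCoeff_eq_zero.1 (ht _ (not_le.1 hlt)))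
  by_cases he : P.eraseLead = 0
  · rw [signVariations_eq_eraseLead_add_ite hP, signVariations_eq_eraseLead_add_ite hP',
      eraseLead_comp_neg_X, he]
    simp [hP, htd]
  · have hlt := ih P.eraseLead.support.card (h ▸ eraseLead_support_card_lt hP) P.eraseLead he
      (fun i hi => by rw [eraseLead_coeff]; split_ifs <;> simp [ht i hi]) rfl
    have hd : P.eraseLead.natDegree < P.natDegree := by
      rcases eraseLead_natDegree_lt_or_eraseLead_eq_zero P with h | h
      · exact h
      · exact absurd h he
    rw [signVariations_eq_eraseLead_add_ite hP, signVariations_eq_eraseLead_add_ite hP',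
      eraseLead_comp_neg_X]
    rcases Nat.lt_or_ge (P.eraseLead.natDegree + 1) P.natDegree with h2 | h2
    · split_ifs <;> omega
    · have h3 : P.natDegree = P.eraseLead.natDegree + 1 := by omega
      have key : ¬ (SignType.sign P.leadingCoeff = -SignType.sign P.eraseLead.leadingCoeff ∧
          SignType.sign (P.comp (-Polynomial.X)).leadingCoeff =
            -SignType.sign (P.eraseLead.comp (-Polynomial.X)).leadingCoeff) := by
        rintro ⟨ha, hb⟩
        rw [comp_neg_X_leadingCoeff_eq, comp_neg_X_leadingCoeff_eq, sign_mul, sign_mul, ha, h3,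
          pow_succ] at hb
        have hne : SignType.sign P.eraseLead.leadingCoeff ≠ 0 :=
          sign_ne_zero.2 (leadingCoeff_ne_zero.2 he)
        have hne' : SignType.sign ((-1 : ℝ) ^ P.eraseLead.natDegree) ≠ 0 :=
          sign_ne_zero.2 (by positivity)
        rw [sign_mul, show SignType.sign (-1 : ℝ) = -1 by simp] at hb
        revert hb hne hne'
        generalize SignType.sign P.eraseLead.leadingCoeff = a
        generalize SignType.sign ((-1 : ℝ) ^ P.eraseLead.natDegree) = b
        revert a b
        decide
      split_ifs with h4 h5 h5
      · exact absurd ⟨h4, h5⟩ key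
      all_goals omega

lemma countP_pos_eq_signVariations {ι : Type} [Fintype ι] (l : ι → ℝ) :
    {i | 0 < l i}.ncard = (∏ i, (Polynomial.X - Polynomial.C (l i))).signVariations := by
  classical
  set P : ℝ[X] := ∏ i, (Polynomial.X - Polynomial.C (l i)) with hPdef
  have hP : P ≠ 0 := Finset.prod_ne_zero_iff.2 fun i _ => X_sub_C_ne_zero _
  have hdeg : P.natDegree = Fintype.card ι := by
    rw [hPdef, natDegree_prod_of_monic _ _ fun i _ => monic_X_sub_C _]; simp
  have hroots : P.roots = Finset.univ.val.map l := by
    have := roots_multiset_prod_X_sub_C (Finset.univ.val.map l)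
    rw [Multiset.map_map] at this
    exact this
  have hc : ∀ (p : ℝ → Prop) [DecidablePred p] (l : ι → ℝ),
      {i | p (l i)}.ncard = (Finset.univ.val.map l).countP p := by
    intro p _ l
    rw [Multiset.countP_map, Set.ncard_eq_toFinset_card', Set.toFinset_ofPred]
    rfl
  have h1 : {i | 0 < l i}.ncard ≤ P.signVariations := by
    rw [hc (fun x => 0 < x) l, ← hroots]
    exact roots_countP_pos_le_signVariations P
  have h2 : {i | l i < 0}.ncard ≤ (P.comp (-Polynomial.X)).signVariations := by
    refine le_trans (le_of_eq ?_) (roots_countP_pos_le_signVariations (P.comp (-Polynomial.X)))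
    have := hc (fun x => 0 < x) (fun i => - l i)
    simp only [neg_pos] at this
    rw [this, roots_comp_neg_X, hroots, Multiset.map_map]
    rfl
  have h3 : {i | l i = 0}.ncard + {i | l i < 0}.ncard + {i | 0 < l i}.ncard = Fintype.card ι := by
    rw [← Nat.card_eq_fintype_card, ← Set.ncard_univ, ← Set.ncard_union_eq, ← Set.ncard_union_eq]
    · congr 1
      ext i
      rcases lt_trichotomy (l i) 0 with h | h | h <;> simp [h]
    · rw [Set.disjoint_left]
      rintro i (h | h) h'
      · exact h'.ne' h
      · exact lt_asymm (Set.mem_ofPred.1 h) h'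
    · rw [Set.disjoint_left]
      intro i h h'
      exact h'.ne h
  have h4 := signVariations_add_comp_neg_X_le P hP {i | l i = 0}.ncard ?_
  · omega
  · have hdvd : Polynomial.X ^ {i | l i = 0}.ncard ∣ P := by
      have h5 := Finset.prod_dvd_prod_of_subset (Finset.univ.filter fun i => l i = 0) Finset.univ
        (fun i => Polynomial.X - Polynomial.C (l i)) (Finset.filter_subset _ _)
      rw [Finset.prod_congr rfl (g := fun _ => Polynomial.X) (by
        intro i hi
        simp [(Finset.mem_filter.1 hi).2]), Finset.prod_const] at h5
      convert h5
      rw [← Set.ncard_coe_finset]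
      simp
    exact fun i hi => X_pow_dvd_iff.1 hdvd i hi

end SignVariations

end SemialgComp

namespace SemialgComp

open Matrix

lemma toQuadraticForm'_apply {n : Type} [Fintype n] [DecidableEq n] (H : Matrix n n ℝ)
    (v : n → ℝ) : H.toQuadraticForm' v = v ⬝ᵥ (H *ᵥ v) := by
  simp [Matrix.toQuadraticForm', Matrix.toLinearMap₂'_apply']

lemma toQuadraticForm'_neg {n : Type} [Fintype n] [DecidableEq n] (H : Matrix n n ℝ) :
    (-H).toQuadraticForm' = -H.toQuadraticForm' := by
  ext v
  simp [toQuadraticForm'_apply, Matrix.neg_mulVec]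

lemma sigPos_toQuadraticForm' {n : Type} [Fintype n] [DecidableEq n] {H : Matrix n n ℝ}
    (hH : H.IsHermitian) : sigPos H.toQuadraticForm' = H.charpoly.signVariations := by
  set U : Matrix n n ℝ := hH.eigenvectorUnitary.1 with hU
  have h1 : star U * U = 1 := Unitary.coe_star_mul_self hH.eigenvectorUnitary
  have h2 : U * star U = 1 := Unitary.coe_mul_star_self hH.eigenvectorUnitary
  have hspec : H = U * diagonal hH.eigenvalues * star U := by
    conv_lhs => rw [hH.spectral_theorem, Unitary.conjStarAlgAut_apply]
    rfl
  have e : QuadraticMap.Equivalent H.toQuadraticForm'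
      (QuadraticMap.weightedSumSquares ℝ hH.eigenvalues) := by
    refine ⟨⟨Matrix.toLin'OfInv h2 h1, fun v => ?_⟩⟩
    have hv : H.toQuadraticForm' v = (star U *ᵥ v) ⬝ᵥ (diagonal hH.eigenvalues *ᵥ (star U *ᵥ v)) := by
      rw [toQuadraticForm'_apply]
      conv_lhs => rw [hspec]
      rw [← Matrix.mulVec_mulVec, ← Matrix.mulVec_mulVec, Matrix.dotProduct_mulVec v U,
        ← Matrix.mulVec_transpose]
      rfl
    rw [hv]
    simp only [QuadraticMap.weightedSumSquares_apply, dotProduct, Matrix.mulVec_diagonal, smul_eq_mul]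
    refine Finset.sum_congr rfl fun i _ => ?_
    have : (Matrix.toLin'OfInv h2 h1) v = star U *ᵥ v := rfl
    change _ * (((Matrix.toLin'OfInv h2 h1) v) i * ((Matrix.toLin'OfInv h2 h1) v) i) = _
    rw [this]
    ring
  rw [QuadraticForm.sigPos_of_equiv_weightedSumSquares e, hH.charpoly_eq]
  exact countP_pos_eq_signVariations hH.eigenvalues

lemma signVariations_congr {p q : Polynomial ℝ}
    (h : ∀ i, SignType.sign (p.coeff i) = SignType.sign (q.coeff i)) :
    p.signVariations = q.signVariations := by
  have hd : p.degree = q.degree := by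
    rw [Polynomial.degree, Polynomial.degree, support_eq_of_sign h]
  have : p.coeffList.map SignType.sign = q.coeffList.map SignType.sign := by
    rw [Polynomial.coeffList, Polynomial.coeffList, hd, List.map_map, List.map_map]
    exact List.map_congr_left fun i _ => h i
  rw [Polynomial.signVariations, Polynomial.signVariations, this]

variable {ι γ : Type}

/-- A polynomial-valued function whose coefficients are polynomial functions. -/
def CoeffPolyFn (D : ℕ) (f : (ι → ℝ) → Polynomial ℝ) : Prop :=
  ∀ i, PolyFn D (fun z => (f z).coeff i)

namespace CoeffPolyFn

lemma mono {D E : ℕ} {f : (ι → ℝ) → Polynomial ℝ} (h : CoeffPolyFn D f) (hD : D ≤ E) :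
    CoeffPolyFn E f := fun i => (h i).mono hD

lemma const (D : ℕ) (p : Polynomial ℝ) : CoeffPolyFn D (fun _ : ι → ℝ => p) :=
  fun _ => PolyFn.const _ _

lemma C {D : ℕ} {f : (ι → ℝ) → ℝ} (h : PolyFn D f) :
    CoeffPolyFn D (fun z => Polynomial.C (f z)) := fun i => by
  simp only [Polynomial.coeff_C]
  split_ifs
  · exact h
  · exact PolyFn.const _ _

lemma sum {D : ℕ} (s : Finset γ) {f : γ → (ι → ℝ) → Polynomial ℝ}
    (hf : ∀ i ∈ s, CoeffPolyFn D (f i)) : CoeffPolyFn D (fun z => ∑ i ∈ s, f i z) := fun j => by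
  simp only [Polynomial.finsetSum_coeff]
  exact PolyFn.sum _ fun i hi => hf i hi j

lemma mul {D E : ℕ} {f g : (ι → ℝ) → Polynomial ℝ} (hf : CoeffPolyFn D f)
    (hg : CoeffPolyFn E g) : CoeffPolyFn (D + E) (fun z => f z * g z) := fun j => by
  simp only [Polynomial.coeff_mul]
  exact PolyFn.sum _ fun i _ => (hf i.1).mul (hg i.2)

lemma sub {D : ℕ} {f g : (ι → ℝ) → Polynomial ℝ} (hf : CoeffPolyFn D f)
    (hg : CoeffPolyFn D g) : CoeffPolyFn D (fun z => f z - g z) := fun j => by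
  simp only [Polynomial.coeff_sub]
  exact (hf j).sub (hg j)

lemma prod (s : Finset γ) {D : γ → ℕ} {f : γ → (ι → ℝ) → Polynomial ℝ}
    (hf : ∀ i ∈ s, CoeffPolyFn (D i) (f i)) :
    CoeffPolyFn (∑ i ∈ s, D i) (fun z => ∏ i ∈ s, f i z) := by
  classical
  induction s using Finset.induction_on with
  | empty => simpa using const 0 1
  | insert a s ha ih =>
    simp only [Finset.prod_insert ha, Finset.sum_insert ha]
    exact (hf a (by simp)).mul (ih fun i hi => hf i (by simp [hi]))

lemma charpoly {n : Type} [Fintype n] [DecidableEq n] {D : ℕ} {M : (ι → ℝ) → Matrix n n ℝ}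
    (hM : ∀ i j, PolyFn D (fun z => M z i j)) :
    CoeffPolyFn (Fintype.card n * D) (fun z => (M z).charpoly) := by
  simp only [Matrix.charpoly, Matrix.det_apply']
  refine CoeffPolyFn.sum _ fun σ _ => ?_
  have h := CoeffPolyFn.prod Finset.univ (D := fun _ : n => D)
    (f := fun i z => (M z).charmatrix (σ i) i) (fun i _ => by
      simp only [Matrix.charmatrix_apply]
      exact (const _ _).sub (C (hM _ _)))
  refine ((const 0 _).mul h).mono (by simp)

lemma eval_const {D n : ℕ} {f : (ι → ℝ) → Polynomial ℝ} (hf : CoeffPolyFn D f)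
    (hn : ∀ z, (f z).natDegree ≤ n) (c : ℝ) : PolyFn D (fun z => (f z).eval c) := by
  refine PolyFn.congr (PolyFn.sum (Finset.range (n + 1)) fun i _ => (hf i).const_mul (c ^ i))
    fun z => ?_
  rw [Polynomial.eval_eq_sum_range' (Nat.lt_succ_of_le (hn z))]
  exact Finset.sum_congr rfl fun i _ => mul_comm _ _

end CoeffPolyFn

lemma CoeffPolyFn.decided_signVariations {D n : ℕ} {f : (ι → ℝ) → Polynomial ℝ}
    (hf : CoeffPolyFn D f) (hn : ∀ z, (f z).natDegree ≤ n) :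
    Decided D (fun z => (f z).signVariations) := by
  refine (Decided.pi (γ := Fin (n + 1)) fun i => (hf i).decided).of_fun_eq fun z z' h => ?_
  refine signVariations_congr fun i => ?_
  rcases Nat.lt_or_ge i (n + 1) with hi | hi
  · exact congrFun h ⟨i, hi⟩
  · rw [Polynomial.coeff_eq_zero_of_natDegree_lt ((hn z).trans_lt (by omega)),
      Polynomial.coeff_eq_zero_of_natDegree_lt ((hn z').trans_lt (by omega))]

/-- The signature of a symmetric matrix with polynomial entries is decided. -/
lemma decided_signature {n : Type} [Fintype n] [DecidableEq n] {D : ℕ}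
    {M : (ι → ℝ) → Matrix n n ℝ} (hs : ∀ z, (M z).IsHermitian)
    (hM : ∀ i j, PolyFn D (fun z => M z i j)) :
    Decided (Fintype.card n * D) (fun z => (sigPos (M z).toQuadraticForm' : ℤ) -
      sigNeg (M z).toQuadraticForm') := by
  have h1 := (CoeffPolyFn.charpoly hM).decided_signVariations (n := Fintype.card n)
    fun z => by rw [Matrix.charpoly_natDegree_eq_dim]
  have h2 := (CoeffPolyFn.charpoly (M := fun z => -M z) fun i j => (hM i j).neg).decided_signVariations
    (n := Fintype.card n) fun z => by rw [Matrix.charpoly_natDegree_eq_dim]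
  refine (h1.prodMk h2).of_fun_eq fun z z' h => ?_
  have key : ∀ z, sigNeg (M z).toQuadraticForm' = (-M z).charpoly.signVariations := fun z => by
    rw [← sigPos_toQuadraticForm' (hs z).neg, toQuadraticForm'_neg, sigPos_neg]
  rw [key, key, sigPos_toQuadraticForm' (hs z), sigPos_toQuadraticForm' (hs z')]
  obtain ⟨ha, hb⟩ := Prod.ext_iff.1 h
  simp only at ha hb
  rw [ha, hb]

end SemialgComp

namespace SemialgComp

section Newton

variable {r : ℕ}

/-- The coefficients of a polynomial of degree `r`, counted from the top. -/
noncomputable def topCoeff (r : ℕ) (p : Polynomial ℝ) (a : ℕ) : ℝ :=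
  if a ≤ r then p.coeff (r - a) else 0

lemma topCoeff_eq_esymm {ρ : Fin r → ℂ} {p : Polynomial ℝ}
    (hp : p.map Complex.ofRealHom = ∏ i, (Polynomial.X - Polynomial.C (ρ i))) (a : ℕ) :
    (topCoeff r p a : ℂ) = (-1) ^ a * (Finset.univ.val.map ρ).esymm a := by
  have hcard : (Finset.univ.val.map ρ).card = r := by simp
  rw [topCoeff]
  split_ifs with h
  · have h1 := Multiset.prod_X_sub_C_coeff (Finset.univ.val.map ρ) (k := r - a) (by omega)
    rw [Multiset.map_map, hcard] at h1
    have h2 : (p.map Complex.ofRealHom).coeff (r - a) = ((p.coeff (r - a) : ℝ) : ℂ) := by simp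
    rw [← h2, hp]
    rw [show r - (r - a) = a by omega] at h1
    exact h1
  · rw [Multiset.esymm, Multiset.powersetCard_eq_empty _ (by rw [hcard]; omega)]
    simp

lemma newton_powerSum {ρ : Fin r → ℂ} {p : Polynomial ℝ}
    (hp : p.map Complex.ofRealHom = ∏ i, (Polynomial.X - Polynomial.C (ρ i))) {k : ℕ} (hk : 0 < k) :
    ∑ i, ρ i ^ k = -(k * (topCoeff r p k : ℂ)) -
      ∑ a ∈ Finset.HasAntidiagonal.antidiagonal k with a.1 ∈ Set.Ioo 0 k,
        (topCoeff r p a.1 : ℂ) * ∑ i, ρ i ^ a.2 := by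
  have h := congrArg (aeval (R := ℤ) ρ) (psum_eq_mul_esymm_sub_sum (Fin r) ℤ k hk)
  simp only [psum, map_sum, map_pow, aeval_X, map_sub, map_mul, map_neg, map_one, map_natCast,
    aeval_esymm_eq_multiset_esymm] at h
  rw [h]
  congr 1
  · rw [topCoeff_eq_esymm hp, pow_succ]; ring
  · refine Finset.sum_congr rfl fun a _ => ?_
    rw [topCoeff_eq_esymm hp]

lemma powerSum_im {ρ : Fin r → ℂ} {p : Polynomial ℝ}
    (hp : p.map Complex.ofRealHom = ∏ i, (Polynomial.X - Polynomial.C (ρ i))) (k : ℕ) :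
    (((∑ i, ρ i ^ k).re : ℝ) : ℂ) = ∑ i, ρ i ^ k := by
  induction k using Nat.strong_induction_on with
  | _ k ih =>
  rcases Nat.eq_zero_or_pos k with rfl | hk
  · simp
  have : ∃ t : ℝ, ∑ i, ρ i ^ k = (t : ℂ) := by
    refine ⟨-(k * topCoeff r p k) - ∑ a ∈ Finset.HasAntidiagonal.antidiagonal k with a.1 ∈ Set.Ioo 0 k,
      topCoeff r p a.1 * (∑ i, ρ i ^ a.2).re, ?_⟩
    rw [newton_powerSum hp hk]
    push_cast
    congr 1
    refine Finset.sum_congr rfl fun a ha => ?_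
    simp only [Finset.mem_filter, Finset.HasAntidiagonal.mem_antidiagonal, Set.mem_Ioo] at ha
    rw [ih a.2 (by omega)]
  obtain ⟨t, ht⟩ := this
  rw [ht, Complex.ofReal_re]

lemma powerSum_re_polyFn {ι : Type} {A : ℕ} {p : (ι → ℝ) → Polynomial ℝ} {ρ : (ι → ℝ) → Fin r → ℂ}
    (hp : ∀ z, (p z).map Complex.ofRealHom = ∏ i, (Polynomial.X - Polynomial.C (ρ z i)))
    (hA : CoeffPolyFn A p) (k : ℕ) : PolyFn (k * A) (fun z => (∑ i, ρ z i ^ k).re) := by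
  induction k using Nat.strong_induction_on with
  | _ k ih =>
  rcases Nat.eq_zero_or_pos k with rfl | hk
  · simpa using PolyFn.const 0 _
  have ht : ∀ a, PolyFn A (fun z => topCoeff r (p z) a) := fun a => by
    unfold topCoeff
    split_ifs
    · exact hA _
    · exact PolyFn.const _ _
  have h1 : PolyFn (k * A) (fun z => -(k * topCoeff r (p z) k) -
      ∑ a ∈ Finset.HasAntidiagonal.antidiagonal k with a.1 ∈ Set.Ioo 0 k,
        topCoeff r (p z) a.1 * (∑ i, ρ z i ^ a.2).re) := by
    refine (((ht k).const_mul _).neg.mono (by nlinarith)).sub (PolyFn.sum _ fun a ha => ?_)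
    simp only [Finset.mem_filter, Finset.HasAntidiagonal.mem_antidiagonal, Set.mem_Ioo] at ha
    refine ((ht _).mul (ih a.2 (by omega))).mono ?_
    calc A + a.2 * A = (a.2 + 1) * A := by ring
      _ ≤ k * A := Nat.mul_le_mul_right _ (by omega)
  refine h1.congr fun z => ?_
  have h2 : ∑ i, ρ z i ^ k = ((-(k * topCoeff r (p z) k) -
      ∑ a ∈ Finset.HasAntidiagonal.antidiagonal k with a.1 ∈ Set.Ioo 0 k,
        topCoeff r (p z) a.1 * (∑ i, ρ z i ^ a.2).re : ℝ) : ℂ) := by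
    rw [newton_powerSum (hp z) hk]
    push_cast
    congr 1
    exact Finset.sum_congr rfl fun a _ => by rw [powerSum_im (hp z)]
  rw [h2, Complex.ofReal_re]

end Newton

end SemialgComp

namespace SemialgComp

section Hermite

open Matrix

variable {r : ℕ}

/-- The Hermite matrix of a polynomial `h` at the points `ρ`. -/
noncomputable def hermiteMat (ρ : Fin r → ℂ) (h : Polynomial ℝ) : Matrix (Fin r) (Fin r) ℝ :=
  Matrix.of fun i j => (∑ l, Polynomial.aeval (ρ l) h * ρ l ^ (i + j : ℕ)).re

/-- The polynomial with coefficient vector `v`, evaluated at a complex number. -/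
noncomputable def vecEval (v : Fin r → ℝ) (w : ℂ) : ℂ := ∑ i, (v i : ℂ) * w ^ (i : ℕ)

lemma vecEval_conj (v : Fin r → ℝ) (w : ℂ) :
    vecEval v ((starRingEnd ℂ) w) = (starRingEnd ℂ) (vecEval v w) := by
  simp [vecEval, map_sum]

lemma aeval_conj' (h : Polynomial ℝ) (w : ℂ) :
    Polynomial.aeval ((starRingEnd ℂ) w) h = (starRingEnd ℂ) (Polynomial.aeval w h) :=
  Polynomial.aeval_conj h w

lemma hermiteMat_isHermitian (ρ : Fin r → ℂ) (h : Polynomial ℝ) :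
    (hermiteMat ρ h).IsHermitian := by
  ext i j
  simp [hermiteMat, Matrix.conjTranspose_apply, add_comm]

lemma hermiteMat_neg (ρ : Fin r → ℂ) (h : Polynomial ℝ) :
    hermiteMat ρ (-h) = -hermiteMat ρ h := by
  ext i j
  simp [hermiteMat]

lemma hermiteMat_mulVec (ρ : Fin r → ℂ) (h : Polynomial ℝ) (v : Fin r → ℝ) (i : Fin r) :
    (hermiteMat ρ h *ᵥ v) i = (∑ l, Polynomial.aeval (ρ l) h * ρ l ^ (i : ℕ) * vecEval v (ρ l)).re := by
  simp only [mulVec, dotProduct, hermiteMat, Matrix.of_apply, vecEval, Finset.mul_sum]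
  rw [Finset.sum_comm, Complex.re_sum]
  refine Finset.sum_congr rfl fun j _ => ?_
  rw [← Complex.re_mul_ofReal, Finset.sum_mul]
  congr 1
  refine Finset.sum_congr rfl fun l _ => ?_
  rw [pow_add]; ring

lemma hermiteMat_form (ρ : Fin r → ℂ) (h : Polynomial ℝ) (v : Fin r → ℝ) :
    (hermiteMat ρ h).toQuadraticForm' v =
      ∑ l, (Polynomial.aeval (ρ l) h * vecEval v (ρ l) ^ 2).re := by
  rw [toQuadraticForm'_apply, dotProduct]
  simp only [hermiteMat_mulVec]
  rw [← Complex.re_sum]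
  have : ∀ i : Fin r, v i * (∑ l, Polynomial.aeval (ρ l) h * ρ l ^ (i : ℕ) * vecEval v (ρ l)).re =
      (∑ l, (v i : ℂ) * (Polynomial.aeval (ρ l) h * ρ l ^ (i : ℕ) * vecEval v (ρ l))).re := fun i => by
    rw [← Finset.mul_sum, Complex.re_ofReal_mul]
  simp only [this]
  rw [← Complex.re_sum, Finset.sum_comm]
  congr 1
  refine Finset.sum_congr rfl fun l _ => ?_
  rw [pow_two]
  conv_rhs => rw [vecEval, Finset.sum_mul, Finset.mul_sum]
  refine Finset.sum_congr rfl fun i _ => ?_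
  simp only [vecEval]
  ring

/-- The points that contribute to the positive part of the signature. -/
noncomputable def posPoints (ρ : Fin r → ℂ) (h : Polynomial ℝ) : Finset ℂ :=
  (Finset.univ.image ρ).filter fun w =>
    (w.im = 0 ∧ 0 < (Polynomial.aeval w h).re) ∨ (0 < w.im ∧ Polynomial.aeval w h ≠ 0)

lemma im_aeval_eq_zero {w : ℂ} (hw : w.im = 0) (h : Polynomial ℝ) :
    (Polynomial.aeval w h).im = 0 := by
  have := aeval_conj' h w
  rw [Complex.conj_eq_iff_im.2 hw] at this
  exact Complex.conj_eq_iff_im.1 this.symm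

lemma im_vecEval_eq_zero {w : ℂ} (hw : w.im = 0) (v : Fin r → ℝ) : (vecEval v w).im = 0 := by
  have := vecEval_conj v w
  rw [Complex.conj_eq_iff_im.2 hw] at this
  exact Complex.conj_eq_iff_im.1 this.symm

lemma sigPos_hermiteMat_le {ρ : Fin r → ℂ}
    (hconj : ∀ w ∈ Finset.univ.image ρ, (starRingEnd ℂ) w ∈ Finset.univ.image ρ)
    (h : Polynomial ℝ) :
    sigPos (hermiteMat ρ h).toQuadraticForm' ≤ (posPoints ρ h).card := by
  classical
  have hs : ∀ w : ℂ, ∃ s : ℂ, s ^ 2 = Polynomial.aeval w h := fun w => by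
    exact IsAlgClosed.exists_pow_nat_eq _ (by norm_num)
  choose s hs using hs
  let L : (Fin r → ℝ) →ₗ[ℝ] (posPoints ρ h → ℝ) :=
    { toFun := fun v w => (s w * vecEval v w).re
      map_add' := fun v v' => by
        ext w
        simp only [Pi.add_apply, vecEval]
        rw [← Complex.add_re, ← mul_add, ← Finset.sum_add_distrib]
        congr 3; ext i; push_cast; ring
      map_smul' := fun c v => by
        ext w
        simp only [Pi.smul_apply, vecEval, smul_eq_mul, RingHom.id_apply]
        rw [← Complex.re_ofReal_mul, mul_left_comm]
        congr 2
        rw [Finset.mul_sum]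
        exact Finset.sum_congr rfl fun i _ => by push_cast; ring }
  have hterm : ∀ w ∈ Finset.univ.image ρ, 0 ≤ w.im → ∀ v, L v = 0 →
      (Polynomial.aeval w h * vecEval v w ^ 2).re ≤ 0 := by
    intro w hw him v hv
    by_cases hwP : w ∈ posPoints ρ h
    · have h1 : (s w * vecEval v w).re = 0 := congrFun hv ⟨w, hwP⟩
      rw [← hs w, ← mul_pow, pow_two, Complex.mul_re, h1]
      nlinarith [sq_nonneg (s w * vecEval v w).im]
    · simp only [posPoints, Finset.mem_filter, not_and, not_or, not_not] at hwP
      obtain ⟨h1, h2⟩ := hwP hw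
      rcases him.eq_or_lt with h0 | h0
      · have h3 := h1 h0.symm
        have h4 := im_aeval_eq_zero h0.symm h
        have h5 := im_vecEval_eq_zero h0.symm v
        rw [Complex.mul_re, h4, pow_two, Complex.mul_re, h5]
        nlinarith [sq_nonneg (vecEval v w).re]
      · rw [h2 h0]; simp
  have hV : ∀ v ∈ LinearMap.ker L, (hermiteMat ρ h).toQuadraticForm' v ≤ 0 := by
    intro v hv
    rw [LinearMap.mem_ker] at hv
    rw [hermiteMat_form]
    refine Finset.sum_nonpos fun l _ => ?_
    have hl : ρ l ∈ Finset.univ.image ρ := Finset.mem_image_of_mem _ (Finset.mem_univ l)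
    rcases le_or_gt 0 (ρ l).im with h0 | h0
    · exact hterm _ hl h0 v hv
    · have := hterm _ (hconj _ hl) (by simp; exact h0.le) v hv
      rw [aeval_conj', vecEval_conj, ← map_pow, ← map_mul, Complex.conj_re] at this
      exact this
  have h1 := QuadraticForm.sigPos_add_finrank_le_of_nonpos hV
  have h2 := LinearMap.finrank_range_add_finrank_ker L
  have h3 : Module.finrank ℝ (LinearMap.range L) ≤ (posPoints ρ h).card := by
    refine (Submodule.finrank_le _).trans ?_
    simp
  omega

lemma sum_aeval_real {ρ : Fin r → ℂ} {p : Polynomial ℝ}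
    (hp : p.map Complex.ofRealHom = ∏ i, (Polynomial.X - Polynomial.C (ρ i))) (f : Polynomial ℝ) :
    (∑ l, Polynomial.aeval (ρ l) f).im = 0 := by
  induction f using Polynomial.induction_on' with
  | add f g hf hg => simp [Finset.sum_add_distrib] at *; linarith
  | monomial n a =>
    simp only [Polynomial.aeval_monomial, Complex.coe_algebraMap]
    rw [← Finset.mul_sum, ← powerSum_im hp]
    simp

lemma finrank_radical_hermiteMat {ρ : Fin r → ℂ} {p : Polynomial ℝ}
    (hp : p.map Complex.ofRealHom = ∏ i, (Polynomial.X - Polynomial.C (ρ i))) (h : Polynomial ℝ) :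
    Module.finrank ℝ (hermiteMat ρ h).toQuadraticForm'.radical +
      ((Finset.univ.image ρ).filter fun w => Polynomial.aeval w h ≠ 0).card ≤ r := by
  classical
  set S := Finset.univ.image ρ with hS
  set S' := S.filter fun w => Polynomial.aeval w h ≠ 0 with hS'
  have hSr : S.card ≤ r := Finset.card_image_le.trans (by simp)
  have hS'S : S'.card ≤ S.card := Finset.card_filter_le _ _
  have key : ∀ v ∈ (hermiteMat ρ h).toQuadraticForm'.radical, ∀ w ∈ S', vecEval v w = 0 := by
    intro v hv w hw
    have hHv : hermiteMat ρ h *ᵥ v = 0 := by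
      rw [QuadraticMap.mem_radical_iff'] at hv
      obtain ⟨h0, h1⟩ := hv
      have h2 : ∀ n, n ⬝ᵥ (hermiteMat ρ h *ᵥ v) = 0 := fun n => by
        have h3 := h1 n
        rw [toQuadraticForm'_apply] at h0 h3
        rw [toQuadraticForm'_apply, mulVec_add, dotProduct_add, add_dotProduct, add_dotProduct] at h3
        have h4 : v ⬝ᵥ (hermiteMat ρ h *ᵥ n) = n ⬝ᵥ (hermiteMat ρ h *ᵥ v) := by
          rw [dotProduct_mulVec, ← mulVec_transpose, dotProduct_comm]
          congr 2
          exact (hermiteMat_isHermitian ρ h)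
        linarith
      exact dotProduct_self_eq_zero.1 (h2 _)
    have hpow : ∀ i < r, ∑ l, Polynomial.aeval (ρ l) h * ρ l ^ i * vecEval v (ρ l) = 0 := by
      intro i hi
      apply Complex.ext
      · have := congrFun hHv ⟨i, hi⟩
        rw [hermiteMat_mulVec] at this
        exact this
      · have := sum_aeval_real hp (h * Polynomial.X ^ i *
          ∑ j : Fin r, Polynomial.C (v j) * Polynomial.X ^ (j : ℕ))
        simpa [vecEval] using this
    have hwS : w ∈ S := (Finset.mem_filter.1 hw).1
    have hg : ∀ g : Polynomial ℂ, g.natDegree < r →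
        ∑ l, Polynomial.aeval (ρ l) h * g.eval (ρ l) * vecEval v (ρ l) = 0 := by
      intro g hg
      simp only [Polynomial.eval_eq_sum_range' hg, Finset.mul_sum, Finset.sum_mul]
      rw [Finset.sum_comm]
      refine Finset.sum_eq_zero fun i hi => ?_
      have := congrArg (g.coeff i * ·) (hpow i (Finset.mem_range.1 hi))
      simp only [mul_zero, Finset.mul_sum] at this
      rw [← this]
      exact Finset.sum_congr rfl fun l _ => by ring
    have h5 := hg (∏ w' ∈ S.erase w, (Polynomial.X - Polynomial.C w')) (by
      rw [Polynomial.natDegree_prod_of_monic _ _ fun i _ => Polynomial.monic_X_sub_C i]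
      simp only [Polynomial.natDegree_X_sub_C, Finset.sum_const, smul_eq_mul, mul_one,
        Finset.card_erase_of_mem hwS]
      have := Finset.card_pos.2 ⟨w, hwS⟩
      omega)
    have h6 : ∀ l, Polynomial.aeval (ρ l) h *
        (∏ w' ∈ S.erase w, (Polynomial.X - Polynomial.C w')).eval (ρ l) * vecEval v (ρ l) =
        if ρ l = w then Polynomial.aeval w h *
        (∏ w' ∈ S.erase w, (Polynomial.X - Polynomial.C w')).eval w * vecEval v w else 0 := by
      intro l
      split_ifs with hl
      · rw [hl]
      · have : (∏ w' ∈ S.erase w, (Polynomial.X - Polynomial.C w')).eval (ρ l) = 0 := by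
          rw [Polynomial.eval_prod]
          exact Finset.prod_eq_zero (Finset.mem_erase.2 ⟨hl, Finset.mem_image_of_mem _
            (Finset.mem_univ l)⟩) (by simp)
        rw [this]; simp
    simp only [h6] at h5
    rw [← Finset.sum_filter, Finset.sum_const, nsmul_eq_mul] at h5
    obtain ⟨l, -, hl⟩ := Finset.mem_image.1 hwS
    have h7 : (∏ w' ∈ S.erase w, (Polynomial.X - Polynomial.C w')).eval w ≠ 0 := by
      rw [Polynomial.eval_prod]
      refine Finset.prod_ne_zero_iff.2 fun w' hw' => ?_
      simpa [sub_eq_zero] using (Finset.mem_erase.1 hw').1.symm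
    have h8 : ((Finset.univ.filter fun l => ρ l = w).card : ℂ) ≠ 0 := by
      rw [Nat.cast_ne_zero]
      exact (Finset.card_pos.2 ⟨l, by simp [hl]⟩).ne'
    have h9 := (Finset.mem_filter.1 hw).2
    rcases mul_eq_zero.1 h5 with h | h
    · exact absurd h h8
    · rcases mul_eq_zero.1 h with h | h
      · exact absurd h (mul_ne_zero h9 h7)
      · exact h
  let R : (hermiteMat ρ h).toQuadraticForm'.radical →ₗ[ℝ] (Fin (r - S'.card) → ℝ) :=
    { toFun := fun v i => v.1 ⟨S'.card + i, by omega⟩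
      map_add' := fun v v' => rfl
      map_smul' := fun c v => rfl }
  have hR : Function.Injective R := by
    rw [← LinearMap.ker_eq_bot, LinearMap.ker_eq_bot']
    rintro ⟨v, hv⟩ hRv
    have hcoef : ∀ i : Fin r, S'.card ≤ i → v i = 0 := fun i hi => by
      have := congrFun hRv ⟨i - S'.card, by omega⟩
      have h2 : v ⟨S'.card + (i - S'.card), by omega⟩ = 0 := this
      rw [← h2]; congr 1; ext; simp; omega
    let f : Polynomial ℂ := ∑ i : Fin r, Polynomial.C (v i : ℂ) * Polynomial.X ^ (i : ℕ)
    have hf : f = 0 := by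
      refine Polynomial.eq_zero_of_degree_lt_of_eval_finset_eq_zero S' ?_ fun w hw => ?_
      · rw [Polynomial.degree_lt_iff_coeff_zero]
        intro m hm
        simp only [f, Polynomial.finsetSum_coeff, Polynomial.coeff_C_mul, Polynomial.coeff_X_pow]
        refine Finset.sum_eq_zero fun i _ => ?_
        split_ifs with him
        · rw [hcoef i (by omega)]; simp
        · simp
      · have := key v hv w hw
        simpa [f, Polynomial.eval_finsetSum, vecEval] using this
    ext i
    have := congrArg (fun q => q.coeff (i : ℕ)) hf
    simp only [f, Polynomial.finsetSum_coeff, Polynomial.coeff_C_mul, Polynomial.coeff_X_pow,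
      Polynomial.coeff_zero] at this
    rw [Finset.sum_eq_single i (fun j _ hj => by
      rw [if_neg (fun h => hj (Fin.ext h.symm)), mul_zero]) (by simp)] at this
    simpa using this
  have := LinearMap.finrank_le_finrank_of_injective hR
  simp only [Module.finrank_fintype_fun_eq_card, Fintype.card_fin] at this
  omega

lemma signature_hermiteMat {ρ : Fin r → ℂ} {p : Polynomial ℝ} (hp0 : p ≠ 0)
    (hp : p.map Complex.ofRealHom = ∏ i, (Polynomial.X - Polynomial.C (ρ i))) (h : Polynomial ℝ) :
    (sigPos (hermiteMat ρ h).toQuadraticForm' : ℤ) - sigNeg (hermiteMat ρ h).toQuadraticForm' =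
      ∑ x ∈ p.roots.toFinset, (SignType.sign (h.eval x) : ℤ) := by
  classical
  set S := Finset.univ.image ρ with hS
  have hSroot : ∀ w, w ∈ S ↔ Polynomial.aeval w p = 0 := fun w => by
    have h1 : Polynomial.aeval w p = (p.map Complex.ofRealHom).eval w := by
      rw [Polynomial.eval_map]; rfl
    rw [h1, hp, Polynomial.eval_prod, Finset.prod_eq_zero_iff, hS, Finset.mem_image]
    simp [sub_eq_zero, eq_comm]
  have hconj : ∀ w ∈ S, (starRingEnd ℂ) w ∈ S := fun w hw => by
    rw [hSroot] at hw ⊢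
    rw [aeval_conj', hw, map_zero]
  have h1 := sigPos_hermiteMat_le hconj h
  have h2 := sigPos_hermiteMat_le hconj (-h)
  rw [hermiteMat_neg, toQuadraticForm'_neg, sigPos_neg] at h2
  have h3 := finrank_radical_hermiteMat hp h
  rw [← hS] at h3
  have h4 := QuadraticForm.sigPos_add_sigNeg_add_radical (Q := (hermiteMat ρ h).toQuadraticForm')
  simp only [Module.finrank_fintype_fun_eq_card, Fintype.card_fin] at h4
  let P := S.filter fun w => w.im = 0 ∧ 0 < (Polynomial.aeval w h).re
  let N := S.filter fun w => w.im = 0 ∧ (Polynomial.aeval w h).re < 0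
  let U := S.filter fun w => 0 < w.im ∧ Polynomial.aeval w h ≠ 0
  let V := S.filter fun w => w.im < 0 ∧ Polynomial.aeval w h ≠ 0
  have hUV : V.card = U.card := by
    refine Finset.card_bij (fun w _ => (starRingEnd ℂ) w) ?_ ?_ ?_
    · intro w hw
      simp only [V, U, Finset.mem_filter] at hw ⊢
      refine ⟨hconj _ hw.1, by simpa using hw.2.1, ?_⟩
      rw [aeval_conj']
      simpa using hw.2.2
    · intro a _ b _ hab
      exact (starRingEnd ℂ).injective hab
    · intro w hw
      simp only [V, U, Finset.mem_filter] at hw ⊢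
      refine ⟨(starRingEnd ℂ) w, ⟨hconj _ hw.1, by simpa using hw.2.1, ?_⟩, by simp⟩
      rw [aeval_conj']
      simpa using hw.2.2
  have c1 : (posPoints ρ h).card = P.card + U.card := by
    rw [← Finset.card_union_of_disjoint]
    · congr 1
      ext w
      simp only [posPoints, P, U, Finset.mem_filter, Finset.mem_union]
      tauto
    · rw [Finset.disjoint_left]
      intro w hw hw'
      simp only [P, U, Finset.mem_filter] at hw hw'
      linarith [hw.2.1, hw'.2.1]
  have c2 : (posPoints ρ (-h)).card = N.card + U.card := by
    rw [← Finset.card_union_of_disjoint]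
    · congr 1
      ext w
      simp only [posPoints, N, U, Finset.mem_filter, Finset.mem_union, map_neg, Complex.neg_re,
        neg_ne_zero, Left.neg_pos_iff]
      tauto
    · rw [Finset.disjoint_left]
      intro w hw hw'
      simp only [N, U, Finset.mem_filter] at hw hw'
      linarith [hw.2.1, hw'.2.1]
  have c3 : P.card + N.card + U.card + V.card ≤
      (S.filter fun w => Polynomial.aeval w h ≠ 0).card := by
    rw [← Finset.card_union_of_disjoint, ← Finset.card_union_of_disjoint,
      ← Finset.card_union_of_disjoint]
    · refine Finset.card_le_card fun w hw => ?_
      simp only [P, N, U, V, Finset.mem_union, Finset.mem_filter] at hw ⊢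
      rcases hw with ((h|h)|h)|h
      · exact ⟨h.1, fun h0 => by have := h.2.2; rw [h0] at this; simp at this⟩
      · exact ⟨h.1, fun h0 => by have := h.2.2; rw [h0] at this; simp at this⟩
      · exact ⟨h.1, h.2.2⟩
      · exact ⟨h.1, h.2.2⟩
    all_goals
      rw [Finset.disjoint_left]
      intro w hw hw'
      simp only [P, N, U, V, Finset.mem_union, Finset.mem_filter] at hw hw'
      grind
  have hdiff : (sigPos (hermiteMat ρ h).toQuadraticForm' : ℤ) -
      sigNeg (hermiteMat ρ h).toQuadraticForm' = (P.card : ℤ) - N.card := by omega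
  rw [hdiff]
  have hval : ∀ x : ℝ, Polynomial.aeval (x : ℂ) h = ((h.eval x : ℝ) : ℂ) := fun x => by
    have := Polynomial.aeval_algebraMap_apply ℂ x h
    simpa using this
  have hvalp : ∀ x : ℝ, Polynomial.aeval (x : ℂ) p = ((p.eval x : ℝ) : ℂ) := fun x => by
    have := Polynomial.aeval_algebraMap_apply ℂ x p
    simpa using this
  have hcard : ∀ Z : ℝ → Prop, (S.filter fun w => w.im = 0 ∧ Z (Polynomial.aeval w h).re).card =
      (p.roots.toFinset.filter fun x => Z (h.eval x)).card := by
    intro Z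
    symm
    refine Finset.card_bij (fun x _ => (x : ℂ)) ?_ ?_ ?_
    · intro x hx
      simp only [Finset.mem_filter, Multiset.mem_toFinset, Polynomial.mem_roots hp0,
        Polynomial.IsRoot.def] at hx ⊢
      refine ⟨?_, by simp, ?_⟩
      · rw [hSroot, hvalp, hx.1]; simp
      · rw [hval]; simpa using hx.2
    · intro a _ b _ hab
      exact_mod_cast hab
    · intro w hw
      simp only [Finset.mem_filter, Multiset.mem_toFinset, Polynomial.mem_roots hp0,
        Polynomial.IsRoot.def] at hw ⊢
      obtain ⟨ha, hb, hc⟩ := hw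
      have hw' : w = (w.re : ℂ) := Complex.ext (by simp) (by simpa using hb)
      refine ⟨w.re, ⟨?_, ?_⟩, hw'.symm⟩
      · rw [hSroot, hw', hvalp] at ha
        exact_mod_cast ha
      · rw [hw', hval] at hc
        simpa using hc
  have e1 : P.card = (p.roots.toFinset.filter fun x => 0 < h.eval x).card := hcard (fun y => 0 < y)
  have e2 : N.card = (p.roots.toFinset.filter fun x => h.eval x < 0).card := hcard (fun y => y < 0)
  rw [e1, e2]
  have : ∀ x : ℝ, ((SignType.sign (h.eval x) : SignType) : ℤ) =
      (if 0 < h.eval x then 1 else 0) - (if h.eval x < 0 then 1 else 0) := fun x => by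
    rcases lt_trichotomy (h.eval x) 0 with h0 | h0 | h0
    · simp [sign_neg h0, h0, h0.not_gt]
    · simp [h0]
    · simp [sign_pos h0, h0, h0.not_gt]
  simp only [this, Finset.sum_sub_distrib]
  simp

end Hermite

end SemialgComp

namespace SemialgComp

variable {ι α : Type}

lemma exists_complex_roots {r : ℕ} {p : Polynomial ℝ} (hm : p.Monic) (hr : p.natDegree = r) :
    ∃ ρ : Fin r → ℂ, p.map Complex.ofRealHom = ∏ i, (Polynomial.X - Polynomial.C (ρ i)) := by
  set q := p.map Complex.ofRealHom with hq
  have hs : q.Splits := IsAlgClosed.splits q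
  have hmq : q.Monic := hm.map _
  have hcard : Multiset.card q.roots = r := by
    rw [← hs.natDegree_eq_card_roots, hq, hm.natDegree_map, hr]
  obtain ⟨l, hl⟩ := Quot.exists_rep q.roots
  replace hl : (l : Multiset ℂ) = q.roots := hl
  rw [← hl, Multiset.coe_card] at hcard
  subst hcard
  refine ⟨fun i => l[(i : ℕ)], ?_⟩
  conv_lhs => rw [hs.eq_prod_roots_of_monic hmq, ← hl]
  simp only
  rw [Fin.prod_univ_fun_getElem l fun w => Polynomial.X - Polynomial.C w, Multiset.map_coe,
    Multiset.prod_coe]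

/-- The Tarski query of `h` at the roots of `p`. -/
noncomputable def tarskiQuery (p h : Polynomial ℝ) : ℤ :=
  ∑ x ∈ p.roots.toFinset, (SignType.sign (h.eval x) : ℤ)

/-- The polynomial `p`, rescaled to a monic one of degree `r`. -/
noncomputable def monicize (r : ℕ) (p : Polynomial ℝ) : Polynomial ℝ :=
  Polynomial.X ^ r + ∑ i ∈ Finset.range r,
    Polynomial.C (p.coeff i * p.coeff r ^ (r - 1 - i)) * Polynomial.X ^ i

/-- The polynomial `h`, rescaled along with `monicize`. -/
noncomputable def rescale (E : ℕ) (a : ℝ) (h : Polynomial ℝ) : Polynomial ℝ :=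
  ∑ i ∈ Finset.range (E + 1), Polynomial.C (h.coeff i * a ^ (2 * E - i)) * Polynomial.X ^ i

lemma monicize_degree_lt (r : ℕ) (p : Polynomial ℝ) : (∑ i ∈ Finset.range r,
    Polynomial.C (p.coeff i * p.coeff r ^ (r - 1 - i)) * Polynomial.X ^ i).degree < (r : WithBot ℕ) := by
  rw [Polynomial.degree_lt_iff_coeff_zero]
  intro m hm
  simp only [Polynomial.finsetSum_coeff, Polynomial.coeff_C_mul, Polynomial.coeff_X_pow]
  refine Finset.sum_eq_zero fun i hi => ?_
  rw [if_neg (by have := Finset.mem_range.1 hi; omega), mul_zero]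

lemma monicize_monic (r : ℕ) (p : Polynomial ℝ) : (monicize r p).Monic :=
  Polynomial.monic_X_pow_add (monicize_degree_lt r p)

lemma monicize_natDegree (r : ℕ) (p : Polynomial ℝ) : (monicize r p).natDegree = r := by
  rw [monicize]
  exact Polynomial.natDegree_eq_of_degree_eq_some (by
    rw [Polynomial.degree_add_eq_left_of_degree_lt] <;> rw [Polynomial.degree_X_pow]
    exact monicize_degree_lt r p)

lemma monicize_eval {r : ℕ} {p : Polynomial ℝ} (hr : p.natDegree = r) (x : ℝ) :
    p.coeff r * (monicize r p).eval (p.coeff r * x) = p.coeff r ^ r * p.eval x := by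
  rw [monicize, Polynomial.eval_add, Polynomial.eval_finsetSum,
    Polynomial.eval_eq_sum_range' (p := p) (n := r + 1) (by omega), Finset.sum_range_succ, mul_add, mul_add,
    add_comm, Finset.mul_sum, Finset.mul_sum]
  congr 1
  · refine Finset.sum_congr rfl fun i hi => ?_
    have hi := Finset.mem_range.1 hi
    simp only [Polynomial.eval_mul, Polynomial.eval_C, Polynomial.eval_pow, Polynomial.eval_X]
    have : p.coeff r ^ r = p.coeff r ^ (r - 1 - i) * p.coeff r ^ i * p.coeff r := by
      rw [← pow_add, ← pow_succ]; congr 1; omega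
    rw [this, mul_pow]; ring
  · simp only [Polynomial.eval_pow, Polynomial.eval_X, mul_pow]; ring

lemma rescale_eval {E : ℕ} {h : Polynomial ℝ} (hE : h.natDegree ≤ E) (a x : ℝ) :
    (rescale E a h).eval (a * x) = a ^ (2 * E) * h.eval x := by
  rw [rescale, Polynomial.eval_finsetSum, Polynomial.eval_eq_sum_range' (n := E + 1) (by omega),
    Finset.mul_sum]
  refine Finset.sum_congr rfl fun i hi => ?_
  have hi := Finset.mem_range.1 hi
  simp only [Polynomial.eval_mul, Polynomial.eval_C, Polynomial.eval_pow, Polynomial.eval_X]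
  have : a ^ (2 * E) = a ^ (2 * E - i) * a ^ i := by
    rw [← pow_add]; congr 1; omega
  rw [this, mul_pow]; ring

lemma tarskiQuery_monicize {p h : Polynomial ℝ} {E : ℕ} (hp : p ≠ 0) (hE : h.natDegree ≤ E) :
    tarskiQuery (monicize p.natDegree p) (rescale E p.leadingCoeff h) = tarskiQuery p h := by
  set r := p.natDegree with hr
  have ha : p.coeff r ≠ 0 := by rwa [hr, Polynomial.coeff_natDegree, Polynomial.leadingCoeff_ne_zero]
  symm
  refine Finset.sum_bij (fun x _ => p.coeff r * x) ?_ ?_ ?_ ?_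
  · intro x hx
    rw [Multiset.mem_toFinset, Polynomial.mem_roots hp, Polynomial.IsRoot.def] at hx
    rw [Multiset.mem_toFinset, Polynomial.mem_roots (monicize_monic _ _).ne_zero,
      Polynomial.IsRoot.def]
    have := monicize_eval hr.symm x
    rw [hx, mul_zero] at this
    exact (mul_eq_zero.1 this).resolve_left ha
  · intro x _ y _ hxy
    exact mul_left_cancel₀ ha hxy
  · intro y hy
    rw [Multiset.mem_toFinset, Polynomial.mem_roots (monicize_monic _ _).ne_zero,
      Polynomial.IsRoot.def] at hy
    refine ⟨y / p.coeff r, ?_, by field_simp⟩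
    rw [Multiset.mem_toFinset, Polynomial.mem_roots hp, Polynomial.IsRoot.def]
    have := monicize_eval hr.symm (y / p.coeff r)
    rw [mul_div_cancel₀ _ ha, hy, mul_zero] at this
    exact (mul_eq_zero.1 this.symm).resolve_left (pow_ne_zero _ ha)
  · intro x _
    have : p.leadingCoeff = p.coeff r := rfl
    have h2 : 0 < p.coeff r ^ (2 * E) := by rw [pow_mul]; exact pow_pos (by positivity) _
    rw [this, rescale_eval hE, sign_mul, sign_pos h2, one_mul]

lemma coeffPolyFn_monicize {n r : ℕ} {p : (ι → ℝ) → Polynomial ℝ} (hp : CoeffPolyFn n p) :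
    CoeffPolyFn (n * r) (fun z => monicize r (p z)) := by
  intro m
  simp only [monicize, Polynomial.coeff_add, Polynomial.finsetSum_coeff, Polynomial.coeff_C_mul]
  refine (PolyFn.const _ _).add (PolyFn.sum _ fun i hi => ?_)
  have hi := Finset.mem_range.1 hi
  refine (((hp i).mul ((hp r).pow (r - 1 - i))).mul (PolyFn.const 0 _)).mono ?_
  calc n + (r - 1 - i) * n + 0 = (r - 1 - i + 1) * n := by ring
    _ ≤ n * r := by rw [mul_comm n]; exact Nat.mul_le_mul_right _ (by omega)

lemma coeffPolyFn_rescale {n E : ℕ} {a : (ι → ℝ) → ℝ} {h : (ι → ℝ) → Polynomial ℝ}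
    (ha : PolyFn n a) (hh : CoeffPolyFn E h) :
    CoeffPolyFn (E + 2 * E * n) (fun z => rescale E (a z) (h z)) := by
  intro m
  simp only [rescale, Polynomial.finsetSum_coeff, Polynomial.coeff_C_mul]
  refine PolyFn.sum _ fun i _ => ?_
  refine (((hh i).mul (ha.pow (2 * E - i))).mul (PolyFn.const 0 _)).mono ?_
  have : (2 * E - i) * n ≤ 2 * E * n := Nat.mul_le_mul_right _ (by omega)
  omega

lemma rescale_natDegree_le (E : ℕ) (a : ℝ) (h : Polynomial ℝ) : (rescale E a h).natDegree ≤ E := by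
  refine Polynomial.natDegree_sum_le_of_forall_le _ _ fun i hi => ?_
  have hi := Finset.mem_range.1 hi
  exact (Polynomial.natDegree_C_mul_X_pow_le _ _).trans (by omega)

lemma hermiteMat_apply_eq {r E : ℕ} (ρ : Fin r → ℂ) {h : Polynomial ℝ} (hE : h.natDegree ≤ E)
    (i j : Fin r) : hermiteMat ρ h i j =
      ∑ m ∈ Finset.range (E + 1), h.coeff m * (∑ l, ρ l ^ (m + (i + j) : ℕ)).re := by
  rw [hermiteMat, Matrix.of_apply]
  have : ∀ l, Polynomial.aeval (ρ l) h * ρ l ^ (i + j : ℕ) =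
      ∑ m ∈ Finset.range (E + 1), (h.coeff m : ℂ) * ρ l ^ (m + (i + j) : ℕ) := fun l => by
    rw [Polynomial.aeval_eq_sum_range' (n := E + 1) (by omega), Finset.sum_mul]
    refine Finset.sum_congr rfl fun m _ => ?_
    rw [Algebra.smul_def, mul_assoc, ← pow_add]
    rfl
  simp only [this]
  rw [Finset.sum_comm, Complex.re_sum]
  refine Finset.sum_congr rfl fun m _ => ?_
  rw [← Finset.mul_sum, Complex.re_ofReal_mul]

lemma decided_tarskiQuery_monic {n r E E' : ℕ} {p h : (ι → ℝ) → Polynomial ℝ}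
    (hm : ∀ z, (p z).Monic) (hr : ∀ z, (p z).natDegree = r) (hp : CoeffPolyFn n p)
    (hh : CoeffPolyFn E h) (hE : ∀ z, (h z).natDegree ≤ E') :
    Decided (r * (E + (E' + 2 * r) * n)) (fun z => tarskiQuery (p z) (h z)) := by
  choose ρ hρ using fun z => exists_complex_roots (hm z) (hr z)
  have := decided_signature (M := fun z => hermiteMat (ρ z) (h z))
    (D := E + (E' + 2 * r) * n) (fun z => hermiteMat_isHermitian _ _) fun i j => by
      refine PolyFn.congr (PolyFn.sum (Finset.range (E' + 1)) fun m hm' =>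
        ((hh m).mul (powerSum_re_polyFn hρ hp (m + (i + j)))).mono ?_) fun z =>
          (hermiteMat_apply_eq (ρ z) (hE z) i j)
      have := Finset.mem_range.1 hm'
      exact Nat.add_le_add_left (Nat.mul_le_mul_right _ (by omega)) _
  rw [Fintype.card_fin] at this
  refine this.of_fun_eq fun z z' hz => ?_
  rw [signature_hermiteMat (hm z).ne_zero (hρ z), signature_hermiteMat (hm z').ne_zero (hρ z')] at hz
  exact hz

lemma decided_natDegree {n D : ℕ} {p : (ι → ℝ) → Polynomial ℝ} (hp : CoeffPolyFn D p)
    (hn : ∀ z, (p z).natDegree ≤ n) : Decided D (fun z => (p z).natDegree) := by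
  refine (Decided.pi (γ := Fin (n + 1)) fun i => (hp i).decided).of_fun_eq fun z z' h => ?_
  refine natDegree_eq_of_sign fun i => ?_
  rcases Nat.lt_or_ge i (n + 1) with hi | hi
  · exact congrFun h ⟨i, hi⟩
  · rw [Polynomial.coeff_eq_zero_of_natDegree_lt ((hn z).trans_lt (by omega)),
      Polynomial.coeff_eq_zero_of_natDegree_lt ((hn z').trans_lt (by omega))]

lemma decided_eq_zero {n D : ℕ} {p : (ι → ℝ) → Polynomial ℝ} (hp : CoeffPolyFn D p)
    (hn : ∀ z, (p z).natDegree ≤ n) : Decided D (fun z => p z = 0) := by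
  refine (Decided.pi (γ := Fin (n + 1)) fun i => (hp i).decided).of_fun_eq fun z z' h => ?_
  have hs : (p z).support = (p z').support := support_eq_of_sign fun i => by
    rcases Nat.lt_or_ge i (n + 1) with hi | hi
    · exact congrFun h ⟨i, hi⟩
    · rw [Polynomial.coeff_eq_zero_of_natDegree_lt ((hn z).trans_lt (by omega)),
        Polynomial.coeff_eq_zero_of_natDegree_lt ((hn z').trans_lt (by omega))]
  rw [← Polynomial.support_eq_empty, ← Polynomial.support_eq_empty, hs]

lemma decided_tarskiQuery {n E : ℕ} (hn1 : 1 ≤ n) (hE1 : 1 ≤ E) {p h : (ι → ℝ) → Polynomial ℝ}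
    (hp : CoeffPolyFn n p) (hn : ∀ z, (p z).natDegree ≤ n)
    (hh : CoeffPolyFn E h) (hE : ∀ z, (h z).natDegree ≤ E) :
    Decided (6 * n ^ 4 * E) (fun z => tarskiQuery (p z) (h z)) := by
  have h1 : ∀ r : Fin (n + 1), Decided (6 * n ^ 4 * E) (fun z =>
      tarskiQuery (monicize r (p z)) (rescale E ((p z).coeff r) (h z))) := fun r => by
    refine (decided_tarskiQuery_monic (fun z => monicize_monic r (p z))
      (fun z => monicize_natDegree r (p z)) (coeffPolyFn_monicize hp)
      (coeffPolyFn_rescale (hp r) hh) (fun z => rescale_natDegree_le _ _ _)).mono ?_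
    have hr : (r : ℕ) ≤ n := by omega
    calc (r : ℕ) * (E + 2 * E * n + (E + 2 * r) * (n * r))
        ≤ n * (E + 2 * E * n + (E + 2 * n) * (n * n)) := by gcongr
      _ ≤ n * (E * n ^ 3 + 2 * E * n ^ 3 + (E * n ^ 3 + 2 * E * n ^ 3)) := by
        have e1 : 1 ≤ n ^ 3 := Nat.one_le_pow _ _ hn1
        have e2 : n ≤ n ^ 3 := Nat.le_self_pow (by norm_num) n
        have e3 : n ^ 2 ≤ n ^ 3 := Nat.pow_le_pow_right hn1 (by norm_num)
        refine Nat.mul_le_mul_left _ ?_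
        have a1 : E ≤ E * n ^ 3 := Nat.le_mul_of_pos_right _ e1
        have a2 : 2 * E * n ≤ 2 * E * n ^ 3 := Nat.mul_le_mul_left _ e2
        have a3 : (E + 2 * n) * (n * n) ≤ E * n ^ 3 + 2 * E * n ^ 3 := by
          have : E * n ^ 2 ≤ E * n ^ 3 := Nat.mul_le_mul_left _ e3
          have : n ^ 3 ≤ E * n ^ 3 := Nat.le_mul_of_pos_left _ hE1
          nlinarith
        omega
      _ = 6 * n ^ 4 * E := by ring
  have hle : n ≤ 6 * n ^ 4 * E := by
    calc n ≤ n ^ 4 := Nat.le_self_pow (by norm_num) n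
      _ ≤ 6 * n ^ 4 * E := by nlinarith [Nat.one_le_pow 4 n hn1]
  refine ((Decided.pi h1).prodMk (((decided_natDegree hp hn).mono hle).prodMk
    ((decided_eq_zero hp hn).mono hle))).of_fun_eq fun z z' hz => ?_
  simp only [Prod.mk.injEq] at hz
  obtain ⟨ha, hb, hc⟩ := hz
  by_cases h0 : p z = 0
  · have h0' : p z' = 0 := hc ▸ h0
    simp [tarskiQuery, h0, h0']
  · have h0' : p z' ≠ 0 := fun h => h0 (hc ▸ h)
    rw [← tarskiQuery_monicize h0 (hE z), ← tarskiQuery_monicize h0' (hE z')]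
    have := congrFun ha ⟨(p z).natDegree, Nat.lt_succ_of_le (hn z)⟩
    simp only at this
    rw [← hb]
    convert this using 2 <;> simp only [Polynomial.leadingCoeff, hb]

/-- A weighted count of the roots of `p` at which the polynomials of `L` have given signs. -/
noncomputable def signCount (p g : Polynomial ℝ) (L : List (Polynomial ℝ × SignType)) : ℤ :=
  ∑ x ∈ p.roots.toFinset, (SignType.sign (g.eval x) : ℤ) *
    (if ∀ q ∈ L, SignType.sign (q.1.eval x) = q.2 then 1 else 0)

lemma two_mul_signCount_cons (p g h : Polynomial ℝ) (τ : SignType)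
    (L : List (Polynomial ℝ × SignType)) :
    2 * signCount p g ((h, τ) :: L) =
      if τ = 0 then 2 * signCount p g L - 2 * signCount p (g * h ^ 2) L
      else signCount p (g * h ^ 2) L + (τ : ℤ) * signCount p (g * h) L := by
  simp only [signCount, Finset.mul_sum]
  split_ifs with hτ
  all_goals
    first
    | rw [← Finset.sum_sub_distrib]
    | rw [← Finset.sum_add_distrib]
    refine Finset.sum_congr rfl fun x _ => ?_
    simp only [List.forall_mem_cons, Polynomial.eval_mul, Polynomial.eval_pow, sign_mul, sign_pow]
    by_cases hL : ∀ q ∈ L, SignType.sign (q.1.eval x) = q.2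
    · generalize SignType.sign (Polynomial.eval x g) = a
      generalize SignType.sign (Polynomial.eval x h) = b
      have e : (∀ q ∈ L, SignType.sign (q.1.eval x) = q.2) = True := eq_true hL
      simp only [e, and_true, if_true]
      revert hτ a b τ
      decide
    · have e : (∀ q ∈ L, SignType.sign (q.1.eval x) = q.2) = False := eq_false hL
      simp only [e, and_false, if_false]
      ring

lemma decided_signCount {n E : ℕ} (hn1 : 1 ≤ n) {p : MvPolynomial (Option ι) ℝ}
    (hp : p.totalDegree ≤ n) (L : List (MvPolynomial (Option ι) ℝ × SignType))
    (hL : ∀ q ∈ L, q.1.totalDegree ≤ E) (g : MvPolynomial (Option ι) ℝ) {E₀ : ℕ}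
    (hg : g.totalDegree ≤ E₀) (h1 : 1 ≤ E₀) :
    Decided (6 * n ^ 4 * (E₀ + L.length * (2 * E))) (fun z => signCount (slice p z) (slice g z)
      (L.map fun q => (slice q.1 z, q.2))) := by
  induction L generalizing g E₀ with
  | nil =>
    refine ((decided_tarskiQuery hn1 h1 (p := slice p) (h := slice g)
      (fun i => polyFn_coeff_slice hp i) (fun z => natDegree_slice_le hp z)
      (fun i => polyFn_coeff_slice hg i) (fun z => natDegree_slice_le hg z)).mono
        (by simp)).of_fun_eq fun z z' h => ?_
    simpa [signCount, tarskiQuery] using h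
  | cons q L ih =>
    obtain ⟨h, τ⟩ := q
    have hh : h.totalDegree ≤ E := hL _ List.mem_cons_self
    have hL' : ∀ q ∈ L, q.1.totalDegree ≤ E := fun q hq => hL q (List.mem_cons_of_mem _ hq)
    have hgh2 : (g * h ^ 2).totalDegree ≤ E₀ + 2 * E := by
      refine (totalDegree_mul _ _).trans (add_le_add hg ((totalDegree_pow _ _).trans ?_))
      omega
    have hgh : (g * h).totalDegree ≤ E₀ + 2 * E :=
      (totalDegree_mul _ _).trans (add_le_add hg (by omega))
    have i1 := (ih hL' g hg h1).mono (E := 6 * n ^ 4 * (E₀ + (L.length + 1) * (2 * E)))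
      (Nat.mul_le_mul_left _ (by nlinarith))
    have i2 := (ih hL' _ hgh2 (by omega)).mono (E := 6 * n ^ 4 * (E₀ + (L.length + 1) * (2 * E)))
      (Nat.mul_le_mul_left _ (by nlinarith))
    have i3 := (ih hL' _ hgh (by omega)).mono (E := 6 * n ^ 4 * (E₀ + (L.length + 1) * (2 * E)))
      (Nat.mul_le_mul_left _ (by nlinarith))
    refine (i1.prodMk (i2.prodMk i3)).of_fun_eq fun z z' hz => ?_
    simp only [Prod.mk.injEq] at hz
    obtain ⟨e1, e2, e3⟩ := hz
    have hmul : ∀ (a b : MvPolynomial (Option ι) ℝ) z, slice (a * b) z = slice a z * slice b z :=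
      fun a b z => by rw [slice, map_mul, Polynomial.map_mul]; rfl
    have hpow : ∀ (a : MvPolynomial (Option ι) ℝ) z, slice (a ^ 2) z = slice a z ^ 2 :=
      fun a z => by rw [slice, map_pow, Polynomial.map_pow]; rfl
    simp only [hmul, hpow] at e1 e2 e3
    have t := two_mul_signCount_cons (slice p z) (slice g z) (slice h z) τ
      (L.map fun q => (slice q.1 z, q.2))
    have t' := two_mul_signCount_cons (slice p z') (slice g z') (slice h z') τ
      (L.map fun q => (slice q.1 z', q.2))
    rw [e1, e2, e3, ← t'] at t
    simpa using t

end SemialgComp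

namespace SemialgComp

variable {ι α : Type}

lemma signCount_one_eq_card (p : Polynomial ℝ) (L : List (Polynomial ℝ × SignType)) :
    signCount p 1 L =
      (p.roots.toFinset.filter fun x => ∀ q ∈ L, SignType.sign (q.1.eval x) = q.2).card := by
  simp [signCount]

lemma slice_one (z : ι → ℝ) : slice (1 : MvPolynomial (Option ι) ℝ) z = 1 := by
  simp [slice]

/-- Roots of a polynomial with given signs transfer between points with the same signs. -/
lemma root_transfer {n D : ℕ} (hn : 1 ≤ n) {p : MvPolynomial (Option ι) ℝ}
    (hp : p.totalDegree ≤ n) {φ : (Option ι → ℝ) → α} (hφ : Decided D φ) :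
    ∃ F : Set (MvPolynomial ι ℝ), FinDeg (6 * n ^ 4 * (1 + n * (2 * D))) F ∧
      ∀ z z', SameSign F z z' → ∀ v ∈ (slice p z).roots, ∃ v' ∈ (slice p z').roots,
        φ (ext z v) = φ (ext z' v') := by
  obtain ⟨G, hG, hφ, hne⟩ : ∃ G : Set (MvPolynomial (Option ι) ℝ), FinDeg D G ∧
      (∀ z z', SameSign G z z' → φ z = φ z') ∧ Nonempty G := by
    obtain ⟨G, hG, hφ⟩ := hφ
    refine ⟨insert 1 G, ⟨hG.1.insert _, ?_⟩, fun z z' h => hφ z z' (h.mono (Set.subset_insert _ _)),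
      ⟨1, Set.mem_insert _ _⟩⟩
    rintro f (rfl | hf)
    · simp
    · exact hG.2 f hf
  have hfin : Finite G := hG.1
  have hLfin : Finite {L : List (G × SignType) // L.length ≤ n} :=
    (List.finite_length_le (G × SignType) n)
  have hdec : ∀ L : {L : List (G × SignType) // L.length ≤ n},
      Decided (6 * n ^ 4 * (1 + n * (2 * D))) (fun z => signCount (slice p z) 1
        (L.1.map fun q => (slice q.1.1 z, q.2))) := fun L => by
    have := decided_signCount hn hp (L.1.map fun q => (q.1.1, q.2)) (E := D) (by
      intro q hq
      obtain ⟨q', -, rfl⟩ := List.mem_map.1 hq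
      exact hG.2 _ q'.1.2) 1 (E₀ := 1) (by simp) le_rfl
    simp only [List.map_map, List.length_map, slice_one] at this
    refine (this.mono ?_)
    gcongr
    exact L.2
  obtain ⟨F, hF, h⟩ := Decided.pi hdec
  refine ⟨F, hF, fun z z' hz v hv => ?_⟩
  by_contra! hcon
  have hbad : ∀ v' ∈ (slice p z').roots, ∃ g : G,
      SignType.sign (eval (ext z v) g.1) ≠ SignType.sign (eval (ext z' v') g.1) := by
    intro v' hv'
    by_contra! hall
    exact hcon v' hv' (hφ _ _ fun f hf => hall ⟨f, hf⟩)
  choose! g hg using hbad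
  set L : List (G × SignType) := (slice p z').roots.toFinset.toList.map fun v' =>
    (g v', SignType.sign (eval (ext z v) (g v').1)) with hL
  have hlen : L.length ≤ n := by
    rw [hL, List.length_map, Finset.length_toList]
    exact (Multiset.toFinset_card_le _).trans ((Polynomial.card_roots' _).trans
      (natDegree_slice_le hp z'))
  have heq := congrFun (h z z' hz) ⟨L, hlen⟩
  simp only [signCount_one_eq_card] at heq
  have h0 : ((slice p z').roots.toFinset.filter fun x =>
      ∀ q ∈ L.map (fun q : G × SignType => (slice q.1.1 z', q.2)), SignType.sign (q.1.eval x) = q.2).card = 0 := by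
    rw [Finset.card_eq_zero, Finset.filter_eq_empty_iff]
    intro x hx hall
    have hx' := Multiset.mem_toFinset.1 hx
    refine hg x hx' ?_
    have := hall (slice (g x).1 z', SignType.sign (eval (ext z v) (g x).1))
      (List.mem_map.2 ⟨(g x, _), List.mem_map.2 ⟨x, Finset.mem_toList.2 hx, rfl⟩, rfl⟩)
    rw [eval_slice] at this
    exact this.symm
  have h1 : 0 < ((slice p z).roots.toFinset.filter fun x =>
      ∀ q ∈ L.map (fun q : G × SignType => (slice q.1.1 z, q.2)), SignType.sign (q.1.eval x) = q.2).card := by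
    refine Finset.card_pos.2 ⟨v, Finset.mem_filter.2 ⟨Multiset.mem_toFinset.2 hv, ?_⟩⟩
    intro q hq
    obtain ⟨q', hq', rfl⟩ := List.mem_map.1 hq
    obtain ⟨x, -, rfl⟩ := List.mem_map.1 hq'
    simp only [eval_slice]
  rw [h0] at heq
  omega

/-- `v` is the root of `p` with exactly `i` smaller roots. -/
def IsRootIdx (p : Polynomial ℝ) (i : ℕ) (v : ℝ) : Prop :=
  v ∈ p.roots ∧ (p.roots.toFinset.filter fun x => x < v).card = i

lemma IsRootIdx.unique {p : Polynomial ℝ} {i : ℕ} {v w : ℝ} (hv : IsRootIdx p i v)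
    (hw : IsRootIdx p i w) : v = w := by
  have key : ∀ {v w : ℝ}, IsRootIdx p i v → IsRootIdx p i w → ¬ v < w := by
    intro v w hv hw hvw
    have : (p.roots.toFinset.filter fun x => x < v).card <
        (p.roots.toFinset.filter fun x => x < w).card := by
      refine Finset.card_lt_card (Finset.ssubset_iff_of_subset ?_ |>.2 ⟨v, ?_, ?_⟩)
      · intro x hx
        rw [Finset.mem_filter] at hx ⊢
        exact ⟨hx.1, hx.2.trans hvw⟩
      · exact Finset.mem_filter.2 ⟨Multiset.mem_toFinset.2 hv.1, hvw⟩
      · simp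
    rw [hv.2, hw.2] at this
    exact lt_irrefl _ this
  exact le_antisymm (not_lt.1 (key hw hv)) (not_lt.1 (key hv hw))

lemma IsRootIdx.le {n : ℕ} {p : Polynomial ℝ} (hn : p.natDegree ≤ n) {i : ℕ} {v : ℝ}
    (hv : IsRootIdx p i v) : i ≤ n := by
  rw [← hv.2]
  exact (Finset.card_filter_le _ _).trans ((Multiset.toFinset_card_le _).trans
    ((Polynomial.card_roots' _).trans hn))

lemma decided_idx {n : ℕ} (hn : 1 ≤ n) {p : MvPolynomial (Option ι) ℝ} (hp : p.totalDegree ≤ n) :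
    Decided (18 * n ^ 4) (fun w : Option ι → ℝ =>
      ((slice p (fun i => w (some i))).roots.toFinset.filter fun x => x < w none).card) := by
  set p' : MvPolynomial (Option (Option ι)) ℝ := rename (Option.map some) p with hp'
  have hdeg : p'.totalDegree ≤ n := (totalDegree_rename_le _ _).trans hp
  have hsl : ∀ w : Option ι → ℝ, slice p' w = slice p (fun i => w (some i)) := fun w => by
    refine Polynomial.funext fun u => ?_
    rw [eval_slice, eval_slice, hp', eval_rename]
    congr 1
    congr 1
    funext o
    cases o <;> rfl
  have h := decided_signCount hn hdeg
    [((MvPolynomial.X none - MvPolynomial.X (some none) : MvPolynomial (Option (Option ι)) ℝ), (-1 : SignType))] (E := 1) (by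
      intro q hq
      rw [List.mem_singleton.1 hq]
      exact (totalDegree_sub _ _).trans (by simp)) 1 (E₀ := 1) (by simp) le_rfl
  refine (h.mono (by simp; omega)).of_fun_eq fun w w' hw => ?_
  simp only [slice_one, signCount_one_eq_card, hsl, List.map_cons, List.map_nil, List.mem_singleton,
    forall_eq, eval_slice, map_sub, eval_X, ext_none, ext_some, sign_eq_neg_one_iff, sub_neg] at hw
  exact_mod_cast hw

/-- The values of a decided function at the roots of a polynomial, listed in increasing order,
are decided. -/
lemma Decided.roots {n D : ℕ} (hn : 1 ≤ n) (hD : 1 ≤ D) {p : MvPolynomial (Option ι) ℝ}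
    (hp : p.totalDegree ≤ n) {φ : (Option ι → ℝ) → α} (hφ : Decided D φ) :
    ∃ F : Set (MvPolynomial ι ℝ), FinDeg (300 * n ^ 9 * D) F ∧
      ∀ z z', SameSign F z z' → ∀ i v, IsRootIdx (slice p z) i v →
        ∃ v', IsRootIdx (slice p z') i v' ∧ φ (ext z v) = φ (ext z' v') := by
  obtain ⟨F, hF, h⟩ := root_transfer hn hp
    ((hφ.mono (Nat.le_add_right D (18 * n ^ 4))).prodMk
      ((decided_idx hn hp).mono (Nat.le_add_left _ D)))
  refine ⟨F, hF.mono ?_, fun z z' hz i v hv => ?_⟩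
  · have h4 : 1 ≤ n ^ 4 := Nat.one_le_pow _ _ hn
    have h5 : 1 ≤ n ^ 5 := Nat.one_le_pow _ _ hn
    have h54 : n ^ 5 = n * n ^ 4 := by ring
    have h95 : n ^ 9 = n ^ 4 * n ^ 5 := by ring
    have : 1 + n * (2 * (D + 18 * n ^ 4)) ≤ 50 * (n ^ 5 * D) := by
      have e1 : n ≤ n ^ 5 := Nat.le_self_pow (by norm_num) n
      have e2 : n * D ≤ n ^ 5 * D := Nat.mul_le_mul_right _ e1
      have e3 : n ^ 5 ≤ n ^ 5 * D := Nat.le_mul_of_pos_right _ hD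
      nlinarith
    calc 6 * n ^ 4 * (1 + n * (2 * (D + 18 * n ^ 4))) ≤ 6 * n ^ 4 * (50 * (n ^ 5 * D)) :=
          Nat.mul_le_mul_left _ this
      _ = 300 * n ^ 9 * D := by ring
  · obtain ⟨v', hv', he⟩ := h z z' hz v hv.1
    simp only [ext_some, ext_none, Prod.mk.injEq] at he
    exact ⟨v', ⟨hv', by rw [← hv.2]; exact he.2.symm⟩, he.1⟩

end SemialgComp

namespace SemialgComp

section DetDeriv

variable {B : Type} [Fintype B] [DecidableEq B]

/-- The derivative of `det` at `X` in the direction `Y`. -/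
noncomputable def detDeriv (X Y : Matrix B B ℝ) : ℝ := ∑ i, (X.updateRow i (Y i)).det

lemma hasDerivAt_det (X Y : Matrix B B ℝ) :
    HasDerivAt (fun s : ℝ => (X + s • Y).det) (detDeriv X Y) 0 := by
  let f : ContinuousMultilinearMap ℝ (fun _ : B => B → ℝ) ℝ :=
    ⟨(Matrix.detRowAlternating (n := B) (R := ℝ)).toMultilinearMap, by
      exact Continuous.matrix_det (A := fun M : B → B → ℝ => (Matrix.of M)) continuous_id⟩
  have hf : ∀ M : Matrix B B ℝ, M.det = f (fun i => M i) := fun M => rfl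
  have hline : HasDerivAt (fun s : ℝ => fun i => (X + s • Y) i) (fun i => Y i) 0 := by
    rw [hasDerivAt_pi]
    intro i
    rw [hasDerivAt_pi]
    intro j
    simpa using ((hasDerivAt_id (0 : ℝ)).mul_const (Y i j)).const_add (X i j)
  have h := (f.hasFDerivAt (x := fun i => (X + (0 : ℝ) • Y) i)).comp_hasDerivAt (0 : ℝ) hline
  have e : f.linearDeriv (fun i => (X + (0 : ℝ) • Y) i) (fun i => Y i) = detDeriv X Y := by
    rw [ContinuousMultilinearMap.linearDeriv_apply, detDeriv]
    refine Finset.sum_congr rfl fun i _ => ?_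
    rw [hf]
    congr 1
    simp only [zero_smul, add_zero]
    rfl
  rw [e] at h
  exact h

lemma detDeriv_sub (X Y Z : Matrix B B ℝ) :
    detDeriv X (Y - Z) = detDeriv X Y - detDeriv X Z := by
  simp only [detDeriv, ← Finset.sum_sub_distrib]
  refine Finset.sum_congr rfl fun i _ => ?_
  have h := Matrix.det_updateRow_add X i (Y i - Z i) (Z i)
  rw [sub_add_cancel] at h
  rw [h, add_sub_cancel_right]
  rfl

lemma detDeriv_smul (X Y : Matrix B B ℝ) (c : ℝ) :
    detDeriv X (c • Y) = c * detDeriv X Y := by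
  simp only [detDeriv, Finset.mul_sum]
  exact Finset.sum_congr rfl fun i _ => Matrix.det_updateRow_smul X i c (Y i)

lemma derivative_charpoly_eval (A : Matrix B B ℝ) (u : ℝ) :
    A.charpoly.derivative.eval u = detDeriv (u • (1 : Matrix B B ℝ) - A) 1 := by
  have h1 := hasDerivAt_det (u • (1 : Matrix B B ℝ) - A) 1
  have h2 : HasDerivAt (fun s : ℝ => A.charpoly.eval (u + s)) (A.charpoly.derivative.eval u) 0 := by
    have := (A.charpoly.hasDerivAt (u + 0)).comp_const_add u 0
    simpa using this
  refine h2.unique (h1.congr_of_eventuallyEq (Filter.Eventually.of_forall fun s => ?_))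
  simp only [Matrix.eval_charpoly]
  congr 1
  ext i j
  simp [Matrix.one_apply, Matrix.scalar_apply, Matrix.diagonal_apply]
  split_ifs <;> ring

/-- On a common eigenvector the second eigenvalue is a quotient of expressions in the first. -/
lemma coord_mul_derivative {A M : Matrix B B ℝ} {b : B → ℝ} (hb : b ≠ 0) {u c : ℝ}
    (hA : A.mulVec b = u • b) (hM : M.mulVec b = c • b) :
    c * A.charpoly.derivative.eval u = detDeriv (u • (1 : Matrix B B ℝ) - A) M := by
  have h1 := hasDerivAt_det (u • (1 : Matrix B B ℝ) - A) (c • 1 - M)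
  have h0 : (fun s : ℝ => ((u • (1 : Matrix B B ℝ) - A) + s • (c • 1 - M)).det) = fun _ => 0 := by
    funext s
    rw [← Matrix.exists_mulVec_eq_zero_iff]
    refine ⟨b, hb, ?_⟩
    simp [Matrix.add_mulVec, Matrix.sub_mulVec, Matrix.smul_mulVec, hA, hM]
  rw [h0] at h1
  have h2 := h1.unique (hasDerivAt_const (0 : ℝ) (0 : ℝ))
  rw [detDeriv_sub, detDeriv_smul, ← derivative_charpoly_eval] at h2
  linarith

lemma charpoly_root_of_mulVec {A : Matrix B B ℝ} {b : B → ℝ} (hb : b ≠ 0) {u : ℝ}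
    (hA : A.mulVec b = u • b) : A.charpoly.eval u = 0 := by
  rw [Matrix.eval_charpoly, ← Matrix.exists_mulVec_eq_zero_iff]
  exact ⟨b, hb, by simp [Matrix.sub_mulVec, hA, Matrix.scalar_apply,
    ← Matrix.smul_one_eq_diagonal, Matrix.smul_mulVec]⟩

lemma exists_mulVec_of_charpoly_root {A : Matrix B B ℝ} {u : ℝ} (h : A.charpoly.eval u = 0) :
    ∃ b, b ≠ 0 ∧ A.mulVec b = u • b := by
  rw [Matrix.eval_charpoly, ← Matrix.exists_mulVec_eq_zero_iff] at h
  obtain ⟨b, hb, h⟩ := h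
  refine ⟨b, hb, ?_⟩
  simp [Matrix.sub_mulVec, Matrix.scalar_apply, ← Matrix.smul_one_eq_diagonal,
    Matrix.smul_mulVec, sub_eq_zero] at h
  exact h.symm

lemma aeval_mulVec {A : Matrix B B ℝ} {b : B → ℝ} {u : ℝ} (hA : A.mulVec b = u • b)
    (q : Polynomial ℝ) : (Polynomial.aeval A q).mulVec b = q.eval u • b := by
  induction q using Polynomial.induction_on' with
  | add p q hp hq => simp [Matrix.add_mulVec, hp, hq, add_smul]
  | monomial n a =>
    have hpow : ∀ n : ℕ, (A ^ n).mulVec b = u ^ n • b := by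
      intro n
      induction n with
      | zero => simp
      | succ n ih =>
        rw [pow_succ, ← Matrix.mulVec_mulVec, hA, Matrix.mulVec_smul, ih, smul_smul, pow_succ,
          mul_comm]
    simp [Polynomial.aeval_monomial, Polynomial.eval_monomial, Algebra.algebraMap_eq_smul_one,
      Matrix.smul_mulVec, hpow, smul_smul]

/-- A bound for eigenvalues. -/
lemma abs_eigenvalue_le {A : Matrix B B ℝ} {b : B → ℝ} (hb : b ≠ 0) {u : ℝ}
    (hA : A.mulVec b = u • b) : |u| ≤ ∑ i, ∑ j, |A i j| := by
  have hne : (Finset.univ : Finset B).Nonempty := by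
    by_contra h
    rw [Finset.not_nonempty_iff_eq_empty, Finset.univ_eq_empty_iff] at h
    exact hb (Subsingleton.elim _ _)
  obtain ⟨i, -, hi⟩ := Finset.exists_max_image Finset.univ (fun i => |b i|) hne
  have hpos : 0 < |b i| := by
    by_contra h
    refine hb (funext fun j => ?_)
    have := (hi j (Finset.mem_univ _)).trans (not_lt.1 h)
    exact abs_eq_zero.1 (le_antisymm this (abs_nonneg _))
  have h := congrFun hA i
  simp only [Matrix.mulVec, dotProduct, Pi.smul_apply, smul_eq_mul] at h
  have h2 : |u| * |b i| ≤ (∑ j, |A i j|) * |b i| := by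
    rw [← abs_mul, ← h, Finset.sum_mul]
    refine (Finset.abs_sum_le_sum_abs _ _).trans (Finset.sum_le_sum fun j _ => ?_)
    rw [abs_mul]
    exact mul_le_mul_of_nonneg_left (hi j (Finset.mem_univ _)) (abs_nonneg _)
  refine (le_of_mul_le_mul_right h2 hpos).trans ?_
  exact Finset.single_le_sum (f := fun i => ∑ j, |A i j|)
    (fun i _ => Finset.sum_nonneg fun j _ => abs_nonneg _) (Finset.mem_univ i)

/-- If `A` has as many distinct eigenvalues as its size, any matrix which is diagonal in the
eigenbasis without zero eigenvalue is invertible. -/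
lemma det_ne_zero_of_eigenbasis {W : Type} [Fintype W] (hW : Fintype.card W = Fintype.card B)
    {A M : Matrix B B ℝ} {b : W → B → ℝ} (hb : ∀ w, b w ≠ 0) {u c : W → ℝ}
    (hu : Function.Injective u) (hA : ∀ w, A.mulVec (b w) = u w • b w)
    (hM : ∀ w, M.mulVec (b w) = c w • b w) (hc : ∀ w, c w ≠ 0) : M.det ≠ 0 := by
  have hli : LinearIndependent ℝ b := by
    refine Module.End.eigenvectors_linearIndependent' (Matrix.toLin' A) u hu b fun w => ?_
    exact Module.End.hasEigenvector_iff.2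
      ⟨Module.End.mem_eigenspace_iff.2 (by simpa using hA w), hb w⟩
  have hsp : Submodule.span ℝ (Set.range b) = ⊤ :=
    hli.span_eq_top_of_card_eq_finrank' (by simp [hW])
  intro h0
  obtain ⟨v, hv, hv0⟩ := Matrix.exists_mulVec_eq_zero_iff.2 h0
  have hmem : v ∈ Submodule.span ℝ (Set.range b) := by rw [hsp]; trivial
  obtain ⟨a, rfl⟩ := (Submodule.mem_span_range_iff_exists_fun ℝ).1 hmem
  rw [Matrix.mulVec_sum] at hv0
  simp only [Matrix.mulVec_smul, hM, smul_smul] at hv0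
  have h1 := Fintype.linearIndependent_iff.1 hli _ hv0
  refine hv (Finset.sum_eq_zero fun w _ => ?_)
  have : a w = 0 := (mul_eq_zero.1 (h1 w)).resolve_right (hc w)
  simp [this]

end DetDeriv

end SemialgComp

namespace SemialgComp

variable {α β γ : Type}

/-- A function that only depends on the coordinates of index less than `m`. -/
def Base {n : ℕ} (m : ℕ) (φ : (Fin n → ℝ) → α) : Prop :=
  ∀ z z' : Fin n → ℝ, (∀ i : Fin n, (i : ℕ) < m → z i = z' i) → φ z = φ z'

/-- The common zeros of the polynomials of index at least `m`. -/
def Crit {n : ℕ} (f : Fin n → MvPolynomial (Fin n) ℝ) (m : ℕ) (z : Fin n → ℝ) : Prop :=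
  ∀ l : Fin n, m ≤ l → eval z (f l) = 0

/-- Exponents of the reduced monomials. -/
abbrev Idx (n m e : ℕ) : Type := {l : Fin n // m ≤ l} → Fin e

/-- The value of a reduced monomial. -/
noncomputable def redMono {n m e : ℕ} (b : Idx n m e) (z : Fin n → ℝ) : ℝ :=
  ∏ l : {l : Fin n // m ≤ l}, z l ^ (b l : ℕ)

/-- Each `f l` with `m ≤ l` is `X l ^ e` up to terms of smaller degree. -/
def Leading {n : ℕ} (f : Fin n → MvPolynomial (Fin n) ℝ) (m e : ℕ) : Prop :=
  2 ≤ e ∧ ∀ l : Fin n, m ≤ l → (f l - MvPolynomial.X l ^ e).totalDegree < e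

lemma exists_normalForm_monomial {n m e T : ℕ} {f : Fin n → MvPolynomial (Fin n) ℝ}
    (hf : Leading f m e) (a : Fin n →₀ ℕ) (ha : a.sum (fun _ k => k) ≤ T)
    (ih : ∀ h : MvPolynomial (Fin n) ℝ, h.totalDegree < T →
      ∃ c : Idx n m e → (Fin n → ℝ) → ℝ, (∀ b, PolyFn T (c b)) ∧ (∀ b, Base m (c b)) ∧
        ∀ z, Crit f m z → eval z h = ∑ b, c b z * redMono b z) :
    ∃ c : Idx n m e → (Fin n → ℝ) → ℝ, (∀ b, PolyFn T (c b)) ∧ (∀ b, Base m (c b)) ∧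
      ∀ z, Crit f m z → eval z (monomial a 1) = ∑ b, c b z * redMono b z := by
  classical
  by_cases hred : ∀ l : Fin n, m ≤ l → a l < e
  · let b₀ : Idx n m e := fun l => ⟨a l, hred l l.2⟩
    refine ⟨fun b z => if b = b₀ then ∏ i ∈ Finset.univ.filter (fun i : Fin n => (i : ℕ) < m),
      z i ^ a i else 0, fun b => ?_, fun b z z' h => ?_, fun z hz => ?_⟩
    · by_cases hb : b = b₀
      · simp only [hb, if_true]
        refine (PolyFn.prod (Finset.univ.filter (fun i : Fin n => (i : ℕ) < m))
          (D := fun i => a i * 1) fun i _ => (PolyFn.coord le_rfl i).pow (a i)).mono ?_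
        refine le_trans ?_ ha
        simp only [mul_one]
        rw [Finsupp.sum_fintype _ _ (fun _ => rfl)]
        exact Finset.sum_le_sum_of_subset (Finset.filter_subset _ _)
      · simp only [hb, if_false]
        exact PolyFn.const _ _
    · dsimp only
      split_ifs
      · refine Finset.prod_congr rfl fun i hi => ?_
        rw [h i (Finset.mem_filter.1 hi).2]
      · rfl
    · rw [Finset.sum_eq_single b₀ (fun b _ hb => by simp [hb]) (by simp)]
      simp only [if_true, redMono, b₀]
      rw [eval_monomial, Finsupp.prod_fintype _ _ (fun _ => by simp), one_mul,
        ← Finset.prod_filter_mul_prod_filter_not Finset.univ (fun i : Fin n => (i : ℕ) < m)]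
      congr 1
      refine Finset.prod_subtype (p := fun l : Fin n => m ≤ l) _ (fun x => by simp) (fun i => z i ^ a i)
  · push Not at hred
    obtain ⟨l, hl, hle⟩ := hred
    let a' : Fin n →₀ ℕ := a - Finsupp.single l e
    have ha' : a' + Finsupp.single l e = a := by
      refine tsub_add_cancel_of_le ?_
      rw [Finsupp.single_le_iff]
      exact hle
    let h : MvPolynomial (Fin n) ℝ := -(monomial a' 1 * (f l - MvPolynomial.X l ^ e))
    have hsum : a'.sum (fun _ k => k) + e = a.sum (fun _ k => k) := by
      conv_rhs => rw [← ha']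
      rw [Finsupp.sum_add_index' (fun _ => rfl) (fun _ _ _ => rfl), Finsupp.sum_single_index rfl]
    have hdeg : h.totalDegree < T := by
      have h1 := totalDegree_mul (monomial a' (1 : ℝ)) (f l - MvPolynomial.X l ^ e)
      have h2 := hf.2 l hl
      have h3 : (monomial a' (1 : ℝ)).totalDegree ≤ a'.sum (fun _ k => k) :=
        totalDegree_monomial_le _ _
      simp only [h, totalDegree_neg]
      omega
    obtain ⟨c, h1, h2, h3⟩ := ih h hdeg
    refine ⟨c, h1, h2, fun z hz => ?_⟩
    rw [← h3 z hz]
    simp only [h, map_neg, map_mul, map_sub, hz l hl, map_pow, eval_X, zero_sub, mul_neg, neg_neg]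
    rw [← ha', eval_monomial, eval_monomial, Finsupp.prod_add_index' (by simp) (by
      intros; rw [pow_add]), Finsupp.prod_single_index (by simp)]
    ring

lemma exists_normalForm {n m e : ℕ} {f : Fin n → MvPolynomial (Fin n) ℝ}
    (hf : Leading f m e) (T : ℕ) (h : MvPolynomial (Fin n) ℝ) (hT : h.totalDegree ≤ T) :
    ∃ c : Idx n m e → (Fin n → ℝ) → ℝ, (∀ b, PolyFn T (c b)) ∧ (∀ b, Base m (c b)) ∧
      ∀ z, Crit f m z → eval z h = ∑ b, c b z * redMono b z := by
  induction T using Nat.strong_induction_on generalizing h with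
  | _ T ih =>
    have hmono : ∀ a ∈ h.support, ∃ c : Idx n m e → (Fin n → ℝ) → ℝ,
        (∀ b, PolyFn T (c b)) ∧ (∀ b, Base m (c b)) ∧
        ∀ z, Crit f m z → eval z (monomial a 1) = ∑ b, c b z * redMono b z := by
      intro a ha
      refine exists_normalForm_monomial hf a ((le_totalDegree ha).trans hT) fun g hg => ?_
      obtain ⟨c, h1, h2, h3⟩ := ih _ hg g le_rfl
      exact ⟨c, fun b => (h1 b).mono hg.le, h2, h3⟩
    choose! c hc1 hc2 hc3 using hmono
    refine ⟨fun b z => ∑ a ∈ h.support, h.coeff a * c a b z, fun b => ?_, fun b z z' hz => ?_,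
      fun z hz => ?_⟩
    · exact PolyFn.sum _ fun a ha => (hc1 a ha b).const_mul _
    · exact Finset.sum_congr rfl fun a ha => by rw [hc2 a ha b z z' hz]
    · conv_lhs => rw [h.as_sum]
      rw [map_sum]
      have : ∀ a ∈ h.support, eval z (monomial a (h.coeff a))
          = ∑ b, h.coeff a * c a b z * redMono b z := by
        intro a ha
        have h1 : monomial a (h.coeff a) = MvPolynomial.C (h.coeff a) * monomial a 1 := by
          rw [C_mul_monomial, mul_one]
        rw [h1, map_mul, eval_C, hc3 a ha z hz, Finset.mul_sum]
        exact Finset.sum_congr rfl fun _ _ => by ring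
      rw [Finset.sum_congr rfl this, Finset.sum_comm]
      exact Finset.sum_congr rfl fun b _ => by rw [Finset.sum_mul]

lemma exists_mulMat {n m e : ℕ} {f : Fin n → MvPolynomial (Fin n) ℝ}
    (hf : Leading f m e) (h : MvPolynomial (Fin n) ℝ) :
    ∃ M : (Fin n → ℝ) → Matrix (Idx n m e) (Idx n m e) ℝ,
      (∀ b c, PolyFn (h.totalDegree + n * e) (fun z => M z b c)) ∧ Base m M ∧
      ∀ z, Crit f m z → (M z).mulVec (fun b => redMono b z) =
        eval z h • fun b => redMono b z := by
  have key : ∀ b : Idx n m e, ∃ c : Idx n m e → (Fin n → ℝ) → ℝ,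
      (∀ b, PolyFn (h.totalDegree + n * e) (c b)) ∧ (∀ b, Base m (c b)) ∧
      ∀ z, Crit f m z → eval z (h * ∏ l : {l : Fin n // m ≤ l}, MvPolynomial.X (l : Fin n) ^ (b l : ℕ)) =
        ∑ b, c b z * redMono b z := by
    intro b
    refine exists_normalForm hf _ _ ((totalDegree_mul _ _).trans (Nat.add_le_add_left ?_ _))
    refine (totalDegree_finsetProd _ _).trans ?_
    refine (Finset.sum_le_sum (g := fun _ => e) fun l _ => ?_).trans ?_
    · refine (totalDegree_X_pow _ _).le.trans (b l).2.le
    · simp only [Finset.sum_const, smul_eq_mul, Finset.card_univ]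
      refine Nat.mul_le_mul_right _ ?_
      exact (Fintype.card_subtype_le (fun l : Fin n => m ≤ l)).trans (Fintype.card_fin n).le
  choose c h1 h2 h3 using key
  refine ⟨fun z => Matrix.of fun b b' => c b b' z, fun b b' => h1 b b', fun z z' hz => ?_,
    fun z hz => ?_⟩
  · ext b b'
    exact h2 b b' z z' hz
  · funext b
    simp only [Matrix.mulVec, dotProduct, Matrix.of_apply, Pi.smul_apply, smul_eq_mul]
    rw [← h3 b z hz, map_mul, map_prod]
    simp [redMono]

/-- The matrix of multiplication by `h` in the basis of reduced monomials. -/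
noncomputable def mulMat {n m e : ℕ} {f : Fin n → MvPolynomial (Fin n) ℝ}
    (hf : Leading f m e) (h : MvPolynomial (Fin n) ℝ) :
    (Fin n → ℝ) → Matrix (Idx n m e) (Idx n m e) ℝ := (exists_mulMat hf h).choose

lemma mulMat_polyFn {n m e : ℕ} {f : Fin n → MvPolynomial (Fin n) ℝ}
    (hf : Leading f m e) (h : MvPolynomial (Fin n) ℝ) (b c : Idx n m e) :
    PolyFn (h.totalDegree + n * e) (fun z => mulMat hf h z b c) :=
  (exists_mulMat hf h).choose_spec.1 b c

lemma mulMat_base {n m e : ℕ} {f : Fin n → MvPolynomial (Fin n) ℝ}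
    (hf : Leading f m e) (h : MvPolynomial (Fin n) ℝ) : Base m (mulMat hf h) :=
  (exists_mulMat hf h).choose_spec.2.1

lemma mulMat_mulVec {n m e : ℕ} {f : Fin n → MvPolynomial (Fin n) ℝ}
    (hf : Leading f m e) (h : MvPolynomial (Fin n) ℝ) {z : Fin n → ℝ} (hz : Crit f m z) :
    (mulMat hf h z).mulVec (fun b => redMono b z) = eval z h • fun b => redMono b z :=
  (exists_mulMat hf h).choose_spec.2.2 z hz

lemma redMono_ne_zero {n m e : ℕ} {f : Fin n → MvPolynomial (Fin n) ℝ}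
    (hf : Leading f m e) (z : Fin n → ℝ) : (fun b : Idx n m e => redMono b z) ≠ 0 := by
  intro h
  have := congrFun h (fun _ => ⟨0, by have := hf.1; omega⟩)
  simp [redMono] at this

end SemialgComp

namespace SemialgComp

variable {n : ℕ}

/-- The separating linear form. -/
noncomputable def sepForm (n m e : ℕ) : MvPolynomial (Fin n) ℝ :=
  ∑ l : {l : Fin n // m ≤ l}, MvPolynomial.C ((e : ℝ) ^ ((l : Fin n) : ℕ)) * MvPolynomial.X (l : Fin n)

lemma sepForm_degree (n m e : ℕ) : (sepForm n m e).totalDegree ≤ 1 := by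
  refine totalDegree_finsetSum_le fun l _ => ?_
  refine (totalDegree_mul _ _).trans ?_
  rw [totalDegree_C, totalDegree_X]

lemma continuous_eval (q : MvPolynomial (Fin n) ℝ) : Continuous fun z : Fin n → ℝ => eval z q :=
  MvPolynomial.continuous_eval q

/-- The degree bound for the eliminating polynomials. -/
def elimDeg (n e : ℕ) : ℕ := e ^ n * (1 + n * e)

variable {m e : ℕ} {f : Fin n → MvPolynomial (Fin n) ℝ}

lemma card_idx_le (he : 1 ≤ e) : Fintype.card (Idx n m e) ≤ e ^ n := by
  rw [Fintype.card_fun, Fintype.card_fin]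
  refine Nat.pow_le_pow_right he ?_
  exact (Fintype.card_subtype_le (fun l : Fin n => m ≤ l)).trans (Fintype.card_fin n).le

lemma card_idx_pos (he : 1 ≤ e) : 0 < Fintype.card (Idx n m e) := by
  rw [Fintype.card_fun, Fintype.card_fin]
  positivity

lemma PolyFn.of_some {D : ℕ} {g : (Fin n → ℝ) → ℝ} (hg : PolyFn D g) :
    PolyFn D (fun w : Option (Fin n) → ℝ => g fun i => w (some i)) := by
  have := hg.comp (ψ := fun i (w : Option (Fin n) → ℝ) => w (some i)) (K := 1)
    (fun i => PolyFn.coord le_rfl _)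
  simpa using this

/-- The characteristic polynomial of the separating form, and the polynomials expressing the
coordinates of a critical point rationally in the value of the separating form. -/
lemma exists_elimination (hf : Leading f m e) :
    ∃ (χ : MvPolynomial (Option (Fin n)) ℝ) (num : Fin n → MvPolynomial (Option (Fin n)) ℝ)
      (den : MvPolynomial (Option (Fin n)) ℝ),
      χ.totalDegree ≤ elimDeg n e ∧ (∀ l, (num l).totalDegree ≤ elimDeg n e) ∧
      den.totalDegree ≤ elimDeg n e ∧
      (∀ z, slice χ z = (mulMat hf (sepForm n m e) z).charpoly) ∧
      (∀ z, slice den z = (slice χ z).derivative) ∧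
      (∀ y z, (∀ i : Fin n, (i : ℕ) < m → y i = z i) → ∀ l r,
        eval (ext y r) (num l) = eval (ext z r) (num l)) ∧
      ∀ z, Crit f m z → ∀ l, z l * eval (ext z (eval z (sepForm n m e))) den =
        eval (ext z (eval z (sepForm n m e))) (num l) := by
  have he : 1 ≤ e := by have := hf.1; omega
  have hN := card_idx_le (n := n) (m := m) he
  set u := sepForm n m e with hu
  let A : (Option (Fin n) → ℝ) → Matrix (Idx n m e) (Idx n m e) ℝ :=
    fun w => w none • (1 : Matrix _ _ ℝ) - mulMat hf u (fun i => w (some i))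
  have hA : ∀ b c, PolyFn (1 + n * e) (fun w => A w b c) := by
    intro b c
    have h1 := ((mulMat_polyFn hf u b c).mono (E := 1 + n * e)
      (Nat.add_le_add_right (sepForm_degree n m e) _)).of_some
    refine (((PolyFn.coord (D := 1 + n * e) (by omega) (none : Option (Fin n))).const_mul
      ((1 : Matrix (Idx n m e) (Idx n m e) ℝ) b c)).sub h1).congr fun w => ?_
    simp [A, mul_comm]
  have hM : ∀ l : Fin n, ∀ b c, PolyFn (1 + n * e) (fun w : Option (Fin n) → ℝ =>
      mulMat hf (MvPolynomial.X l) (fun i => w (some i)) b c) := fun l b c =>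
    ((mulMat_polyFn hf (MvPolynomial.X l) b c).mono (E := 1 + n * e) (by simp)).of_some
  have hdd : ∀ Y : (Option (Fin n) → ℝ) → Matrix (Idx n m e) (Idx n m e) ℝ,
      (∀ b c, PolyFn (1 + n * e) (fun w => Y w b c)) →
      PolyFn (elimDeg n e) (fun w => detDeriv (A w) (Y w)) := by
    intro Y hY
    refine PolyFn.sum _ fun b _ => ?_
    refine (PolyFn.det (M := fun w => (A w).updateRow b (Y w b)) (D := 1 + n * e)
      fun i j => ?_).mono (Nat.mul_le_mul_right _ hN)
    by_cases h : i = b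
    · subst h
      simpa using hY i j
    · simpa [Matrix.updateRow_ne h] using hA i j
  obtain ⟨χ, hχ1, hχ2⟩ := (PolyFn.det hA).mono (Nat.mul_le_mul_right _ hN)
  obtain ⟨den, hd1, hd2⟩ := hdd (fun _ => 1) (fun b c => PolyFn.const _ _)
  choose num hn1 hn2 using fun l => hdd _ (hM l)
  have e1 : ∀ (z : Fin n → ℝ) (r : ℝ), (fun i => ext z r (some i)) = z := by
    intro z r
    funext i
    exact ext_some z r i
  have hs : ∀ z, slice χ z = (mulMat hf u z).charpoly := by
    intro z
    refine Polynomial.funext fun r => ?_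
    rw [eval_slice, ← hχ2, Matrix.eval_charpoly]
    congr 1
    simp only [A, e1, ext_none]
    rw [Matrix.scalar_apply, Matrix.smul_one_eq_diagonal]
  refine ⟨χ, num, den, hχ1, hn1, hd1, hs, fun z => ?_, fun y z hyz l r => ?_, fun z hz l => ?_⟩
  · refine Polynomial.funext fun r => ?_
    rw [eval_slice, ← hd2, hs, derivative_charpoly_eval]
    simp [A, e1]
  · rw [← hn2, ← hn2]
    simp only [A, e1, ext_none, mulMat_base hf u y z hyz, mulMat_base hf (MvPolynomial.X l) y z hyz]
  · rw [← hd2, ← hn2]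
    have h := coord_mul_derivative (redMono_ne_zero hf z) (mulMat_mulVec hf u hz)
      (mulMat_mulVec hf (MvPolynomial.X l) hz)
    rw [derivative_charpoly_eval] at h
    simpa [A, e1] using h

/-- A polynomial in the base coordinates vanishing where `q` vanishes at a critical point. -/
lemma exists_norm (hf : Leading f m e) (q : MvPolynomial (Fin n) ℝ) :
    ∃ N : MvPolynomial (Fin n) ℝ, N.totalDegree ≤ e ^ n * (q.totalDegree + n * e) ∧
      ∀ z, eval z N = (mulMat hf q z).det := by
  have he : 1 ≤ e := by have := hf.1; omega
  obtain ⟨N, h1, h2⟩ := PolyFn.det (mulMat_polyFn hf q)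
  exact ⟨N, h1.trans (Nat.mul_le_mul_right _ (card_idx_le he)), fun z => (h2 z).symm⟩

lemma exists_disc (hf : Leading f m e) :
    ∃ N : MvPolynomial (Fin n) ℝ, N.totalDegree ≤ e ^ n * (2 * elimDeg n e) ∧
      ∀ z, eval z N = (Polynomial.aeval (mulMat hf (sepForm n m e) z)
        (mulMat hf (sepForm n m e) z).charpoly.derivative).det := by
  have he : 1 ≤ e := by have := hf.1; omega
  have hN := card_idx_le (n := n) (m := m) he
  set M := mulMat hf (sepForm n m e) with hM
  have hM1 : ∀ b c, PolyFn (1 + n * e) (fun z => M z b c) := fun b c =>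
    (mulMat_polyFn hf _ b c).mono (Nat.add_le_add_right (sepForm_degree n m e) _)
  have hpow : ∀ i b c, PolyFn (i * (1 + n * e)) (fun z => (M z ^ i) b c) := by
    intro i
    induction i with
    | zero =>
      intro b c
      simpa using PolyFn.const _ _
    | succ i ih =>
      intro b c
      simp only [pow_succ, Matrix.mul_apply]
      refine PolyFn.sum _ fun k _ => ?_
      refine ((ih b k).mul (hM1 k c)).mono (by ring_nf; rfl)
  have hdet := PolyFn.det (M := fun z => Polynomial.aeval (M z) (M z).charpoly.derivative)
    (D := 2 * elimDeg n e) (fun b c => by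
      have h1 : PolyFn (2 * elimDeg n e) (fun z => ∑ i ∈ Finset.range (Fintype.card (Idx n m e)),
          (M z).charpoly.derivative.coeff i * (M z ^ i) b c) := by
        refine PolyFn.sum _ fun i hi => ?_
        have h2 := (CoeffPolyFn.charpoly hM1) (i + 1)
        have h3 : PolyFn (elimDeg n e) (fun z => (M z).charpoly.derivative.coeff i) := by
          simp only [Polynomial.coeff_derivative]
          refine ((h2.const_mul (i + 1 : ℝ)).congr fun z => by ring).mono
            (Nat.mul_le_mul_right _ hN)
        refine (h3.mul (hpow i b c)).mono ?_
        rw [two_mul]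
        exact Nat.add_le_add_left (Nat.mul_le_mul_right _
          ((Finset.mem_range.1 hi).le.trans hN)) _
      refine h1.congr fun z => ?_
      have hdeg : (M z).charpoly.derivative.natDegree < Fintype.card (Idx n m e) := by
        have := Polynomial.natDegree_derivative_lt (p := (M z).charpoly) (by
          rw [Matrix.charpoly_natDegree_eq_dim]; exact (card_idx_pos he).ne')
        rwa [Matrix.charpoly_natDegree_eq_dim] at this
      rw [Polynomial.aeval_eq_sum_range' hdeg, Matrix.sum_apply]
      simp)
  obtain ⟨N, h1, h2⟩ := hdet
  exact ⟨N, h1.trans (Nat.mul_le_mul_right _ hN), fun z => (h2 z).symm⟩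

lemma ne_zero_of_norm (hf : Leading f m e) {q : MvPolynomial (Fin n) ℝ} {z : Fin n → ℝ}
    (hz : Crit f m z) (hN : (mulMat hf q z).det ≠ 0) : eval z q ≠ 0 := by
  intro h
  refine hN (Matrix.exists_mulVec_eq_zero_iff.1 ⟨_, redMono_ne_zero hf z, ?_⟩)
  rw [mulMat_mulVec hf q hz, h, zero_smul]

lemma derivative_ne_zero_of_disc (M : Matrix (Idx n m e) (Idx n m e) ℝ)
    (hM : (Polynomial.aeval M M.charpoly.derivative).det ≠ 0) {r : ℝ}
    (hr : M.charpoly.eval r = 0) : M.charpoly.derivative.eval r ≠ 0 := by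
  intro h
  obtain ⟨b, hb, hb2⟩ := exists_mulVec_of_charpoly_root hr
  refine hM (Matrix.exists_mulVec_eq_zero_iff.1 ⟨b, hb, ?_⟩)
  rw [aeval_mulVec hb2, h, zero_smul]

/-- The grid point over `z` with centred digits `b`. -/
noncomputable def gridPt (m e : ℕ) (s : ℝ) (z : Fin n → ℝ) (b : Idx n m e) : Fin n → ℝ :=
  fun i => if h : m ≤ (i : ℕ) then ((b ⟨i, h⟩ : ℕ) : ℝ) - s else z i

lemma sepForm_gridPt_injective (s : ℝ) (z : Fin n → ℝ) :
    Function.Injective fun b : Idx n m e => eval (gridPt m e s z b) (sepForm n m e) := by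
  rcases Nat.eq_zero_or_pos e with rfl | he
  · intro b b' _
    funext l
    exact (b l).elim0
  intro b b' h
  let E : Idx n m e → Fin n → Fin e := fun b i => if h : m ≤ (i : ℕ) then b ⟨i, h⟩ else ⟨0, he⟩
  have hE : ∀ b : Idx n m e, eval (gridPt m e s z b) (sepForm n m e) =
      ((finFunctionFinEquiv (E b) : ℕ) : ℝ) - ∑ l : {l : Fin n // m ≤ l}, (e : ℝ) ^ ((l : Fin n) : ℕ) * s := by
    intro b
    have h1 : ((finFunctionFinEquiv (E b) : ℕ) : ℝ) =
        ∑ l : {l : Fin n // m ≤ l}, (e : ℝ) ^ ((l : Fin n) : ℕ) * (b l : ℕ) := by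
      rw [finFunctionFinEquiv_apply, Nat.cast_sum,
        ← Finset.sum_filter_add_sum_filter_not Finset.univ (fun i : Fin n => m ≤ (i : ℕ)),
        Finset.sum_eq_zero (s := Finset.univ.filter (fun i : Fin n => ¬ m ≤ (i : ℕ))), add_zero,
        Finset.sum_subtype (p := fun i : Fin n => m ≤ (i : ℕ)) _ (fun x => by simp)]
      · refine Finset.sum_congr rfl fun l _ => ?_
        simp [E, l.2, mul_comm]
      · intro i hi
        simp [E, (Finset.mem_filter.1 hi).2]
    rw [h1, ← Finset.sum_sub_distrib, sepForm, map_sum]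
    refine Finset.sum_congr rfl fun l _ => ?_
    simp [gridPt, l.2, mul_sub]
  dsimp only at h
  rw [hE b, hE b', sub_left_inj, Nat.cast_inj] at h
  have h2 := finFunctionFinEquiv.injective (Fin.ext h)
  funext l
  have := congrFun h2 l
  simpa [E, l.2] using this

lemma norm_ne_zero_of_grid (hf : Leading f m e) {s : ℝ} {z : Fin n → ℝ}
    (hz : ∀ b : Idx n m e, Crit f m (gridPt m e s z b)) {q : MvPolynomial (Fin n) ℝ}
    (hq : ∀ b : Idx n m e, eval (gridPt m e s z b) q ≠ 0) : (mulMat hf q z).det ≠ 0 := by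
  have hb : ∀ b : Idx n m e, ∀ q, mulMat hf q z = mulMat hf q (gridPt m e s z b) := fun b q =>
    mulMat_base hf q _ _ fun i hi => by simp [gridPt, not_le.2 hi]
  refine det_ne_zero_of_eigenbasis (W := Idx n m e) rfl
    (b := fun w b => redMono b (gridPt m e s z w)) (fun w => redMono_ne_zero hf _)
    (sepForm_gridPt_injective s z) (A := mulMat hf (sepForm n m e) z) (fun w => ?_) (fun w => ?_) hq
  · rw [hb w]; exact mulMat_mulVec hf _ (hz w)
  · rw [hb w]; exact mulMat_mulVec hf _ (hz w)

lemma disc_ne_zero_of_grid (hf : Leading f m e) {s : ℝ} {z : Fin n → ℝ}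
    (hz : ∀ b : Idx n m e, Crit f m (gridPt m e s z b)) :
    (Polynomial.aeval (mulMat hf (sepForm n m e) z)
        (mulMat hf (sepForm n m e) z).charpoly.derivative).det ≠ 0 := by
  have hb : ∀ b : Idx n m e, ∀ q, mulMat hf q z = mulMat hf q (gridPt m e s z b) := fun b q =>
    mulMat_base hf q _ _ fun i hi => by simp [gridPt, not_le.2 hi]
  have hA : ∀ w, (mulMat hf (sepForm n m e) z).mulVec (fun b => redMono b (gridPt m e s z w)) =
      eval (gridPt m e s z w) (sepForm n m e) • (fun b => redMono b (gridPt m e s z w)) := by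
    intro w
    rw [hb w]; exact mulMat_mulVec hf _ (hz w)
  have hinj := sepForm_gridPt_injective (m := m) (e := e) s z
  refine det_ne_zero_of_eigenbasis (W := Idx n m e) rfl
    (b := fun w b => redMono b (gridPt m e s z w)) (fun w => redMono_ne_zero hf _)
    hinj (A := mulMat hf (sepForm n m e) z) hA (fun w => aeval_mulVec (hA w) _) fun w h0 => ?_
  set χ := (mulMat hf (sepForm n m e) z).charpoly with hχ
  have hmon : χ.Monic := Matrix.charpoly_monic _
  have hroots : ∀ w : Idx n m e, eval (gridPt m e s z w) (sepForm n m e) ∈ χ.roots.toFinset := by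
    intro w
    rw [Multiset.mem_toFinset, Polynomial.mem_roots hmon.ne_zero]
    exact charpoly_root_of_mulVec (redMono_ne_zero hf _) (hA w)
  have hcard : Fintype.card (Idx n m e) ≤ χ.roots.toFinset.card := by
    rw [← Finset.card_univ, ← Finset.card_image_of_injective _ hinj]
    refine Finset.card_le_card fun x hx => ?_
    obtain ⟨w, -, rfl⟩ := Finset.mem_image.1 hx
    exact hroots w
  have hnd : χ.roots.Nodup := by
    rw [← Multiset.dedup_card_eq_card_iff_nodup]
    refine le_antisymm (Multiset.card_le_card (Multiset.dedup_le _)) ?_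
    refine (Polynomial.card_roots' χ).trans ?_
    rw [hχ, Matrix.charpoly_natDegree_eq_dim]
    exact hcard
  have hm := hroots w
  rw [Multiset.mem_toFinset] at hm
  have h1 : 1 < χ.rootMultiplicity (eval (gridPt m e s z w) (sepForm n m e)) :=
    (Polynomial.one_lt_rootMultiplicity_iff_isRoot hmon.ne_zero).2
      ⟨(Polynomial.mem_roots hmon.ne_zero).1 hm, h0⟩
  have h2 := Multiset.nodup_iff_count_le_one.1 hnd (eval (gridPt m e s z w) (sepForm n m e))
  rw [Polynomial.count_roots] at h2
  omega

end SemialgComp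

namespace SemialgComp

open Filter Topology in
/-- The index of a simple real root is locally constant in continuous families of polynomials. -/
lemma IsRootIdx.locally_const {X : Type} [TopologicalSpace X] {P : X → Polynomial ℝ}
    (hP : Continuous fun q : X × ℝ => (P q.1).eval q.2)
    (hP' : Continuous fun q : X × ℝ => (P q.1).derivative.eval q.2)
    (hne : ∀ x, P x ≠ 0) {bd : X → ℝ} (hbd : Continuous bd)
    (hroot : ∀ x r, (P x).eval r = 0 → |r| ≤ bd x) {x₀ : X}
    (hs : ∀ r, (P x₀).eval r = 0 → (P x₀).derivative.eval r ≠ 0) {r₀ : ℝ} {i : ℕ}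
    (h₀ : IsRootIdx (P x₀) i r₀) :
    ∃ ε > 0, ∀ᶠ x in 𝓝 x₀, ∀ r, (P x).eval r = 0 → |r - r₀| < ε → IsRootIdx (P x) i r := by
  classical
  have hmem : ∀ x r, r ∈ (P x).roots.toFinset ↔ (P x).eval r = 0 := fun x r => by
    rw [Multiset.mem_toFinset, Polynomial.mem_roots (hne x), Polynomial.IsRoot.def]
  set R := (P x₀).roots.toFinset with hR
  have hε : ∃ ε > 0, (∀ ρ ∈ R, ∀ᶠ x in 𝓝 x₀, ∀ r, |r - ρ| ≤ ε → (P x).derivative.eval r ≠ 0) ∧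
      ∀ ρ ∈ R, ∀ ρ' ∈ R, ρ ≠ ρ' → 2 * ε < |ρ - ρ'| := by
    have e1 : ∀ ρ ∈ R, ∀ᶠ ε in 𝓝[>] (0 : ℝ), ∀ᶠ x in 𝓝 x₀, ∀ r, |r - ρ| ≤ ε →
        (P x).derivative.eval r ≠ 0 := by
      intro ρ hρ
      have h1 : ∀ᶠ q in 𝓝 (x₀, ρ), (P q.1).derivative.eval q.2 ≠ 0 :=
        hP'.continuousAt.eventually_ne (hs ρ ((hmem _ _).1 hρ))
      rw [nhds_prod_eq] at h1
      obtain ⟨p, hp, q, hq, hpq⟩ := Filter.eventually_prod_iff.1 h1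
      obtain ⟨δ, hδ, hδ2⟩ := Metric.eventually_nhds_iff.1 hq
      have : ∀ᶠ ε in 𝓝[>] (0 : ℝ), ε < δ := (eventually_lt_nhds hδ).filter_mono nhdsWithin_le_nhds
      filter_upwards [this] with ε hε
      filter_upwards [hp] with x hx r hr
      exact hpq hx (hδ2 (by rw [Real.dist_eq]; exact hr.trans_lt hε))
    have e2 : ∀ ρ ∈ R, ∀ ρ' ∈ R, ∀ᶠ ε in 𝓝[>] (0 : ℝ), ρ ≠ ρ' → 2 * ε < |ρ - ρ'| := by
      intro ρ _ ρ' _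
      by_cases h : ρ = ρ'
      · simp [h]
      · have h1 : (0 : ℝ) < |ρ - ρ'| / 2 := by
          have := abs_pos.2 (sub_ne_zero.2 h)
          linarith
        filter_upwards [(eventually_lt_nhds h1).filter_mono nhdsWithin_le_nhds] with ε hε _
        linarith
    have e3 : ∀ᶠ ε in 𝓝[>] (0 : ℝ), 0 < ε := self_mem_nhdsWithin
    have e4 := (Filter.eventually_all_finset R).2 e1
    have e5 := (Filter.eventually_all_finset R).2 fun ρ hρ =>
      (Filter.eventually_all_finset R).2 fun ρ' hρ' => e2 ρ hρ ρ' hρ'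
    obtain ⟨ε, h1, h2, h3⟩ := (e3.and (e4.and e5)).exists
    exact ⟨ε, h1, h2, h3⟩
  obtain ⟨ε, hε, hder, hgap⟩ := hε
  have hinj : ∀ x ρ, (∀ r, |r - ρ| ≤ ε → (P x).derivative.eval r ≠ 0) → ∀ a b, |a - ρ| ≤ ε →
      |b - ρ| ≤ ε → a < b → (P x).eval a ≠ (P x).eval b := by
    intro x ρ hx a b ha hb hab heq
    obtain ⟨c, hc, hc0⟩ := exists_hasDerivAt_eq_zero hab (P x).continuous.continuousOn heq
      (fun y _ => (P x).hasDerivAt y)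
    refine hx c ?_ hc0
    rw [abs_le] at ha hb ⊢
    constructor <;> linarith [hc.1, hc.2]
  have hcont : ∀ r, Continuous fun x => (P x).eval r := fun r =>
    hP.comp (continuous_id.prodMk continuous_const)
  have hex : ∀ ρ ∈ R, ∀ᶠ x in 𝓝 x₀, ∃ r, (P x).eval r = 0 ∧ |r - ρ| < ε := by
    intro ρ hρ
    have hρ0 := (hmem _ _).1 hρ
    have hinjOn : InjOn (fun r => (P x₀).eval r) (Icc (ρ - ε) (ρ + ε)) := by
      intro a ha b hb hab
      have h1 := hinj x₀ ρ (hder ρ hρ).self_of_nhds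
      have ha' : |a - ρ| ≤ ε := by rw [abs_le]; constructor <;> linarith [ha.1, ha.2]
      have hb' : |b - ρ| ≤ ε := by rw [abs_le]; constructor <;> linarith [hb.1, hb.2]
      rcases lt_trichotomy a b with h | h | h
      · exact absurd hab (h1 a b ha' hb' h)
      · exact h
      · exact absurd hab.symm (h1 b a hb' ha' h)
    have hl : ρ - ε ∈ Icc (ρ - ε) (ρ + ε) := ⟨le_rfl, by linarith⟩
    have hr : ρ + ε ∈ Icc (ρ - ε) (ρ + ε) := ⟨by linarith, le_rfl⟩
    have hm : ρ ∈ Icc (ρ - ε) (ρ + ε) := ⟨by linarith, by linarith⟩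
    rcases (P x₀).continuous.continuousOn.strictMonoOn_of_injOn_Icc' (by linarith : ρ - ε ≤ ρ + ε) hinjOn
      with hmon | hmon
    · have h1 := hmon hl hm (by linarith)
      have h2 := hmon hm hr (by linarith)
      dsimp only at h1 h2
      rw [hρ0] at h1 h2
      filter_upwards [(hcont (ρ - ε)).continuousAt.eventually_lt_const h1,
        (hcont (ρ + ε)).continuousAt.eventually_const_lt h2] with x hx1 hx2
      obtain ⟨r, hr1, hr2⟩ := intermediate_value_Ioo (by linarith : ρ - ε ≤ ρ + ε)
        (P x).continuous.continuousOn ⟨hx1, hx2⟩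
      exact ⟨r, hr2, by rw [abs_lt]; constructor <;> linarith [hr1.1, hr1.2]⟩
    · have h1 := hmon hl hm (by linarith)
      have h2 := hmon hm hr (by linarith)
      dsimp only at h1 h2
      rw [hρ0] at h1 h2
      filter_upwards [(hcont (ρ + ε)).continuousAt.eventually_lt_const h2,
        (hcont (ρ - ε)).continuousAt.eventually_const_lt h1] with x hx1 hx2
      obtain ⟨r, hr1, hr2⟩ := intermediate_value_Ioo' (by linarith : ρ - ε ≤ ρ + ε)
        (P x).continuous.continuousOn ⟨hx1, hx2⟩
      exact ⟨r, hr2, by rw [abs_lt]; constructor <;> linarith [hr1.1, hr1.2]⟩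
  have hno : ∀ᶠ x in 𝓝 x₀, ∀ r, (P x).eval r = 0 → ∃ ρ ∈ R, |r - ρ| < ε := by
    let K : Set ℝ := Icc (-(bd x₀ + 1)) (bd x₀ + 1) ∩ ⋂ ρ ∈ R, {r | ε ≤ |r - ρ|}
    have hK : IsCompact K := by
      refine isCompact_Icc.inter_right (isClosed_biInter fun ρ _ => ?_)
      exact isClosed_le continuous_const (by fun_prop)
    have h1 : ∀ᶠ x in 𝓝 x₀, ∀ r ∈ K, (P x).eval r ≠ 0 := by
      refine hK.eventually_forall_of_forall_eventually fun r hr => ?_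
      refine hP.continuousAt.eventually_ne (y := (0 : ℝ)) fun h0 => ?_
      have h2 := Set.mem_iInter₂.1 hr.2 r ((hmem _ _).2 h0)
      simp at h2
      linarith
    filter_upwards [h1, hbd.continuousAt.eventually_lt_const (by linarith : bd x₀ < bd x₀ + 1)]
      with x hx hb r hr
    by_contra hcon
    push Not at hcon
    have h3 := abs_le.1 (hroot x r hr)
    exact hx r ⟨⟨by linarith [h3.1], by linarith [h3.2]⟩, Set.mem_iInter₂.2 hcon⟩ hr
  refine ⟨ε, hε, ?_⟩
  have hr₀R : r₀ ∈ R := Multiset.mem_toFinset.2 h₀.1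
  filter_upwards [(Filter.eventually_all_finset R).2 hder, (Filter.eventually_all_finset R).2 hex, hno]
    with x hx1 hx2 hx3 r hr hrr
  refine ⟨Multiset.mem_toFinset.1 ((hmem _ _).2 hr), ?_⟩
  rw [← h₀.2]
  choose! g hg1 hg2 using hx2
  have huniq : ∀ ρ ∈ R, ∀ a b, (P x).eval a = 0 → (P x).eval b = 0 → |a - ρ| < ε → |b - ρ| < ε →
      a = b := by
    intro ρ hρ a b ha hb ha2 hb2
    have h1 := hinj x ρ (hx1 ρ hρ)
    rcases lt_trichotomy a b with h | h | h
    · exact absurd (ha.trans hb.symm) (h1 a b ha2.le hb2.le h)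
    · exact h
    · exact absurd (hb.trans ha.symm) (h1 b a hb2.le ha2.le h)
  have hord : ∀ ρ ∈ R, ∀ ρ' ∈ R, ∀ a b, |a - ρ| < ε → |b - ρ'| < ε → ρ < ρ' → a < b := by
    intro ρ hρ ρ' hρ' a b ha hb hlt
    have h1 := hgap ρ hρ ρ' hρ' hlt.ne
    rw [abs_of_neg (by linarith)] at h1
    rw [abs_lt] at ha hb
    linarith [ha.2, hb.1]
  have himg : (P x).roots.toFinset.filter (· < r) = (R.filter (· < r₀)).image g := by
    ext a
    simp only [Finset.mem_filter, Finset.mem_image, hmem]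
    constructor
    · rintro ⟨ha, har⟩
      obtain ⟨ρ, hρ, haρ⟩ := hx3 a ha
      refine ⟨ρ, ⟨hρ, ?_⟩, huniq ρ hρ _ _ (hg1 ρ hρ) ha (hg2 ρ hρ) haρ⟩
      by_contra hle
      rcases (not_lt.1 hle).eq_or_lt with h | h
      · subst h
        exact har.ne (huniq _ hρ _ _ ha hr haρ hrr)
      · exact lt_asymm har (hord _ hr₀R _ hρ _ _ hrr haρ h)
    · rintro ⟨ρ, ⟨hρ, hlt⟩, rfl⟩
      exact ⟨hg1 ρ hρ, hord _ hρ _ hr₀R _ _ (hg2 ρ hρ) hrr hlt⟩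
  rw [himg, Finset.card_image_of_injOn]
  intro ρ hρ ρ' hρ' hgg
  have h1 := (Finset.mem_filter.1 hρ).1
  have h2 := (Finset.mem_filter.1 hρ').1
  rcases lt_trichotomy ρ ρ' with h | h | h
  · exact absurd hgg (hord _ h1 _ h2 _ _ (hg2 _ h1) (hg2 _ h2) h).ne
  · exact h
  · exact absurd hgg (hord _ h2 _ h1 _ _ (hg2 _ h2) (hg2 _ h1) h).ne'

end SemialgComp

namespace SemialgComp

variable {n : ℕ}

/-- Two points with the same coordinates of index less than `m`. -/
def AgreeLT (m : ℕ) (y z : Fin n → ℝ) : Prop := ∀ i : Fin n, (i : ℕ) < m → y i = z i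

lemma AgreeLT.refl (m : ℕ) (z : Fin n → ℝ) : AgreeLT m z z := fun _ _ => rfl

lemma AgreeLT.symm {m : ℕ} {y z : Fin n → ℝ} (h : AgreeLT m y z) : AgreeLT m z y :=
  fun i hi => (h i hi).symm

lemma AgreeLT.trans {m : ℕ} {x y z : Fin n → ℝ} (h : AgreeLT m x y) (h' : AgreeLT m y z) :
    AgreeLT m x z := fun i hi => (h i hi).trans (h' i hi)

lemma AgreeLT.mono {m m' : ℕ} {y z : Fin n → ℝ} (h : AgreeLT m y z) (hm : m' ≤ m) :
    AgreeLT m' y z := fun i hi => h i (hi.trans_le hm)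

lemma agreeLT_update {m : ℕ} (i : Fin n) (hi : m ≤ i) (z : Fin n → ℝ) (t : ℝ) :
    AgreeLT m (Function.update z i t) z := fun j hj => by
  rw [Function.update_of_ne]
  rintro rfl
  omega

lemma AgreeLT.succ {m : ℕ} {y z : Fin n → ℝ} (h : AgreeLT m y z) (hm : m < n)
    (h' : y ⟨m, hm⟩ = z ⟨m, hm⟩) : AgreeLT (m + 1) y z := fun i hi => by
  rcases Nat.lt_succ_iff_lt_or_eq.1 hi with h1 | h1
  · exact h i h1
  · have : i = ⟨m, hm⟩ := Fin.ext h1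
    rw [this, h']

/-- The gradient of a polynomial. -/
noncomputable def grad (Q : MvPolynomial (Fin n) ℝ) (l : Fin n) : MvPolynomial (Fin n) ℝ :=
  pderiv l Q

/-- The Jacobian of the map keeping the coordinates of index less than `m` and taking the other
partial derivatives of `Q`. -/
noncomputable def jacMat (Q : MvPolynomial (Fin n) ℝ) (m : ℕ) (z : Fin n → ℝ) :
    Matrix (Fin n) (Fin n) ℝ :=
  Matrix.of fun l l' => if (l : ℕ) < m then (if l = l' then 1 else 0)
    else eval z (pderiv l' (pderiv l Q))

lemma hasStrictFDerivAt_eval (q : MvPolynomial (Fin n) ℝ) (z : Fin n → ℝ) :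
    HasStrictFDerivAt (fun y : Fin n → ℝ => eval y q)
      (∑ i, eval z (pderiv i q) • ContinuousLinearMap.proj (R := ℝ) (φ := fun _ : Fin n => ℝ) i) z := by
  induction q using MvPolynomial.induction_on with
  | C a =>
    simp only [eval_C, pderiv_C, map_zero, zero_smul, Finset.sum_const_zero]
    exact hasStrictFDerivAt_const a z
  | add p q hp hq =>
    simp only [map_add, add_smul, Finset.sum_add_distrib]
    exact hp.add hq
  | mul_X p l hp =>
    have h := hp.mul (ContinuousLinearMap.proj (R := ℝ) (φ := fun _ : Fin n => ℝ) l).hasStrictFDerivAt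
      (x := z)
    simp only [map_mul, eval_X, pderiv_mul, map_add]
    refine h.congr_fderiv ?_
    ext v
    have e : ∀ i, eval z (pderiv i (MvPolynomial.X (R := ℝ) l)) = if l = i then 1 else 0 := fun i => by
      rw [pderiv_X, Pi.single_apply]
      by_cases hil : i = l
      · simp [hil]
      · simp [hil, Ne.symm hil]
    simp only [e, add_apply, ContinuousLinearMap.smul_apply, ContinuousLinearMap.sum_apply,
      ContinuousLinearMap.proj_apply, smul_eq_mul, add_mul, Finset.sum_add_distrib, Finset.mul_sum,
      mul_ite, ite_mul, mul_one, mul_zero, zero_mul, Finset.sum_ite_eq, Finset.mem_univ, if_true]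
    rw [add_comm]
    congr 1
    exact Finset.sum_congr rfl fun i _ => by ring

lemma hasDerivAt_eval_comp (q : MvPolynomial (Fin n) ℝ) {c : ℝ → Fin n → ℝ} {c' : Fin n → ℝ}
    {t : ℝ} (hc : HasDerivAt c c' t) :
    HasDerivAt (fun s => eval (c s) q) (∑ i, eval (c t) (pderiv i q) * c' i) t := by
  have h := (hasStrictFDerivAt_eval q (c t)).hasFDerivAt.comp_hasDerivAt t hc
  simpa [Function.comp_def] using h

lemma exists_local_branch {Q : MvPolynomial (Fin n) ℝ} {m : ℕ} (hm : m < n) {p : Fin n → ℝ}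
    (hp : Crit (grad Q) (m + 1) p) (hdet : (jacMat Q (m + 1) p).det ≠ 0) :
    ∃ (c : ℝ → Fin n → ℝ) (c' : Fin n → ℝ), c (p ⟨m, hm⟩) = p ∧
      HasDerivAt c c' (p ⟨m, hm⟩) ∧
      ∀ᶠ t in nhds (p ⟨m, hm⟩), Crit (grad Q) (m + 1) (c t) ∧ AgreeLT m (c t) p ∧
        c t ⟨m, hm⟩ = t := by
  let Ψ : (Fin n → ℝ) → Fin n → ℝ := fun y l => if (l : ℕ) < m + 1 then y l else eval y (pderiv l Q)
  let L : (Fin n → ℝ) →L[ℝ] (Fin n → ℝ) :=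
    LinearMap.toContinuousLinearMap (Matrix.toLin' (jacMat Q (m + 1) p))
  have hL : L.det ≠ 0 := by
    simpa [L, ContinuousLinearMap.det] using hdet
  have hΨ : HasStrictFDerivAt Ψ L p := by
    rw [hasStrictFDerivAt_pi']
    intro l
    by_cases hl : (l : ℕ) < m + 1
    · have h := (ContinuousLinearMap.proj (R := ℝ) (φ := fun _ : Fin n => ℝ) l).hasStrictFDerivAt
        (x := p)
      have e : (fun y => Ψ y l) = fun y => ContinuousLinearMap.proj (R := ℝ) (φ := fun _ : Fin n => ℝ) l y := by
        funext y
        exact if_pos hl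
      rw [e]
      refine h.congr_fderiv ?_
      ext v
      have hl' : ∀ j, jacMat Q (m + 1) p l j = if l = j then 1 else 0 := fun j => if_pos hl
      simp [L, Matrix.mulVec, dotProduct, hl']
    · have h := hasStrictFDerivAt_eval (pderiv l Q) p
      have e : (fun y => Ψ y l) = fun y => eval y (pderiv l Q) := by
        funext y
        exact if_neg hl
      rw [e]
      refine h.congr_fderiv ?_
      ext v
      have hl' : ∀ j, jacMat Q (m + 1) p l j = eval p (pderiv j (pderiv l Q)) :=
        fun j => if_neg hl
      simp [L, Matrix.mulVec, dotProduct, hl']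
  let Le := ContinuousLinearMap.toContinuousLinearEquivOfDetNeZero L hL
  have hΨ' : HasStrictFDerivAt Ψ (Le : (Fin n → ℝ) →L[ℝ] (Fin n → ℝ)) p := by
    rw [ContinuousLinearMap.coe_toContinuousLinearEquivOfDetNeZero]
    exact hΨ
  let g := hΨ'.localInverse Ψ Le p
  let w : ℝ → Fin n → ℝ := fun t => Function.update (Ψ p) ⟨m, hm⟩ t
  have hw0 : w (p ⟨m, hm⟩) = Ψ p := by
    simp only [w]
    rw [Function.update_eq_self_iff]
    simp [Ψ]
  have hw : HasDerivAt w (Pi.single ⟨m, hm⟩ 1) (p ⟨m, hm⟩) := hasDerivAt_update _ _ _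
  have hwc : Filter.Tendsto w (nhds (p ⟨m, hm⟩)) (nhds (Ψ p)) := by
    have := hw.continuousAt
    rwa [ContinuousAt, hw0] at this
  have hg := hΨ'.to_localInverse.hasFDerivAt
  rw [← hw0] at hg
  refine ⟨fun t => g (w t), _, ?_, hg.comp_hasDerivAt (p ⟨m, hm⟩) hw, ?_⟩
  · dsimp only
    rw [hw0]
    exact hΨ'.localInverse_apply_image
  · filter_upwards [hwc.eventually hΨ'.eventually_right_inverse] with t ht
    have hl : ∀ l, Ψ (g (w t)) l = w t l := fun l => congrFun ht l
    refine ⟨fun l hlm => ?_, fun l hlm => ?_, ?_⟩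
    · have h1 := hl l
      have hne : l ≠ ⟨m, hm⟩ := by
        rintro rfl
        simp at hlm
      rw [show w t l = Ψ p l from Function.update_of_ne hne _ _,
        show Ψ (g (w t)) l = eval (g (w t)) (pderiv l Q) from if_neg (not_lt.2 hlm),
        show Ψ p l = eval p (pderiv l Q) from if_neg (not_lt.2 hlm)] at h1
      rw [grad, h1]
      exact hp l hlm
    · have h1 := hl l
      have hne : l ≠ ⟨m, hm⟩ := by
        rintro rfl
        simp at hlm
      rw [show w t l = Ψ p l from Function.update_of_ne hne _ _,
        show Ψ (g (w t)) l = g (w t) l from if_pos (Nat.lt_succ_of_lt hlm),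
        show Ψ p l = p l from if_pos (Nat.lt_succ_of_lt hlm)] at h1
      exact h1
    · simpa [Ψ, w] using hl ⟨m, hm⟩

end SemialgComp

namespace SemialgComp

open Filter Topology

variable {n : ℕ}

lemma AgreeLT.update {i : Fin n} {q z : Fin n → ℝ} (h : AgreeLT i q z) :
    AgreeLT (i + 1) q (Function.update z i (q i)) := by
  intro l hl
  rcases Nat.lt_succ_iff_lt_or_eq.1 hl with h1 | h1
  · rw [Function.update_of_ne (fun e => by rw [e] at h1; exact lt_irrefl _ h1)]
    exact h l h1
  · rw [Fin.ext h1, Function.update_self]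

/-- The data needed to walk down the critical loci of `Q` while keeping the `h j` positive. -/
structure Walk (n m₀ B : ℕ) (J : Type) where
  Q : MvPolynomial (Fin n) ℝ
  h : J → MvPolynomial (Fin n) ℝ
  u : ℕ → MvPolynomial (Fin n) ℝ
  χ : ℕ → MvPolynomial (Option (Fin n)) ℝ
  num : ℕ → Fin n → MvPolynomial (Option (Fin n)) ℝ
  den : ℕ → MvPolynomial (Option (Fin n)) ℝ
  V : ℕ → Set (MvPolynomial (Fin n) ℝ)
  bd : ℕ → (Fin n → ℝ) → ℝ
  le_B : 10000 ≤ B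
  grad_degree : ∀ l, (grad Q l).totalDegree ≤ B
  h_degree : ∀ j, (h j).totalDegree ≤ B
  u_degree : ∀ m, m₀ ≤ m → (u m).totalDegree ≤ B
  χ_degree : ∀ m, m₀ ≤ m → (χ m).totalDegree ≤ B
  num_degree : ∀ m, m₀ ≤ m → ∀ l, (num m l).totalDegree ≤ B
  den_degree : ∀ m, m₀ ≤ m → (den m).totalDegree ≤ B
  V_finDeg : ∀ m, m₀ ≤ m → FinDeg B (V m)
  bd_cont : ∀ m, m₀ ≤ m → Continuous (bd m)
  bd_base : ∀ m, m₀ ≤ m → ∀ y z, AgreeLT m y z → bd m y = bd m z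
  χ_ne : ∀ m, m₀ ≤ m → ∀ z, slice (χ m) z ≠ 0
  χ_base : ∀ m, m₀ ≤ m → ∀ y z, AgreeLT m y z → slice (χ m) y = slice (χ m) z
  num_base : ∀ m, m₀ ≤ m → ∀ y z, AgreeLT m y z → ∀ l r,
    eval (ext y r) (num m l) = eval (ext z r) (num m l)
  V_base : ∀ m, m₀ ≤ m → ∀ y z, AgreeLT m y z → ∀ δ ∈ V m, eval y δ = eval z δ
  bd_root : ∀ m, m₀ ≤ m → ∀ z r, (slice (χ m) z).eval r = 0 → |r| ≤ bd m z
  den_eq : ∀ m, m₀ ≤ m → ∀ z, slice (den m) z = (slice (χ m) z).derivative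
  crit_root : ∀ m, m₀ ≤ m → ∀ z, Crit (grad Q) m z → (slice (χ m) z).eval (eval z (u m)) = 0
  crit_coord : ∀ m, m₀ ≤ m → ∀ z, Crit (grad Q) m z → ∀ l,
    z l * eval (ext z (eval z (u m))) (den m) = eval (ext z (eval z (u m))) (num m l)
  crit_bd : ∀ m, m₀ ≤ m → ∀ z, Crit (grad Q) m z → ∀ l : Fin n, m ≤ l → |z l| ≤ bd m z
  ns_simple : ∀ m, m₀ ≤ m → ∀ z, (∀ δ ∈ V m, eval z δ ≠ 0) → ∀ r,
    (slice (χ m) z).eval r = 0 → (slice (χ m) z).derivative.eval r ≠ 0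
  ns_jac : ∀ m, m₀ ≤ m → ∀ z, (∀ δ ∈ V m, eval z δ ≠ 0) → Crit (grad Q) m z →
    (jacMat Q m z).det ≠ 0
  ns_h : ∀ m, m₀ ≤ m → ∀ z, (∀ δ ∈ V m, eval z δ ≠ 0) → Crit (grad Q) m z → ∀ j, eval z (h j) ≠ 0
  ns_grad : ∀ i : Fin n, m₀ ≤ i → ∀ z, (∀ δ ∈ V (i + 1), eval z δ ≠ 0) →
    Crit (grad Q) (i + 1) z → eval z (grad Q i) ≠ 0

namespace Walk

variable {m₀ B : ℕ} {J : Type} (W : Walk n m₀ B J)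

/-- No special polynomial of level `m` vanishes. -/
def NS (m : ℕ) (z : Fin n → ℝ) : Prop := ∀ δ ∈ W.V m, eval z δ ≠ 0

variable {W}

lemma NS.congr {m : ℕ} (hm : m₀ ≤ m) {y z : Fin n → ℝ} (h : W.NS m y) (hyz : AgreeLT m y z) :
    W.NS m z := fun δ hδ => by
  rw [← W.V_base m hm y z hyz δ hδ]
  exact h δ hδ

lemma exists_idx {m : ℕ} (hm : m₀ ≤ m) {z : Fin n → ℝ} (hz : Crit (grad W.Q) m z) :
    ∃ j, IsRootIdx (slice (W.χ m) z) j (eval z (W.u m)) :=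
  ⟨_, (Polynomial.mem_roots (W.χ_ne m hm z)).2 (W.crit_root m hm z hz), rfl⟩

lemma crit_den {m : ℕ} (hm : m₀ ≤ m) {z : Fin n → ℝ} (hN : W.NS m z) {r : ℝ}
    (hr : (slice (W.χ m) z).eval r = 0) : eval (ext z r) (W.den m) ≠ 0 := by
  rw [← eval_slice, W.den_eq m hm]
  exact W.ns_simple m hm z hN r hr

lemma crit_unique {m : ℕ} (hm : m₀ ≤ m) {p q : Fin n → ℝ} (hN : W.NS m p)
    (hp : Crit (grad W.Q) m p) (hq : Crit (grad W.Q) m q) (hpq : AgreeLT m q p)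
    (hu : eval q (W.u m) = eval p (W.u m)) : q = p := by
  funext l
  have h1 := W.crit_coord m hm p hp l
  have h2 := W.crit_coord m hm q hq l
  have hd := crit_den hm hN (W.crit_root m hm p hp)
  have hden : eval (ext q (eval p (W.u m))) (W.den m) = eval (ext p (eval p (W.u m))) (W.den m) := by
    rw [← eval_slice, ← eval_slice, W.den_eq m hm, W.den_eq m hm, W.χ_base m hm q p hpq]
  rw [hu, W.num_base m hm q p hpq, ← h1, hden] at h2
  exact mul_right_cancel₀ hd h2

variable (W)

/-- The critical point with index `j` over the line in direction `i` through `z`. -/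
structure Lab (i : Fin n) (j : ℕ) (z : Fin n → ℝ) (t : ℝ) (q : Fin n → ℝ) : Prop where
  crit : Crit (grad W.Q) (i + 1) q
  agree : AgreeLT i q z
  coord : q i = t
  idx : IsRootIdx (slice (W.χ (i + 1)) q) j (eval q (W.u (i + 1)))

variable {W} {i : Fin n} {j : ℕ} {z q p : Fin n → ℝ} {t : ℝ}

lemma agree_update (ha : AgreeLT i q z) (hc : q i = t) :
    AgreeLT (i + 1) q (Function.update z i t) := by
  rw [← hc]
  exact ha.update

lemma Lab.unique (hi : m₀ ≤ i) (hN : W.NS (i + 1) (Function.update z i t))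
    (hp : W.Lab i j z t p) (hq : W.Lab i j z t q) : q = p := by
  have hm : m₀ ≤ (i : ℕ) + 1 := hi.trans (Nat.le_succ _)
  have h1 := agree_update hp.agree hp.coord
  have h2 := agree_update hq.agree hq.coord
  have h3 := h2.trans h1.symm
  refine crit_unique hm (hN.congr hm h1.symm) hp.crit hq.crit h3 ?_
  have := hq.idx
  rw [W.χ_base _ hm q p h3] at this
  exact this.unique hp.idx

lemma isClosed_crit (f : Fin n → MvPolynomial (Fin n) ℝ) (m : ℕ) :
    IsClosed {y : Fin n → ℝ | Crit f m y} := by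
  have : {y : Fin n → ℝ | Crit f m y} = ⋂ l : Fin n, ⋂ _ : m ≤ l, {y | eval y (f l) = 0} := by
    ext y
    simp [Crit]
  rw [this]
  exact isClosed_iInter fun l => isClosed_iInter fun _ =>
    isClosed_eq (continuous_eval (f l)) continuous_const

lemma isClosed_agreeLT (m : ℕ) (z : Fin n → ℝ) : IsClosed {y : Fin n → ℝ | AgreeLT m y z} := by
  have : {y : Fin n → ℝ | AgreeLT m y z} = ⋂ l : Fin n, ⋂ _ : (l : ℕ) < m, {y | y l = z l} := by
    ext y
    simp [AgreeLT]
  rw [this]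
  exact isClosed_iInter fun l => isClosed_iInter fun _ =>
    isClosed_eq (continuous_apply l) continuous_const

/-- A closed condition that holds eventually holds at cluster points. -/
lemma _root_.MapClusterPt.mem_of_isClosed {X Y : Type*} [TopologicalSpace X] {F : Filter Y}
    {f : Y → X} {x : X} (h : MapClusterPt x F f) {s : Set X} (hs : IsClosed s)
    (hf : ∀ᶠ y in F, f y ∈ s) : x ∈ s := by
  by_contra hx
  have h1 := mapClusterPt_iff_frequently.1 h sᶜ (hs.isOpen_compl.mem_nhds hx)
  obtain ⟨y, h2, h3⟩ := (h1.and_eventually hf).exists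
  exact h2 h3

lemma exists_crit_cluster (hi : m₀ ≤ i) {F : Filter ℝ} [F.NeBot] (hF : F ≤ 𝓝 t)
    {br : ℝ → Fin n → ℝ} (h1 : ∀ᶠ s in F, Crit (grad W.Q) (i + 1) (br s))
    (h2 : ∀ᶠ s in F, AgreeLT i (br s) z) (h3 : ∀ᶠ s in F, br s i = s) :
    ∃ q, MapClusterPt q F br ∧ Crit (grad W.Q) (i + 1) q ∧ AgreeLT i q z ∧ q i = t := by
  have hm : m₀ ≤ (i : ℕ) + 1 := hi.trans (Nat.le_succ _)
  have hcont : Continuous fun s : ℝ => W.bd (i + 1) (Function.update z i s) :=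
    (W.bd_cont _ hm).comp (continuous_const.update i continuous_id)
  set M := W.bd (i + 1) (Function.update z i t) + 1 with hM
  have h4 : ∀ᶠ s in F, W.bd (i + 1) (Function.update z i s) < M :=
    (hcont.tendsto t).mono_left hF |>.eventually (gt_mem_nhds (lt_add_one _))
  have h5 : ∀ᶠ s in F, |s| < |t| + 1 :=
    (continuous_abs.tendsto t).mono_left hF |>.eventually (gt_mem_nhds (lt_add_one _))
  set R := max (max M (|t| + 1)) (∑ l, |z l|) with hR
  have h6 : ∀ᶠ s in F, br s ∈ Metric.closedBall (0 : Fin n → ℝ) R := by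
    filter_upwards [h1, h2, h3, h4, h5] with s s1 s2 s3 s4 s5
    have hR0 : 0 ≤ R := (Finset.sum_nonneg fun l _ => abs_nonneg (z l)).trans (le_max_right _ _)
    rw [mem_closedBall_zero_iff, pi_norm_le_iff_of_nonneg hR0]
    intro l
    rw [Real.norm_eq_abs]
    rcases lt_trichotomy (l : ℕ) i with hl | hl | hl
    · rw [s2 l hl]
      exact (Finset.single_le_sum (f := fun l => |z l|) (fun l _ => abs_nonneg (z l))
        (Finset.mem_univ l)).trans (le_max_right _ _)
    · rw [Fin.ext hl, s3]
      exact s5.le.trans ((le_max_right _ _).trans (le_max_left _ _))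
    · refine (W.crit_bd _ hm _ s1 l hl).trans ?_
      rw [W.bd_base _ hm _ _ (agree_update s2 s3)]
      exact s4.le.trans ((le_max_left _ _).trans (le_max_left _ _))
  obtain ⟨q, -, hq⟩ := (isCompact_closedBall (0 : Fin n → ℝ) R).exists_mapClusterPt_of_frequently
    (f := br) h6.frequently
  refine ⟨q, hq, hq.mem_of_isClosed (isClosed_crit _ _) h1,
    hq.mem_of_isClosed (isClosed_agreeLT _ z) h2, ?_⟩
  have h7 : ∀ ε > 0, q ∈ {y : Fin n → ℝ | |y i - t| ≤ ε} := fun ε hε => by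
    refine hq.mem_of_isClosed (isClosed_le (by fun_prop) continuous_const) ?_
    filter_upwards [h3, hF (Metric.closedBall_mem_nhds t hε)] with s s3 s4
    have : |br s i - t| ≤ ε := by
      rw [s3]
      simpa [Real.dist_eq] using s4
    exact this
  have h8 : |q i - t| ≤ 0 := le_of_forall_pos_le_add fun ε hε => by simpa using h7 ε hε
  exact sub_eq_zero.1 (abs_nonpos_iff.1 h8)

end Walk

end SemialgComp

namespace SemialgComp

open Filter Topology

namespace Walk

variable {n m₀ B : ℕ} {J : Type} {W : Walk n m₀ B J}
variable {i : Fin n} {j : ℕ} {z q p : Fin n → ℝ} {t : ℝ}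

lemma idx_locally_const (hi : m₀ ≤ i) (hN : W.NS (i + 1) (Function.update z i t)) {r₀ : ℝ}
    (h₀ : IsRootIdx (slice (W.χ (i + 1)) (Function.update z i t)) j r₀) :
    ∃ ε > 0, ∀ᶠ s in 𝓝 t, ∀ r, (slice (W.χ (i + 1)) (Function.update z i s)).eval r = 0 →
      |r - r₀| < ε → IsRootIdx (slice (W.χ (i + 1)) (Function.update z i s)) j r := by
  have hm : m₀ ≤ (i : ℕ) + 1 := hi.trans (Nat.le_succ _)
  have hc : Continuous fun q : ℝ × ℝ => ext (Function.update z i q.1) q.2 := by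
    refine continuous_pi fun o => ?_
    cases o with
    | none => exact continuous_snd
    | some l =>
      have h : Continuous fun q : ℝ × ℝ => Function.update z i q.1 :=
        continuous_const.update i continuous_fst
      exact (continuous_apply l).comp h
  refine IsRootIdx.locally_const (P := fun s => slice (W.χ (i + 1)) (Function.update z i s))
    (bd := fun s => W.bd (i + 1) (Function.update z i s)) ?_ ?_
    (fun s => W.χ_ne _ hm _) ((W.bd_cont _ hm).comp (continuous_const.update i continuous_id))
    (fun s r => W.bd_root _ hm _ r) (fun r => W.ns_simple _ hm _ hN r) h₀
  · simp only [eval_slice]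
    exact (MvPolynomial.continuous_eval _).comp hc
  · simp only [← W.den_eq _ hm, eval_slice]
    exact (MvPolynomial.continuous_eval _).comp hc

lemma Lab.idx_update (hi : m₀ ≤ i) (h : W.Lab i j z t p) :
    IsRootIdx (slice (W.χ (i + 1)) (Function.update z i t)) j (eval p (W.u (i + 1))) := by
  rw [← W.χ_base _ (hi.trans (Nat.le_succ _)) _ _ (agree_update h.agree h.coord)]
  exact h.idx

lemma Lab.of_update (hi : m₀ ≤ i) (h1 : Crit (grad W.Q) (i + 1) p) (h2 : AgreeLT i p z)
    (h3 : p i = t)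
    (h4 : IsRootIdx (slice (W.χ (i + 1)) (Function.update z i t)) j (eval p (W.u (i + 1)))) :
    W.Lab i j z t p := by
  refine ⟨h1, h2, h3, ?_⟩
  rw [W.χ_base _ (hi.trans (Nat.le_succ _)) _ _ (agree_update h2 h3)]
  exact h4

lemma root_update (hi : m₀ ≤ i) (h1 : Crit (grad W.Q) (i + 1) p) (h2 : AgreeLT i p z)
    (h3 : p i = t) :
    (slice (W.χ (i + 1)) (Function.update z i t)).eval (eval p (W.u (i + 1))) = 0 := by
  rw [← W.χ_base _ (hi.trans (Nat.le_succ _)) _ _ (agree_update h2 h3)]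
  exact W.crit_root _ (hi.trans (Nat.le_succ _)) p h1

lemma Lab.exists_local (hi : m₀ ≤ i) (hN : W.NS (i + 1) (Function.update z i t))
    (h : W.Lab i j z t p) :
    ∃ (c : ℝ → Fin n → ℝ) (c' : Fin n → ℝ), c t = p ∧ HasDerivAt c c' t ∧
      ∀ᶠ s in 𝓝 t, W.Lab i j z s (c s) := by
  have hm : m₀ ≤ (i : ℕ) + 1 := hi.trans (Nat.le_succ _)
  have hNp : W.NS (i + 1) p := hN.congr hm (agree_update h.agree h.coord).symm
  obtain ⟨c, c', h1, h2, h3⟩ := exists_local_branch i.2 h.crit (W.ns_jac _ hm p hNp h.crit)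
  have hpi : p ⟨i, i.2⟩ = t := h.coord
  rw [hpi] at h1 h2 h3
  refine ⟨c, c', h1, h2, ?_⟩
  obtain ⟨ε, hε, h4⟩ := idx_locally_const hi hN (h.idx_update hi)
  have h5 : ∀ᶠ s in 𝓝 t, |eval (c s) (W.u (i + 1)) - eval p (W.u (i + 1))| < ε := by
    have hc : Tendsto (fun s => eval (c s) (W.u (i + 1))) (𝓝 t) (𝓝 (eval p (W.u (i + 1)))) := by
      have := (continuous_eval (W.u (i + 1))).continuousAt.comp h2.continuousAt
      simpa [ContinuousAt, Function.comp_def, h1] using this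
    exact hc.eventually (Metric.ball_mem_nhds _ hε)
  filter_upwards [h3, h4, h5] with s s3 s4 s5
  have s2 : AgreeLT i (c s) z := s3.2.1.trans h.agree
  exact Lab.of_update hi s3.1 s2 s3.2.2 (s4 _ (root_update hi s3.1 s2 s3.2.2) s5)

lemma Lab.exists_limit (hi : m₀ ≤ i) (hN : W.NS (i + 1) (Function.update z i t))
    {F : Filter ℝ} [F.NeBot] (hF : F ≤ 𝓝 t) {br : ℝ → Fin n → ℝ}
    (hbr : ∀ᶠ s in F, W.Lab i j z s (br s)) : ∃ q, W.Lab i j z t q := by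
  obtain ⟨q, hq, h1, h2, h3⟩ := exists_crit_cluster (W := W) hi hF (hbr.mono fun s h => h.crit)
    (hbr.mono fun s h => h.agree) (hbr.mono fun s h => h.coord)
  refine ⟨q, Lab.of_update hi h1 h2 h3 ?_⟩
  have h4 : IsRootIdx (slice (W.χ (i + 1)) (Function.update z i t)) _ (eval q (W.u (i + 1))) :=
    ⟨(Polynomial.mem_roots (W.χ_ne _ (hi.trans (Nat.le_succ _)) _)).2 (root_update hi h1 h2 h3), rfl⟩
  obtain ⟨ε, hε, h5⟩ := idx_locally_const hi hN h4
  have h6 : ∃ᶠ s in F, |eval (br s) (W.u (i + 1)) - eval q (W.u (i + 1))| < ε :=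
    mapClusterPt_iff_frequently.1 hq
      ((fun y => eval y (W.u (i + 1))) ⁻¹' Metric.ball (eval q (W.u (i + 1))) ε)
      ((continuous_eval _).continuousAt.preimage_mem_nhds (Metric.ball_mem_nhds _ hε))
  obtain ⟨s, s6, s5, s7⟩ := (h6.and_eventually ((h5.filter_mono hF).and hbr)).exists
  have h8 := s5 _ (root_update hi s7.crit s7.agree s7.coord) s6
  have h9 := s7.idx_update hi
  rwa [← h8.2, h9.2] at h4

/-- Critical points can be continued along intervals avoiding the special values. -/
theorem exists_branch (hi : m₀ ≤ i) {K : Set ℝ} (hK : IsOpen K) (hKc : IsPreconnected K)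
    (hN : ∀ s : ℝ, s ∈ K → W.NS ((i : ℕ) + 1) (Function.update z i s)) (ht : t ∈ K) (hp : W.Lab i j z t p) :
    ∃ br : ℝ → (Fin n → ℝ), br t = p ∧ (∀ s : ℝ, s ∈ K → W.Lab i j z s (br s)) ∧ ContinuousOn br K ∧
      ∀ s : ℝ, s ∈ K → HasDerivAt (fun r : ℝ => eval (br r) W.Q) (eval (br s) (grad W.Q i)) s := by
  classical
  have hTo : IsOpen {s : ℝ | s ∈ K ∧ ∃ q, W.Lab i j z s q} := by
    rw [isOpen_iff_mem_nhds]
    rintro s ⟨hs, q, hq⟩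
    obtain ⟨c, c', -, -, h3⟩ := hq.exists_local hi (hN s hs)
    filter_upwards [hK.mem_nhds hs, h3] with r r1 r2
    exact ⟨r1, _, r2⟩
  have hKT : K ⊆ {s | s ∈ K ∧ ∃ q, W.Lab i j z s q} := by
    refine hKc.subset_of_closure_inter_subset hTo ⟨t, ht, ht, p, hp⟩ ?_
    rintro s ⟨h1, h2⟩
    refine ⟨h2, ?_⟩
    have : (𝓝[{s | s ∈ K ∧ ∃ q, W.Lab i j z s q}] s).NeBot := mem_closure_iff_nhdsWithin_neBot.1 h1
    let br : ℝ → Fin n → ℝ := fun s => if h : ∃ q, W.Lab i j z s q then h.choose else 0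
    refine Lab.exists_limit hi (hN s h2) nhdsWithin_le_nhds (br := br)
      (F := 𝓝[{s | s ∈ K ∧ ∃ q, W.Lab i j z s q}] s) ?_
    filter_upwards [self_mem_nhdsWithin] with r hr
    simp only [br, dif_pos hr.2]
    exact hr.2.choose_spec
  have hex : ∀ s : ℝ, s ∈ K → ∃ q, W.Lab i j z s q := fun s hs => (hKT hs).2
  choose! br hbr using hex
  have hloc : ∀ s ∈ K, ∃ c', HasDerivAt br c' s := by
    intro s hs
    obtain ⟨c, c', h1, h2, h3⟩ := (hbr s hs).exists_local hi (hN s hs)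
    refine ⟨c', h2.congr_of_eventuallyEq ?_⟩
    filter_upwards [hK.mem_nhds hs, h3] with r r1 r2
    exact Lab.unique hi (hN r r1) r2 (hbr r r1)
  refine ⟨br, Lab.unique hi (hN t ht) hp (hbr t ht), hbr, fun s hs => ?_, fun s hs => ?_⟩
  · exact (hloc s hs).choose_spec.continuousAt.continuousWithinAt
  · obtain ⟨c', hc'⟩ := hloc s hs
    have h := hasDerivAt_eval_comp W.Q hc'
    have hpi := hasDerivAt_pi.1 hc'
    have hlt : ∀ l : Fin n, (l : ℕ) < i → c' l = 0 := fun l hl => by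
      refine (hpi l).unique ((hasDerivAt_const s (z l)).congr_of_eventuallyEq ?_)
      filter_upwards [hK.mem_nhds hs] with r r1
      exact (hbr r r1).agree l hl
    have heq : c' i = 1 := by
      refine (hpi i).unique ((hasDerivAt_id s).congr_of_eventuallyEq ?_)
      filter_upwards [hK.mem_nhds hs] with r r1
      exact (hbr r r1).coord
    rw [Finset.sum_eq_single i] at h
    · simpa [heq, grad] using h
    · intro l _ hl
      rcases lt_or_gt_of_ne hl with h1 | h1
      · rw [hlt l h1, mul_zero]
      · have : eval (br s) (pderiv l W.Q) = 0 := (hbr s hs).crit l h1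
        rw [this, zero_mul]
    · simp

end Walk

end SemialgComp

namespace SemialgComp

open Filter Topology

variable {ι α : Type}

lemma Decided.atRoot {n D : ℕ} (hn : 1 ≤ n) (hD : 1 ≤ D) {p : MvPolynomial (Option ι) ℝ}
    (hp : p.totalDegree ≤ n) {φ : (Option ι → ℝ) → α} (hφ : Decided D φ) (i : ℕ) :
    ∃ Φ : (ι → ℝ) → Option α, Decided (300 * n ^ 9 * D) Φ ∧
      (∀ z v, IsRootIdx (slice p z) i v → Φ z = some (φ (ext z v))) ∧
      ∀ z, (¬ ∃ v, IsRootIdx (slice p z) i v) → Φ z = none := by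
  classical
  obtain ⟨F, hF, h⟩ := Decided.roots hn hD hp hφ
  set Φ : (ι → ℝ) → Option α := fun z =>
    if hz : ∃ v, IsRootIdx (slice p z) i v then some (φ (ext z hz.choose)) else none with hΦ
  have h1 : ∀ z v, IsRootIdx (slice p z) i v → Φ z = some (φ (ext z v)) := fun z v hv => by
    have hz : ∃ v, IsRootIdx (slice p z) i v := ⟨v, hv⟩
    simp only [hΦ, dif_pos hz]
    rw [hz.choose_spec.unique hv]
  have h2 : ∀ z, (¬ ∃ v, IsRootIdx (slice p z) i v) → Φ z = none := fun z hz => by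
    simp only [hΦ, dif_neg hz]
  refine ⟨Φ, ⟨F, hF, fun z z' hz => ?_⟩, h1, h2⟩
  by_cases he : ∃ v, IsRootIdx (slice p z) i v
  · obtain ⟨v, hv⟩ := he
    obtain ⟨v', hv', e⟩ := h z z' hz i v hv
    rw [h1 z v hv, h1 z' v' hv', e]
  · have he' : ¬ ∃ v, IsRootIdx (slice p z') i v := fun ⟨v, hv⟩ => by
      obtain ⟨v', hv', -⟩ := h z' z hz.symm i v hv
      exact he ⟨v', hv'⟩
    rw [h2 z he, h2 z' he']

lemma exists_pullback {κ K : Type} {b : κ → (K → ℝ) → ℝ} (hb : ∀ l, PolyFn 1 (b l))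
    (q : MvPolynomial (Option κ) ℝ) : ∃ q' : MvPolynomial (Option K) ℝ,
      q'.totalDegree ≤ q.totalDegree ∧ ∀ x r, eval (ext x r) q' = eval (ext (fun l => b l x) r) q := by
  have hψ : ∀ o : Option κ, PolyFn 1 (fun w : Option K → ℝ =>
      ext (fun l => b l fun x => w (some x)) (w none) o) := by
    rintro (_ | l)
    · exact PolyFn.coord le_rfl none
    · have := (hb l).comp (K := 1) (fun x : K => PolyFn.coord le_rfl (some x))
      exact this
  have h := (PolyFn.eval (q := q) le_rfl).comp hψ
  rw [mul_one] at h
  obtain ⟨q', h1, h2⟩ := h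
  exact ⟨q', h1, fun x r => (h2 (ext x r)).symm⟩

namespace Walk

variable {n m₀ B : ℕ} {J : Type} (W : Walk n m₀ B J)

lemma one_le_B (W : Walk n m₀ B J) : 1 ≤ B := le_trans (by norm_num) W.le_B

/-- Decided functions of a critical point with given index are decided by its base point. -/
lemma critUp {m D : ℕ} (hm : m₀ ≤ m) {K E : Type} {b : Fin n → (K → ℝ) → ℝ}
    (hb : ∀ l, PolyFn 1 (b l)) {c : E → (K → ℝ) → ℝ} (hc : ∀ e, PolyFn 1 (c e))
    {φ : (Fin n ⊕ E → ℝ) → α} (hφ : Decided D φ) (hD : 1 ≤ D) (j : ℕ) :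
    ∃ Φ : (K → ℝ) → Option α, Decided (B ^ 11 * D) Φ ∧ ∀ x p, W.NS m p →
      AgreeLT m p (fun l => b l x) → Crit (grad W.Q) m p →
      IsRootIdx (slice (W.χ m) p) j (eval p (W.u m)) →
      Φ x = some (φ (Sum.elim p fun e => c e x)) := by
  have hB := W.one_le_B
  obtain ⟨χ', hχd, hχ⟩ := exists_pullback hb (W.χ m)
  obtain ⟨den', hdd, hden⟩ := exists_pullback hb (W.den m)
  choose num' hnd hnum using fun l => exists_pullback hb (W.num m l)
  obtain ⟨Φ₁, h1, h2, -⟩ := hφ.comp_div (K := B + 1)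
    (ψ := fun s (w : Option K → ℝ) => Sum.elim (fun l => eval w (num' l))
      (fun e => c e (fun x => w (some x)) * eval w den') s)
    (f₀ := fun w => eval w den') (by
      rintro (l | e)
      · exact PolyFn.eval ((hnd l).trans ((W.num_degree m hm l).trans (Nat.le_succ _)))
      · refine PolyFn.mono (((hc e).comp (fun x => PolyFn.coord le_rfl (some x))).mul
          (PolyFn.eval (hdd.trans (W.den_degree m hm)))) (by omega))
    (PolyFn.eval (hdd.trans ((W.den_degree m hm).trans (Nat.le_succ _)))) hD
  obtain ⟨Φ₂, h3, h4, -⟩ := h1.atRoot hB (by nlinarith [Nat.zero_le B]) (hχd.trans (W.χ_degree m hm)) j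
  refine ⟨fun x => (Φ₂ x).join, (h3.comp Option.join).mono ?_, fun x p hN hp hcr hi => ?_⟩
  · have h5 : 600 * (B + 1) ≤ B ^ 2 := by nlinarith [W.le_B]
    calc 300 * B ^ 9 * (2 * D * (B + 1)) = B ^ 9 * D * (600 * (B + 1)) := by ring
      _ ≤ B ^ 9 * D * B ^ 2 := Nat.mul_le_mul_left _ h5
      _ = B ^ 11 * D := by ring
  · have hχe : slice χ' x = slice (W.χ m) p := by
      rw [W.χ_base m hm _ _ hp]
      refine Polynomial.funext fun r => ?_
      rw [eval_slice, eval_slice, hχ]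
    have hde : eval (ext x (eval p (W.u m))) den' = eval (ext p (eval p (W.u m))) (W.den m) := by
      rw [hden, ← eval_slice, ← eval_slice, W.den_eq m hm, W.den_eq m hm, W.χ_base m hm _ _ hp]
    have hd0 := crit_den hm hN (W.crit_root m hm p hcr)
    rw [← hde] at hd0
    change (Φ₂ x).join = _
    rw [h4 x (eval p (W.u m)) (by rw [hχe]; exact hi), h2 _ hd0]
    simp only [Option.join_some, Option.some.injEq]
    congr 1
    funext s
    rcases s with l | e
    · simp only [Sum.elim_inl]
      rw [div_eq_iff hd0, hde, W.crit_coord m hm p hcr l, hnum, W.num_base m hm _ _ hp]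
    · simp only [Sum.elim_inr, ext_some]
      rw [mul_div_cancel_right₀ _ hd0]

/-- Transfer of the behaviour of a labelled branch near a root of a univariate polynomial. -/
lemma stateTransfer {D : ℕ} {i : Fin n} (hi : m₀ ≤ i) {δ : MvPolynomial (Option (Fin n)) ℝ}
    (hδ : δ.totalDegree ≤ B) (k j : ℕ) (σ : ℝ) {φ : (Fin n ⊕ Bool → ℝ) → α} (hφ : Decided D φ)
    (hD : 1 ≤ D) :
    ∃ Φ : (Fin n → ℝ) → Option (Option α), Decided (B ^ 21 * D) Φ ∧
      ∀ z v, IsRootIdx (slice δ z) k v →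
      ∀ᶠ κ in 𝓝[>] (0 : ℝ), ∀ᶠ ξ in 𝓝[>] (0 : ℝ), ∀ᶠ η in 𝓝[>] (0 : ℝ), ∀ p,
        W.NS (i + 1) (Function.update z i (v + σ * η)) → W.Lab i j z (v + σ * η) p →
        Φ z = some (some (φ (Sum.elim p fun e => if e then κ else v - σ * ξ))) := by
  have hB := W.one_le_B
  obtain ⟨Φ₀, h0, h0'⟩ := W.critUp (m := i + 1) (hi.trans (Nat.le_succ _))
    (K := Option (Option (Option (Option (Fin n)))))
    (b := fun l w => if l = i then w (some (some (some none))) + σ * w none else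
      w (some (some (some (some l)))))
    (c := fun (e : Bool) w => if e then w (some (some none)) else
      w (some (some (some none))) - σ * w (some none))
    (by
      intro l
      by_cases hl : l = i
      · simp only [hl, if_true]
        exact (PolyFn.coord le_rfl _).add ((PolyFn.coord le_rfl _).const_mul σ)
      · simp only [hl, if_false]
        exact PolyFn.coord le_rfl _)
    (by
      rintro (_ | _)
      · exact (PolyFn.coord le_rfl _).sub ((PolyFn.coord le_rfl _).const_mul σ)
      · exact PolyFn.coord le_rfl _) hφ hD j
  obtain ⟨Φ₁, h1, h1'⟩ := h0.small
  obtain ⟨Φ₂, h2, h2'⟩ := h1.small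
  obtain ⟨Φ₃, h3, h3'⟩ := h2.small
  obtain ⟨Φ, h4, h4', -⟩ := h3.atRoot hB (Nat.mul_pos (Nat.pow_pos hB) hD) hδ k
  refine ⟨Φ, h4.mono ?_, fun z v hv => ?_⟩
  · have : 300 ≤ B := le_trans (by norm_num) W.le_B
    calc 300 * B ^ 9 * (B ^ 11 * D) = 300 * (B ^ 20 * D) := by ring
      _ ≤ B * (B ^ 20 * D) := Nat.mul_le_mul_right _ this
      _ = B ^ 21 * D := by ring
  · filter_upwards [h3' (ext z v)] with κ hκ
    filter_upwards [h2' (ext (ext z v) κ)] with ξ hξ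
    filter_upwards [h1' (ext (ext (ext z v) κ) ξ)] with η hη
    intro p hN hp
    rw [h4' z v hv, ← hκ, ← hξ, ← hη]
    have hag := agree_update hp.agree hp.coord
    have := h0' (ext (ext (ext (ext z v) κ) ξ) η) p (hN.congr (hi.trans (Nat.le_succ _)) hag.symm)
      (by
        refine hag.trans fun l _ => ?_
        by_cases hl : l = i
        · subst hl; simp
        · simp [hl]) hp.crit hp.idx
    rw [this]
    congr 3

end Walk

lemma Decided.exists_root {n D : ℕ} (hn : 1 ≤ n) (hD : 1 ≤ D) {p : MvPolynomial (Option ι) ℝ}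
    (hp : p.totalDegree ≤ n) {ψ : (Option ι → ℝ) → Prop} (hψ : Decided D ψ) :
    Decided (300 * n ^ 9 * D) (fun z => ∃ v ∈ (slice p z).roots, ψ (ext z v)) := by
  obtain ⟨F, hF, h⟩ := Decided.roots hn hD hp hψ
  have key : ∀ z z', SameSign F z z' → (∃ v ∈ (slice p z).roots, ψ (ext z v)) →
      ∃ v ∈ (slice p z').roots, ψ (ext z' v) := by
    rintro z z' hz ⟨v, hv, hv'⟩
    obtain ⟨w, hw, e⟩ := h z z' hz _ v ⟨hv, rfl⟩
    exact ⟨w, hw.1, e ▸ hv'⟩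
  exact ⟨F, hF, fun z z' hz => propext ⟨key z z' hz, key z' z hz.symm⟩⟩

lemma Decided.exists_rootIdx {n D : ℕ} (hn : 1 ≤ n) (hD : 1 ≤ D) {p : MvPolynomial (Option ι) ℝ}
    (hp : p.totalDegree ≤ n) {ψ : (Option ι → ℝ) → Prop} (hψ : Decided D ψ) (k : ℕ) :
    Decided (300 * n ^ 9 * D) (fun z => ∃ v, IsRootIdx (slice p z) k v ∧ ψ (ext z v)) := by
  obtain ⟨F, hF, h⟩ := Decided.roots hn hD hp hψ
  have key : ∀ z z', SameSign F z z' → (∃ v, IsRootIdx (slice p z) k v ∧ ψ (ext z v)) →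
      ∃ v, IsRootIdx (slice p z') k v ∧ ψ (ext z' v) := by
    rintro z z' hz ⟨v, hv, hv'⟩
    obtain ⟨w, hw, e⟩ := h z z' hz _ v hv
    exact ⟨w, hw, e ▸ hv'⟩
  exact ⟨F, hF, fun z z' hz => propext ⟨key z z' hz, key z' z hz.symm⟩⟩

lemma slice_rename_map (p : MvPolynomial (Option ι) ℝ) (w : Option ι → ℝ) :
    slice (rename (Option.map some) p) w = slice p (fun i => w (some i)) := by
  refine Polynomial.funext fun u => ?_
  rw [eval_slice, eval_slice, eval_rename]
  congr 1
  congr 1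
  funext o
  cases o <;> rfl

/-- The polynomial `δ` viewed as a univariate polynomial in the `i`-th coordinate. -/
noncomputable def along {n : ℕ} (i : Fin n) (δ : MvPolynomial (Fin n) ℝ) :
    MvPolynomial (Option (Fin n)) ℝ := rename (fun l => if l = i then none else some l) δ

variable {n : ℕ} (i : Fin n)

lemma eval_along (δ : MvPolynomial (Fin n) ℝ) (z : Fin n → ℝ) (t : ℝ) :
    (slice (along i δ) z).eval t = eval (Function.update z i t) δ := by
  rw [eval_slice, along, eval_rename]
  congr 1
  congr 1
  funext l
  by_cases h : l = i
  · subst h; simp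
  · simp [h]

lemma along_degree (δ : MvPolynomial (Fin n) ℝ) : (along i δ).totalDegree ≤ δ.totalDegree :=
  totalDegree_rename_le _ _

namespace Walk

variable {m₀ B : ℕ} {J : Type} (W : Walk n m₀ B J) {i}

lemma along_congr {W : Walk n m₀ B J} (hi : m₀ ≤ i) {δ : MvPolynomial (Fin n) ℝ}
    (hδ : δ ∈ W.V (i + 1)) {y z : Fin n → ℝ} (h : AgreeLT i y z) :
    slice (along i δ) y = slice (along i δ) z := by
  refine Polynomial.funext fun t => ?_
  rw [eval_along, eval_along]
  refine W.V_base _ (hi.trans (Nat.le_succ _)) _ _ (fun l hl => ?_) δ hδ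
  by_cases hli : l = i
  · subst hli; simp
  · rw [Function.update_of_ne hli, Function.update_of_ne hli]
    refine h l (lt_of_le_of_ne (Nat.lt_succ_iff.1 hl) fun e => hli (Fin.ext e))

variable (i) in
/-- The `k`-th root of `δ` is the special value next to `p i` on the side given by `σ`. -/
def Near (δ : MvPolynomial (Fin n) ℝ) (k : ℕ) (σ : ℝ) (p : Fin n → ℝ) : Prop :=
  ∃ v, IsRootIdx (slice (along i δ) p) k v ∧ 0 < σ * (p i - v) ∧
    ∀ δ₂ ∈ W.V (i + 1), ¬ ∃ r ∈ (slice (along i δ₂) p).roots, 0 < σ * (r - v) ∧ 0 < σ * (p i - r)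

lemma decided_pos {κ : Type} {f : (κ → ℝ) → ℝ} {D : ℕ} (h : PolyFn D f) :
    Decided D (fun w => 0 < f w) :=
  h.decided.of_fun_eq fun z z' hz => propext (by rw [← sign_eq_one_iff, hz, sign_eq_one_iff])

lemma decided_near (hi : m₀ ≤ i) {δ : MvPolynomial (Fin n) ℝ} (hδ : δ ∈ W.V (i + 1)) (k : ℕ)
    (σ : ℝ) : Decided (B ^ 20) (W.Near i δ k σ) := by
  have hB := W.one_le_B
  have hV := W.V_finDeg (i + 1) (hi.trans (Nat.le_succ _))
  have := hV.1.to_subtype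
  have h1 : ∀ δ₂ : W.V (i + 1), Decided (300 * B ^ 9 * 1) (fun w : Option (Fin n) → ℝ =>
      ∃ r ∈ (slice (along i δ₂.1) (fun l => w (some l))).roots,
        0 < σ * (r - w none) ∧ 0 < σ * (w (some i) - r)) := fun δ₂ => by
    have h2 : Decided 1 (fun w : Option (Option (Fin n)) → ℝ =>
        0 < σ * (w none - w (some none)) ∧ 0 < σ * (w (some (some i)) - w none)) :=
      (decided_pos (((PolyFn.coord le_rfl _).sub (PolyFn.coord le_rfl _)).const_mul σ)).comp₂
        (decided_pos (((PolyFn.coord le_rfl _).sub (PolyFn.coord le_rfl _)).const_mul σ)) And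
    have h3 := h2.exists_root hB le_rfl (p := rename (Option.map some) (along i δ₂.1))
      ((totalDegree_rename_le _ _).trans ((along_degree i _).trans (hV.2 _ δ₂.2)))
    simpa only [slice_rename_map, ext_none, ext_some] using h3
  have h2 : Decided (300 * B ^ 9 * 1) (fun w : Option (Fin n) → ℝ =>
      0 < σ * (w (some i) - w none) ∧ ∀ δ₂ ∈ W.V (i + 1),
        ¬ ∃ r ∈ (slice (along i δ₂) (fun l => w (some l))).roots,
        0 < σ * (r - w none) ∧ 0 < σ * (w (some i) - r)) := by
    have h4 := ((decided_pos (((PolyFn.coord (ι := Option (Fin n)) le_rfl (some i)).sub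
      (PolyFn.coord le_rfl none)).const_mul σ)).mono (E := 300 * B ^ 9 * 1)
      (by have := Nat.one_le_pow 9 B hB; omega)).prodMk (Decided.pi h1)
    refine (h4.comp fun a => a.1 ∧ ∀ δ₂, ¬ a.2 δ₂).of_fun_eq fun z z' hz => ?_
    simpa only [Subtype.forall] using hz
  refine (h2.exists_rootIdx hB (by have := Nat.one_le_pow 9 B hB; omega)
    ((along_degree i _).trans (hV.2 _ hδ)) k).mono ?_
  have h5 : 90000 ≤ B ^ 2 := by nlinarith [W.le_B]
  calc 300 * B ^ 9 * (300 * B ^ 9 * 1) = 90000 * B ^ 18 := by ring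
    _ ≤ B ^ 2 * B ^ 18 := Nat.mul_le_mul_right _ h5
    _ = B ^ 20 := by ring

end Walk

end SemialgComp

namespace SemialgComp

open Filter Topology

namespace Walk

variable {n m₀ B : ℕ} {J : Type} (W : Walk n m₀ B J)

/-- Some point over the first `m` coordinates of `z` is generic at all levels from `m` on. -/
def Good (m : ℕ) (z : Fin n → ℝ) : Prop :=
  ∃ y, AgreeLT m y z ∧ ∀ m', m ≤ m' → m' ≤ n → W.NS m' y

/-- All the obstacle polynomials are positive. -/
def Pos (z : Fin n → ℝ) : Prop := ∀ j, 0 < eval z (W.h j)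

/-- `z` and `p` can be joined inside the fibre over the first `m` coordinates, keeping the
obstacles positive and `Q` below `c`. -/
def Conn (m : ℕ) (z p : Fin n → ℝ) (c : ℝ) : Prop :=
  ∃ T : Set (Fin n → ℝ), IsPreconnected T ∧ z ∈ T ∧ p ∈ T ∧
    ∀ y ∈ T, AgreeLT m y z ∧ W.Pos y ∧ eval y W.Q < c

/-- The restriction of `Q` to the fibre through `z` is proper and bounded below. -/
def Coer (z : Fin n → ℝ) : Prop :=
  (∀ c, ∃ R : ℝ, ∀ y, AgreeLT m₀ y z → eval y W.Q ≤ c → ∀ l, |y l| ≤ R) ∧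
    ∃ b, ∀ y, AgreeLT m₀ y z → b ≤ eval y W.Q

variable {W} {i : Fin n} {j m : ℕ} {z y q p : Fin n → ℝ} {c c' t : ℝ}

lemma Good.congr (h : W.Good m z) (hy : AgreeLT m z y) : W.Good m y := by
  obtain ⟨x, h1, h2⟩ := h
  exact ⟨x, h1.trans hy, h2⟩

lemma Good.ns (hm : m₀ ≤ m) (hn : m ≤ n) (h : W.Good m z) : W.NS m z := by
  obtain ⟨x, h1, h2⟩ := h
  exact (h2 m le_rfl hn).congr hm h1

lemma Good.eventually (hi : m₀ ≤ i) (h : W.Good i z) :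
    ∀ᶠ t in cofinite, W.Good (i + 1) (Function.update z i t) := by
  obtain ⟨x, h1, h2⟩ := h
  have hfin : (⋃ m' ∈ Finset.Icc ((i : ℕ) + 1) n, ⋃ δ ∈ W.V m',
      {t | (slice (along i δ) x).IsRoot t}).Finite := by
    refine Set.Finite.biUnion (Finset.finite_toSet _) fun m' hm' => ?_
    have hm := Finset.mem_Icc.1 (Finset.mem_coe.1 hm')
    have hle : m₀ ≤ m' := by omega
    refine Set.Finite.biUnion (W.V_finDeg m' hle).1 fun δ hδ => Polynomial.finite_setOfPred_isRoot ?_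
    intro h0
    have h3 := eval_along i δ x (x i)
    rw [h0, Function.update_eq_self, Polynomial.eval_zero] at h3
    exact h2 m' (by omega) hm.2 δ hδ h3.symm
  filter_upwards [hfin.compl_mem_cofinite] with t ht
  refine ⟨Function.update x i t, fun l hl => ?_, fun m' hm' hn δ hδ h0 => ht ?_⟩
  · by_cases hli : l = i
    · subst hli; simp
    · rw [Function.update_of_ne hli, Function.update_of_ne hli]
      exact h1 l (lt_of_le_of_ne (Nat.lt_succ_iff.1 hl) fun e => hli (Fin.ext e))
  · simp only [mem_iUnion]
    refine ⟨m', Finset.mem_Icc.2 ⟨hm', hn⟩, δ, hδ, ?_⟩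
    change (slice (along i δ) x).eval t = 0
    rw [eval_along, h0]

lemma Good.eventually_right (hi : m₀ ≤ i) (h : W.Good i z) (v : ℝ) {σ : ℝ} (hσ : σ ≠ 0) :
    ∀ᶠ η in 𝓝[>] (0 : ℝ), W.Good (i + 1) (Function.update z i (v + σ * η)) := by
  have hinj : Function.Injective fun η : ℝ => v + σ * η := fun a b hab =>
    mul_left_cancel₀ hσ (add_left_cancel hab)
  have h1 := hinj.tendsto_cofinite.eventually (h.eventually hi)
  exact h1.filter_mono ((nhdsGT_le_nhdsNE 0).trans (nhdsNE_le_cofinite 0))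

lemma Conn.agree (h : W.Conn m z p c) : AgreeLT m p z := by
  obtain ⟨T, -, -, h3, h4⟩ := h
  exact (h4 p h3).1

lemma Conn.pos (h : W.Conn m z p c) : W.Pos p := by
  obtain ⟨T, -, -, h3, h4⟩ := h
  exact (h4 p h3).2.1

lemma Conn.lt (h : W.Conn m z p c) : eval p W.Q < c := by
  obtain ⟨T, -, -, h3, h4⟩ := h
  exact (h4 p h3).2.2

lemma Conn.mono (h : W.Conn m z p c) (hc : c ≤ c') : W.Conn m z p c' := by
  obtain ⟨T, h1, h2, h3, h4⟩ := h
  exact ⟨T, h1, h2, h3, fun y hy => ⟨(h4 y hy).1, (h4 y hy).2.1, (h4 y hy).2.2.trans_le hc⟩⟩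

lemma Conn.mono_level {m' : ℕ} (h : W.Conn m' z p c) (hm : m ≤ m') : W.Conn m z p c := by
  obtain ⟨T, h1, h2, h3, h4⟩ := h
  exact ⟨T, h1, h2, h3, fun y hy => ⟨(h4 y hy).1.mono hm, (h4 y hy).2⟩⟩

lemma Conn.trans (h : W.Conn m z p c) (h' : W.Conn m p q c) : W.Conn m z q c := by
  have hp := h.agree
  obtain ⟨T, h1, h2, h3, h4⟩ := h
  obtain ⟨T', h1', h2', h3', h4'⟩ := h'
  refine ⟨T ∪ T', h1.union p h3 h2' h1', Or.inl h2, Or.inr h3', ?_⟩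
  rintro y (hy | hy)
  · exact h4 y hy
  · exact ⟨(h4' y hy).1.trans hp, (h4' y hy).2⟩

lemma Conn.refl (hz : W.Pos z) (hc : eval z W.Q < c) : W.Conn m z z c :=
  ⟨{z}, isPreconnected_singleton, rfl, rfl, by rintro y rfl; exact ⟨AgreeLT.refl _ _, hz, hc⟩⟩

lemma convex_agreeLT (m : ℕ) (z : Fin n → ℝ) : Convex ℝ {y : Fin n → ℝ | AgreeLT m y z} := by
  intro a ha b hb s t _ _ hst l hl
  simp only [Pi.add_apply, Pi.smul_apply, smul_eq_mul, ha l hl, hb l hl]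
  rw [← add_mul, hst, one_mul]

/-- Points near a cluster point of a family of reachable points are reachable. -/
lemma conn_of_cluster [Finite J] {F : Filter ℝ} {br : ℝ → Fin n → ℝ} (hq : MapClusterPt q F br)
    (h : ∀ᶠ s in F, W.Conn m z (br s) c) (hp : W.Pos q) (hc : eval q W.Q < c) :
    ∀ᶠ y in 𝓝 q, AgreeLT m y z → W.Conn m z y c := by
  have hopen : {y : Fin n → ℝ | W.Pos y ∧ eval y W.Q < c} ∈ 𝓝 q := by
    have h1 : ∀ᶠ y in 𝓝 q, ∀ j, 0 < eval y (W.h j) := eventually_all.2 fun j =>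
      ((continuous_eval (W.h j)).tendsto q).eventually (lt_mem_nhds (hp j))
    filter_upwards [h1, ((continuous_eval W.Q).tendsto q).eventually (gt_mem_nhds hc)]
      with y h2 h3 using ⟨h2, h3⟩
  obtain ⟨ε, hε, hball⟩ := Metric.mem_nhds_iff.1 hopen
  filter_upwards [Metric.ball_mem_nhds q hε] with y hy hyz
  obtain ⟨s, hs1, hs2⟩ := ((mapClusterPt_iff_frequently.1 hq _
    (Metric.ball_mem_nhds q hε)).and_eventually h).exists
  refine hs2.trans ⟨Metric.ball q ε ∩ {y | AgreeLT m y z},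
    ((convex_ball q ε).inter (convex_agreeLT m z)).isPreconnected, ⟨hs1, hs2.agree⟩, ⟨hy, hyz⟩, ?_⟩
  exact fun x hx => ⟨hx.2.trans hs2.agree.symm, hball hx.1⟩

lemma conn_nhds [Finite J] (hp : W.Pos z) (hc : eval z W.Q < c) :
    ∀ᶠ y in 𝓝 z, AgreeLT m y z → W.Conn m z y c := by
  refine conn_of_cluster (F := 𝓝 (0 : ℝ)) (br := fun _ => z) ?_
    (Eventually.of_forall fun _ => Conn.refl hp hc) hp hc
  exact tendsto_const_nhds.mapClusterPt

lemma pos_of_preconnected {K : Set ℝ} (hK : IsPreconnected K) {f : ℝ → ℝ} (hf : ContinuousOn f K)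
    (h0 : ∀ s ∈ K, f s ≠ 0) {t : ℝ} (ht : t ∈ K) (hpos : 0 < f t) : ∀ s ∈ K, 0 < f s := by
  intro s hs
  by_contra hneg
  obtain ⟨r, hr, hr0⟩ := hK.intermediate_value hs ht hf ⟨not_lt.1 hneg, hpos.le⟩
  exact h0 r hr hr0

/-- Following a branch in the direction in which `Q` decreases. -/
lemma descend [Finite J] (hi : m₀ ≤ i) {K : Set ℝ} (hK : IsOpen K) (hKc : IsPreconnected K)
    (hN : ∀ s ∈ K, W.NS (i + 1) (Function.update p i s)) (ht : p i ∈ K)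
    (hcr : Crit (grad W.Q) (i + 1) p)
    (hidx : IsRootIdx (slice (W.χ (i + 1)) p) j (eval p (W.u (i + 1)))) {σ : ℝ} (hσ : σ * σ = 1)
    (hg : 0 < σ * eval p (grad W.Q i)) (hp : W.Pos p) (hc : eval p W.Q < c) :
    ∀ s ∈ K, 0 ≤ σ * (p i - s) → ∃ q, W.Lab i j p s q ∧ 0 < σ * eval q (grad W.Q i) ∧
      W.Conn i p q c ∧ eval q W.Q ≤ eval p W.Q := by
  obtain ⟨br, b1, b2, b3, b4⟩ := exists_branch hi hK hKc hN ht ⟨hcr, AgreeLT.refl _ _, rfl, hidx⟩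
  have hm : m₀ ≤ (i : ℕ) + 1 := hi.trans (Nat.le_succ _)
  have hNS : ∀ s ∈ K, W.NS (i + 1) (br s) := fun s hs =>
    (hN s hs).congr hm (agree_update (b2 s hs).agree (b2 s hs).coord).symm
  have hpos : ∀ s ∈ K, W.Pos (br s) := fun s hs j' => by
    refine pos_of_preconnected hKc ((continuous_eval (W.h j')).comp_continuousOn b3)
      (fun r hr => W.ns_h _ hm _ (hNS r hr) (b2 r hr).crit j') ht ?_ s hs
    rw [Function.comp_apply, b1]
    exact hp j'
  have hgr : ∀ s ∈ K, 0 < σ * eval (br s) (grad W.Q i) := by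
    refine pos_of_preconnected hKc (continuousOn_const.mul
      ((continuous_eval (grad W.Q i)).comp_continuousOn b3)) (fun r hr => mul_ne_zero ?_ ?_) ht ?_
    · rintro rfl; simp at hσ
    · exact W.ns_grad i hi _ (hNS r hr) (b2 r hr).crit
    · simp only [b1]
      exact hg
  have hord := hKc.ordConnected
  have hle : ∀ s ∈ K, 0 ≤ σ * (p i - s) → eval (br s) W.Q ≤ eval p W.Q := by
    intro s hs hsp
    have hanti : ∀ a ∈ K, ∀ b ∈ K, a < b → 0 ≤ σ * (eval (br b) W.Q - eval (br a) W.Q) := by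
      intro a ha b hb hab
      have hsub := hord.out ha hb
      obtain ⟨x, hx, hx'⟩ := exists_hasDerivAt_eq_slope (fun r => eval (br r) W.Q)
        (fun r => eval (br r) (grad W.Q i)) hab
        ((continuous_eval W.Q).comp_continuousOn (b3.mono hsub))
        fun x hx => b4 x (hsub (Ioo_subset_Icc_self hx))
      have h1 := hgr x (hsub (Ioo_subset_Icc_self hx))
      rw [eq_div_iff (sub_pos.2 hab).ne'] at hx'
      rw [← hx', ← mul_assoc]
      exact mul_nonneg h1.le (sub_pos.2 hab).le
    rw [← b1]
    rcases lt_trichotomy s (p i) with h | h | h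
    · have h1 : 0 < σ := by
        by_contra h0
        rcases (not_lt.1 h0).lt_or_eq with h2 | h2
        · nlinarith [sub_pos.2 h]
        · rw [h2] at hσ; simp at hσ
      have h2 := hanti s hs _ ht h
      nlinarith
    · rw [h]
    · have h1 : σ < 0 := by
        by_contra h0
        rcases (not_lt.1 h0).lt_or_eq with h2 | h2
        · nlinarith [sub_pos.2 h]
        · rw [← h2] at hσ; simp at hσ
      have h2 := hanti _ ht s hs h
      nlinarith
  intro s hs hsp
  refine ⟨br s, b2 s hs, hgr s hs, ⟨br '' uIcc s (p i), ?_, ⟨p i, right_mem_uIcc, b1⟩,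
    ⟨s, left_mem_uIcc, rfl⟩, ?_⟩, hle s hs hsp⟩
  · exact isPreconnected_uIcc.image _ (b3.mono (hord.uIcc_subset hs ht))
  · rintro _ ⟨r, hr, rfl⟩
    have hrK := hord.uIcc_subset hs ht hr
    refine ⟨(b2 r hrK).agree, hpos r hrK, (hle r hrK ?_).trans_lt hc⟩
    rcases le_total s (p i) with h | h
    · rw [uIcc_of_le h] at hr
      rcases le_or_gt 0 σ with h1 | h1
      · exact mul_nonneg h1 (sub_nonneg.2 hr.2)
      · have : p i - s ≤ 0 := by nlinarith
        have : r = p i := le_antisymm hr.2 (by linarith [hr.1])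
        rw [this]; simp
    · rw [uIcc_of_ge h] at hr
      rcases le_or_gt σ 0 with h1 | h1
      · exact mul_nonneg_of_nonpos_of_nonpos h1 (sub_nonpos.2 hr.1)
      · have : 0 ≤ p i - s := by nlinarith
        have : r = p i := le_antisymm (by linarith [hr.2]) hr.1
        rw [this]; simp

end Walk

end SemialgComp

namespace SemialgComp

open Filter Topology

namespace Walk

variable {n m₀ B : ℕ} {J : Type} (W : Walk n m₀ B J)

/-- The branch with index `j` is reachable near the `k`-th root of `δ`, with `Q` decreasing
towards that root. -/
def Appr (i : Fin n) (δ : MvPolynomial (Fin n) ℝ) (k j : ℕ) (σ : ℝ) (z : Fin n → ℝ) (c r : ℝ) :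
    Prop :=
  ∃ v, IsRootIdx (slice (along i δ) z) k v ∧ ∀ᶠ η in 𝓝[>] (0 : ℝ), ∃ q,
    W.Lab i j z (v + σ * η) q ∧ 0 < σ * eval q (grad W.Q i) ∧ W.Conn i z q c ∧ eval q W.Q ≤ r

variable {W} {i : Fin n} {j k : ℕ} {z y q p : Fin n → ℝ} {c c' t σ r : ℝ}
variable {δ : MvPolynomial (Fin n) ℝ}

lemma slice_along_ne (hN : W.NS (i + 1) p) {δ₂ : MvPolynomial (Fin n) ℝ} (h : δ₂ ∈ W.V (i + 1)) :
    slice (along i δ₂) p ≠ 0 := fun h0 => by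
  have h3 := eval_along i δ₂ p (p i)
  rw [h0, Function.update_eq_self, Polynomial.eval_zero] at h3
  exact hN δ₂ h h3.symm

lemma eventually_ns (hi : m₀ ≤ i) (hN : W.NS (i + 1) p) :
    ∀ᶠ s in 𝓝 (p i), W.NS (i + 1) (Function.update p i s) := by
  have hV := (W.V_finDeg (i + 1) (hi.trans (Nat.le_succ _))).1
  refine (eventually_all_finite hV).2 fun δ₂ h2 => ?_
  have hc : Continuous fun s : ℝ => eval (Function.update p i s) δ₂ :=
    (continuous_eval δ₂).comp (continuous_const.update i continuous_id)
  refine (hc.tendsto (p i)).eventually (isOpen_ne.mem_nhds ?_)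
  rw [Function.update_eq_self]
  exact hN δ₂ h2

lemma ns_of_near (hN : W.NS (i + 1) p) {s : ℝ}
    (h : ∀ δ₂ ∈ W.V (i + 1), s ∉ (slice (along i δ₂) p).roots) :
    W.NS (i + 1) (Function.update p i s) := fun δ₂ h2 h0 => by
  refine h δ₂ h2 ((Polynomial.mem_roots (slice_along_ne hN h2)).2 ?_)
  change Polynomial.eval _ _ = 0
  rw [eval_along, h0]

lemma convex_side (σ v : ℝ) : Convex ℝ {t : ℝ | 0 < σ * (t - v)} := by
  have : {t : ℝ | 0 < σ * (t - v)} = (fun t => σ * t) ⁻¹' Ioi (σ * v) := by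
    ext t
    simp [mul_sub]
  rw [this]
  exact (convex_Ioi _).is_linear_preimage ⟨fun a b => mul_add _ _ _, fun a b => by simp; ring⟩

lemma abs_eq_of_sq_one (hσ : σ * σ = 1) {x : ℝ} (hx : 0 ≤ σ * x) : |x| = σ * x := by
  have : |σ| = 1 := by
    rcases mul_self_eq_one_iff.1 hσ with rfl | rfl <;> simp
  rw [← abs_of_nonneg hx, abs_mul, this, one_mul]

lemma appr_of_near [Finite J] (hi : m₀ ≤ i) (hσ : σ * σ = 1) (hδ : δ ∈ W.V (i + 1))
    (hnear : W.Near i δ k σ p) (hN : W.NS (i + 1) p) (hcr : Crit (grad W.Q) (i + 1) p)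
    (hidx : IsRootIdx (slice (W.χ (i + 1)) p) j (eval p (W.u (i + 1))))
    (hg : 0 < σ * eval p (grad W.Q i)) (hz : W.Conn i z p c) :
    W.Appr i δ k j σ z c (eval p W.Q) := by
  obtain ⟨v, hv, hvp, hgap⟩ := hnear
  obtain ⟨ε, hε, hball⟩ := Metric.mem_nhds_iff.1 (eventually_ns hi hN)
  set K : Set ℝ := {t | 0 < σ * (t - v)} ∩ {t | 0 < (-σ) * (t - (p i + σ * ε))} with hK
  have hKo : IsOpen K := (isOpen_lt continuous_const (by fun_prop)).inter
    (isOpen_lt continuous_const (by fun_prop))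
  have hKc : IsPreconnected K := ((convex_side _ _).inter (convex_side _ _)).isPreconnected
  have hexp : ∀ s, (-σ) * (s - (p i + σ * ε)) = σ * (p i - s) + ε := fun s => by
    linear_combination ε * hσ
  have hKN : ∀ s ∈ K, W.NS (i + 1) (Function.update p i s) := by
    rintro s ⟨hs1, hs2⟩
    have hs2' : 0 < (-σ) * (s - (p i + σ * ε)) := hs2
    rw [hexp] at hs2'
    by_cases hs : 0 < σ * (p i - s)
    · exact ns_of_near hN fun δ₂ h2 hr => hgap δ₂ h2 ⟨s, hr, hs1, hs⟩
    · refine hball (show s ∈ Metric.ball (p i) ε from ?_)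
      have h1 : σ * (s - p i) = -(σ * (p i - s)) := by ring
      rw [Metric.mem_ball, Real.dist_eq, abs_eq_of_sq_one hσ (by rw [h1]; linarith), h1]
      linarith
  have hpK : p i ∈ K := ⟨hvp, by
    have : 0 < (-σ) * (p i - (p i + σ * ε)) := by rw [hexp]; simpa using hε
    exact this⟩
  have hd := descend hi hKo hKc hKN hpK hcr hidx hσ hg hz.pos hz.lt
  refine ⟨v, by rw [← along_congr hi hδ hz.agree]; exact hv, ?_⟩
  filter_upwards [Ioo_mem_nhdsGT hvp] with η hη
  have e1 : σ * (v + σ * η - v) = η := by linear_combination η * hσ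
  have e2 : σ * (p i - (v + σ * η)) = σ * (p i - v) - η := by linear_combination (-η) * hσ
  obtain ⟨q, h1, h2, h3, h4⟩ := hd (v + σ * η) ⟨by
      have : 0 < σ * (v + σ * η - v) := by rw [e1]; exact hη.1
      exact this, by
      have : 0 < (-σ) * (v + σ * η - (p i + σ * ε)) := by rw [hexp, e2]; linarith [hη.2]
      exact this⟩ (by rw [e2]; linarith [hη.2])
  exact ⟨q, ⟨h1.crit, h1.agree.trans hz.agree, h1.coord, h1.idx⟩, h2, hz.trans h3, h4⟩

lemma exists_near [Finite J] (hi : m₀ ≤ i) (hσ : σ * σ = 1) (hN : W.NS (i + 1) p)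
    (hcr : Crit (grad W.Q) (i + 1) p) (hg : 0 < σ * eval p (grad W.Q i)) (hp : W.Pos p)
    (hco : W.Coer p) : ∃ δ ∈ W.V (i + 1), ∃ k ≤ B, W.Near i δ k σ p := by
  classical
  have hm : m₀ ≤ (i : ℕ) + 1 := hi.trans (Nat.le_succ _)
  have hV := W.V_finDeg _ hm
  set S : Set ℝ := {r | 0 < σ * (p i - r) ∧ ∃ δ ∈ W.V (i + 1), r ∈ (slice (along i δ) p).roots}
    with hS
  have hSf : S.Finite := by
    refine Set.Finite.subset (Set.Finite.biUnion hV.1 fun δ _ =>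
      (slice (along i δ) p).roots.toFinset.finite_toSet) ?_
    rintro r ⟨-, δ, hδ, hr⟩
    exact mem_iUnion₂.2 ⟨δ, hδ, by simpa using hr⟩
  by_cases hne : S.Nonempty
  · obtain ⟨v, ⟨hv1, δ, hδ, hv2⟩, hmax⟩ := hSf.exists_maximalFor (fun r => σ * r) S hne
    refine ⟨δ, hδ, _, IsRootIdx.le (natDegree_slice_le ((along_degree i δ).trans (hV.2 δ hδ)) p)
      ⟨hv2, rfl⟩, v, ⟨hv2, rfl⟩, hv1, ?_⟩
    rintro δ₂ h2 ⟨r, hr, h3, h4⟩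
    have h5 : σ * r ≤ σ * v := hmax ⟨h4, δ₂, h2, hr⟩ (by linarith [mul_sub σ r v])
    linarith [mul_sub σ r v]
  · exfalso
    obtain ⟨ε, hε, hball⟩ := Metric.mem_nhds_iff.1 (eventually_ns hi hN)
    set K : Set ℝ := {t | 0 < (-σ) * (t - (p i + σ * ε))} with hK
    have hexp : ∀ s, (-σ) * (s - (p i + σ * ε)) = σ * (p i - s) + ε := fun s => by
      linear_combination ε * hσ
    have hKo : IsOpen K := isOpen_lt continuous_const (by fun_prop)
    have hKN : ∀ s ∈ K, W.NS (i + 1) (Function.update p i s) := by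
      intro s hs2
      have hs2' : 0 < (-σ) * (s - (p i + σ * ε)) := hs2
      rw [hexp] at hs2'
      by_cases hs : 0 < σ * (p i - s)
      · exact ns_of_near hN fun δ₂ h2 hr => hne ⟨s, hs, δ₂, h2, hr⟩
      · refine hball (show s ∈ Metric.ball (p i) ε from ?_)
        have h1 : σ * (s - p i) = -(σ * (p i - s)) := by ring
        rw [Metric.mem_ball, Real.dist_eq, abs_eq_of_sq_one hσ (by rw [h1]; linarith), h1]
        linarith
    have hpK : p i ∈ K := by
      have : 0 < (-σ) * (p i - (p i + σ * ε)) := by rw [hexp]; simpa using hε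
      exact this
    obtain ⟨j, hidx⟩ := exists_idx hm hcr
    have hd := descend hi hKo (convex_side _ _).isPreconnected hKN hpK hcr hidx hσ hg hp
      (lt_add_one (eval p W.Q))
    obtain ⟨R, hR⟩ := hco.1 (eval p W.Q)
    set x : ℝ := |R| + |p i| + 1 with hx
    have hx0 : 0 < x := by positivity
    have e2 : σ * (p i - (p i - σ * x)) = x := by linear_combination x * hσ
    obtain ⟨q, h1, -, -, h4⟩ := hd (p i - σ * x) (by
      have : 0 < (-σ) * (p i - σ * x - (p i + σ * ε)) := by rw [hexp, e2]; positivity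
      exact this) (by rw [e2]; exact hx0.le)
    have h5 := hR q (h1.agree.mono hi) h4 i
    rw [h1.coord] at h5
    have h6 : |σ * x| = x := by
      rw [abs_mul, abs_of_pos hx0]
      rcases mul_self_eq_one_iff.1 hσ with rfl | rfl <;> simp
    have h7 := abs_sub_abs_le_abs_sub (σ * x) (p i)
    rw [abs_sub_comm (σ * x), h6] at h7
    linarith [le_abs_self R]

end Walk

end SemialgComp

namespace SemialgComp

open Filter Topology

namespace Walk

variable {n m₀ B : ℕ} {J : Type} {W : Walk n m₀ B J}
variable {i : Fin n} {j k : ℕ} {z y p p₀ : Fin n → ℝ} {c c' t σ r v : ℝ} {q : ℝ → Fin n → ℝ}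
variable {δ : MvPolynomial (Fin n) ℝ}

lemma cluster_of_lab (hi : m₀ ≤ i) (hσ : σ * σ = 1)
    (h : ∀ᶠ η in 𝓝[>] (0 : ℝ), W.Lab i j z (v + σ * η) (q η)) :
    ∃ p₀, MapClusterPt p₀ (𝓝[>] (0 : ℝ)) q ∧ Crit (grad W.Q) (i + 1) p₀ ∧ AgreeLT i p₀ z ∧
      p₀ i = v := by
  have e : ∀ η, σ * (v + σ * η - v) = η := fun η => by linear_combination η * hσ
  have hF : map (fun η : ℝ => v + σ * η) (𝓝[>] 0) ≤ 𝓝 v := by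
    have h1 : Continuous fun η : ℝ => v + σ * η := by fun_prop
    have h2 := h1.tendsto 0
    simp only [mul_zero, add_zero] at h2
    exact h2.mono_left nhdsWithin_le_nhds
  obtain ⟨p₀, h1, h2⟩ := exists_crit_cluster (z := z) hi hF (br := fun s => q (σ * (s - v)))
    (by rw [eventually_map]; filter_upwards [h] with η hη; rw [e]; exact hη.crit)
    (by rw [eventually_map]; filter_upwards [h] with η hη; rw [e]; exact hη.agree)
    (by rw [eventually_map]; filter_upwards [h] with η hη; rw [e]; exact hη.coord)
  refine ⟨p₀, ?_, h2⟩
  rw [MapClusterPt, map_map] at h1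
  simp only [Function.comp_def, e] at h1
  exact h1

lemma Appr.exists_choice (hi : m₀ ≤ i) (hσ : σ * σ = 1) (hz : W.Good i z)
    (h : W.Appr i δ k j σ z c r) : ∃ (v : ℝ) (q : ℝ → Fin n → ℝ), IsRootIdx (slice (along i δ) z) k v ∧
      ∀ᶠ η in 𝓝[>] (0 : ℝ), W.NS (i + 1) (Function.update z i (v + σ * η)) ∧
        W.Lab i j z (v + σ * η) (q η) ∧ 0 < σ * eval (q η) (grad W.Q i) ∧ W.Conn i z (q η) c ∧
        eval (q η) W.Q ≤ r := by
  obtain ⟨v, hv, h⟩ := h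
  have hσ0 : σ ≠ 0 := by rintro rfl; simp at hσ
  obtain ⟨q, hq⟩ := h.choice
  refine ⟨v, q, hv, ?_⟩
  filter_upwards [hq, hz.eventually_right hi v hσ0] with η h1 h2
  exact ⟨h2.ns (hi.trans (Nat.le_succ _)) i.2, h1⟩

lemma cluster_le (hi : m₀ ≤ i) (hv : IsRootIdx (slice (along i δ) z) k v)
    (hq : ∀ᶠ η in 𝓝[>] (0 : ℝ), W.NS (i + 1) (Function.update z i (v + σ * η)) ∧
      W.Lab i j z (v + σ * η) (q η)) (hp : MapClusterPt p₀ (𝓝[>] (0 : ℝ)) q)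
    (h : W.Appr i δ k j σ z c r) : eval p₀ W.Q ≤ r := by
  obtain ⟨v', hv', h⟩ := h
  rw [hv'.unique hv] at h
  refine hp.mem_of_isClosed (s := {y | eval y W.Q ≤ r})
    (isClosed_le (continuous_eval _) continuous_const) ?_
  filter_upwards [h, hq] with η h0 h34
  obtain ⟨x, h1, -, -, h2⟩ := h0
  obtain ⟨h3, h4⟩ := h34
  rw [Lab.unique hi h3 h4 h1] at h2
  exact h2

variable (W) in
/-- The number of roots of the eliminant that lie below the value at `p` by at least `κ`. -/
noncomputable def below (m : ℕ) (p : Fin n → ℝ) (κ : ℝ) : ℕ :=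
  ((slice (W.χ m) p).roots.toFinset.filter fun x => x < eval p (W.u m) - κ).card

lemma exists_gap (S : Finset ℝ) (u : ℝ) : ∃ g > 0, ∀ r ∈ S, r < u → r < u - g := by
  have h : ∀ᶠ g in 𝓝[>] (0 : ℝ), ∀ r ∈ S, r < u → r < u - g := by
    refine (eventually_all_finset S).2 fun r _ => ?_
    by_cases hr : r < u
    · filter_upwards [Ioo_mem_nhdsGT (sub_pos.2 hr)] with g hg _
      linarith [hg.2]
    · exact Eventually.of_forall fun _ h => absurd h hr
  obtain ⟨g, h1, h2⟩ := (h.and self_mem_nhdsWithin).exists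
  exact ⟨g, h2, h1⟩

lemma pos_of_cluster (hp : MapClusterPt p₀ (𝓝[>] (0 : ℝ)) q) {κ : ℝ} (hκ : 0 < κ)
    (h : ∀ᶠ η in 𝓝[>] (0 : ℝ), ∀ j, κ ≤ eval (q η) (W.h j)) : W.Pos p₀ := fun j =>
  hκ.trans_le (hp.mem_of_isClosed (s := {y | κ ≤ eval y (W.h j)})
    (isClosed_le continuous_const (continuous_eval _)) (h.mono fun _ h' => h' j))

lemma le_of_cluster (hp : MapClusterPt p₀ (𝓝[>] (0 : ℝ)) q)
    (h : ∀ᶠ η in 𝓝[>] (0 : ℝ), W.Conn i z (q η) c) : eval p₀ W.Q ≤ c :=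
  hp.mem_of_isClosed (s := {y | eval y W.Q ≤ c})
    (isClosed_le (continuous_eval _) continuous_const) (h.mono fun _ h' => h'.lt.le)

lemma limit_crit [Finite J] (hi : m₀ ≤ i) (hσ : σ * σ = 1) (hc : c' < c)
    (hq : ∀ᶠ η in 𝓝[>] (0 : ℝ), W.Lab i j z (v + σ * η) (q η))
    (hco : ∀ᶠ η in 𝓝[>] (0 : ℝ), W.Conn i z (q η) c')
    {κ₀ : ℝ} (hκ₀ : 0 < κ₀) (hpos : ∀ᶠ η in 𝓝[>] (0 : ℝ), ∀ j, κ₀ ≤ eval (q η) (W.h j))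
    (hder : ∀ᶠ κ in 𝓝[>] (0 : ℝ), ∀ᶠ η in 𝓝[>] (0 : ℝ), eval (q η) (grad W.Q i) ^ 2 < κ) {N : ℕ}
    (hcnt : ∀ᶠ κ in 𝓝[>] (0 : ℝ), ∀ᶠ η in 𝓝[>] (0 : ℝ), W.below i (q η) κ = N) :
    ∃ p₀, Crit (grad W.Q) i p₀ ∧ W.Conn i z p₀ c ∧
      IsRootIdx (slice (W.χ i) p₀) N (eval p₀ (W.u i)) := by
  obtain ⟨p₀, h1, h2, h3, -⟩ := cluster_of_lab hi hσ hq
  have hd0 : eval p₀ (grad W.Q i) = 0 := by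
    have h4 : ∀ᶠ κ in 𝓝[>] (0 : ℝ), eval p₀ (grad W.Q i) ^ 2 ≤ κ := hder.mono fun κ hκ =>
      h1.mem_of_isClosed (s := {y | eval y (grad W.Q i) ^ 2 ≤ κ})
        (isClosed_le ((continuous_eval _).pow 2) continuous_const) (hκ.mono fun _ h => h.le)
    have h5 : eval p₀ (grad W.Q i) ^ 2 ≤ 0 :=
      ge_of_tendsto (tendsto_id.mono_left nhdsWithin_le_nhds) h4
    exact pow_eq_zero_iff (two_ne_zero) |>.1 (le_antisymm h5 (sq_nonneg _))
  have hcr : Crit (grad W.Q) i p₀ := fun l hl => by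
    rcases hl.lt_or_eq with h | h
    · exact h2 l h
    · rw [← Fin.ext h]; exact hd0
  have hp0 := pos_of_cluster h1 hκ₀ hpos
  have hlt := (le_of_cluster h1 hco).trans_lt hc
  have hconn := (conn_of_cluster h1 (hco.mono fun _ h => h.mono hc.le) hp0 hlt).self_of_nhds h3
  refine ⟨p₀, hcr, hconn, (Polynomial.mem_roots (W.χ_ne i hi p₀)).2 (W.crit_root i hi p₀ hcr), ?_⟩
  obtain ⟨g, hg, hgap⟩ := exists_gap (slice (W.χ i) p₀).roots.toFinset (eval p₀ (W.u i))
  obtain ⟨κ, hκ, hκ1, hκ2⟩ := (hcnt.and (Ioo_mem_nhdsGT hg)).exists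
  have hnear : {y | eval p₀ (W.u i) - (g - κ) < eval y (W.u i)} ∩
      {y | eval y (W.u i) < eval p₀ (W.u i) + κ} ∈ 𝓝 p₀ :=
    inter_mem (((continuous_eval (W.u i)).tendsto p₀).eventually (lt_mem_nhds (by linarith)))
      (((continuous_eval (W.u i)).tendsto p₀).eventually (gt_mem_nhds (by linarith)))
  obtain ⟨η, ⟨h6, h7⟩, h8, h9⟩ :=
    ((mapClusterPt_iff_frequently.1 h1 _ hnear).and_eventually (hκ.and hq)).exists
  have h6' : eval p₀ (W.u i) - (g - κ) < eval (q η) (W.u i) := h6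
  have h7' : eval (q η) (W.u i) < eval p₀ (W.u i) + κ := h7
  rw [← h8, below, W.χ_base i hi _ _ (h9.agree.trans h3.symm)]
  congr 1
  refine Finset.filter_congr fun r hr => ⟨fun h => ?_, fun h => ?_⟩
  · have := hgap r hr h
    linarith
  · linarith

lemma jump [Finite J] (hi : m₀ ≤ i) (hσ : σ * σ = 1) (hz : W.Good i z) (hc : c' < c)
    (hq : ∀ᶠ η in 𝓝[>] (0 : ℝ), W.Lab i j z (v + σ * η) (q η))
    (hsgn : ∀ᶠ η in 𝓝[>] (0 : ℝ), 0 < σ * eval (q η) (grad W.Q i))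
    (hco : ∀ᶠ η in 𝓝[>] (0 : ℝ), W.Conn i z (q η) c')
    {κ₀ : ℝ} (hκ₀ : 0 < κ₀) (hpos : ∀ᶠ η in 𝓝[>] (0 : ℝ), ∀ j, κ₀ ≤ eval (q η) (W.h j))
    {κ₁ : ℝ} (hκ₁ : 0 < κ₁)
    (hder : ∀ᶠ η in 𝓝[>] (0 : ℝ), κ₁ ≤ eval (q η) (grad W.Q i) ^ 2) {P : (Fin n → ℝ) → Prop}
    (hP : ∀ᶠ ξ in 𝓝[>] (0 : ℝ), ∀ᶠ η in 𝓝[>] (0 : ℝ), P (Function.update (q η) i (v - σ * ξ))) :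
    ∃ p₀, MapClusterPt p₀ (𝓝[>] (0 : ℝ)) q ∧ ∃ y c'' τ₁, 0 < τ₁ ∧ c'' < c ∧ W.Conn i z y c'' ∧
      eval y W.Q + τ₁ ≤ c'' ∧ eval y W.Q + τ₁ < eval p₀ W.Q ∧ W.Good (i + 1) y ∧ P y := by
  obtain ⟨p₀, h1, h2, h3, h4⟩ := cluster_of_lab hi hσ hq
  refine ⟨p₀, h1, ?_⟩
  have hp0 := pos_of_cluster h1 hκ₀ hpos
  have hle := le_of_cluster h1 hco
  have hd0 : 0 < σ * eval p₀ (grad W.Q i) := by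
    have h5 : 0 ≤ σ * eval p₀ (grad W.Q i) :=
      h1.mem_of_isClosed (s := {y | 0 ≤ σ * eval y (grad W.Q i)})
        (isClosed_le continuous_const (continuous_const.mul (continuous_eval _)))
        (hsgn.mono fun _ h => h.le)
    have h6 : κ₁ ≤ eval p₀ (grad W.Q i) ^ 2 :=
      h1.mem_of_isClosed (s := {y | κ₁ ≤ eval y (grad W.Q i) ^ 2})
        (isClosed_le continuous_const ((continuous_eval _).pow 2)) hder
    refine h5.lt_of_ne fun h0 => ?_
    have : eval p₀ (grad W.Q i) = 0 := by
      have := congrArg (σ * ·) h0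
      simp only [mul_zero, ← mul_assoc, hσ, one_mul] at this
      exact this.symm
    rw [this] at h6
    norm_num at h6
    linarith
  obtain ⟨c'', hc1, hc2⟩ := exists_between hc
  have hnear := conn_of_cluster h1 (hco.mono fun _ h => h.mono hc1.le) hp0 (hle.trans_lt hc1)
  -- the path leaving the limit point
  set g : ℝ → Fin n → ℝ := fun ξ => Function.update p₀ i (v - σ * ξ) with hg
  have hg0 : g 0 = p₀ := by simp [hg, ← h4]
  have hgc : Continuous g := continuous_const.update i (by fun_prop)
  have hgd : HasDerivAt (fun ξ => eval (g ξ) W.Q) (-(σ * eval p₀ (grad W.Q i))) 0 := by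
    have h5 : HasDerivAt g (Pi.single i (-σ)) 0 := by
      rw [hasDerivAt_pi]
      intro l
      by_cases hl : l = i
      · subst hl
        simp only [hg, Function.update_self, Pi.single_eq_same]
        have := ((hasDerivAt_id (0 : ℝ)).const_mul σ).const_sub v
        simpa using this
      · simp only [hg, Function.update_of_ne hl, Pi.single_eq_of_ne hl]
        exact hasDerivAt_const _ _
    have h6 := hasDerivAt_eval_comp W.Q h5
    rw [hg0, Finset.sum_eq_single i] at h6
    · convert h6 using 1
      simp [grad]
      ring
    · intro l _ hl
      simp [Pi.single_eq_of_ne hl]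
    · simp
  have hdec : ∀ᶠ ξ in 𝓝[>] (0 : ℝ), eval (g ξ) W.Q < eval p₀ W.Q := by
    have h5 := hgd.tendsto_slope_zero_right.eventually (gt_mem_nhds (neg_neg_of_pos hd0))
    filter_upwards [h5, self_mem_nhdsWithin] with ξ h6 h7
    have h7' : 0 < ξ := h7
    simp only [zero_add, hg0, smul_eq_mul] at h6
    by_contra h8
    have h9 := mul_nonneg (inv_pos.2 h7').le (sub_nonneg.2 (not_lt.1 h8))
    linarith
  have hgn : ∀ᶠ ξ in 𝓝[>] (0 : ℝ), ∀ᶠ y in 𝓝 (g ξ), AgreeLT i y z → W.Conn i z y c'' := by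
    have h5 := hgc.tendsto 0
    rw [hg0] at h5
    exact (h5.eventually (eventually_eventually_nhds.2 hnear)).filter_mono nhdsWithin_le_nhds
  have hσ0 : -σ ≠ 0 := by rw [neg_ne_zero]; rintro rfl; simp at hσ
  obtain ⟨ξ, hξ1, hξ2, hξ3, hξ4⟩ :=
    (hdec.and (hgn.and ((hz.eventually_right hi v hσ0).and hP))).exists
  set τ : ℝ := (eval p₀ W.Q - eval (g ξ) W.Q) / 2 with hτ
  have hup : Tendsto (fun x : Fin n → ℝ => Function.update x i (v - σ * ξ)) (𝓝 p₀) (𝓝 (g ξ)) :=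
    (continuous_id.update i continuous_const).tendsto p₀
  have hQ : ∀ᶠ y in 𝓝 (g ξ), eval y W.Q < eval (g ξ) W.Q + τ :=
    ((continuous_eval W.Q).tendsto _).eventually (gt_mem_nhds (by rw [hτ]; linarith))
  obtain ⟨η, ⟨e1, e2⟩, e3, e4⟩ := ((h1.frequently (hup.eventually (hξ2.and hQ))).and_eventually
    (hξ4.and hq)).exists
  have hag : AgreeLT i (Function.update (q η) i (v - σ * ξ)) z :=
    (agreeLT_update i le_rfl _ _).trans e4.agree
  refine ⟨Function.update (q η) i (v - σ * ξ), c'', τ, by rw [hτ]; linarith, hc2, e1 hag, ?_, ?_,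
    ?_, e3⟩
  · rw [hτ] at e2 ⊢; linarith
  · rw [hτ] at e2 ⊢; linarith
  · refine hξ3.congr ?_
    have h7 := agree_update (z := z) hag (Function.update_self i (v - σ * ξ) (q η))
    rw [show v + -σ * ξ = v - σ * ξ by ring]
    exact h7.symm

end Walk

end SemialgComp

namespace SemialgComp

open Filter Topology

namespace Walk

variable {n m₀ B : ℕ} {J : Type} {W : Walk n m₀ B J} {m : ℕ}
variable {i : Fin n} {z y z' y' : Fin n → ℝ} {c c' τ τ₁ τ₁' : ℝ}

lemma decided_below (hm : m₀ ≤ m) : Decided (B ^ 6) (fun w : Option (Fin n) → ℝ =>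
    W.below m (fun l => w (some l)) (w none)) := by
  have hB := W.le_B
  have hB1 := W.one_le_B
  have hψ : ∀ o : Option (Fin n), PolyFn B (fun w : Option (Fin n) → ℝ =>
      ext (fun l => w (some l)) (eval (fun l => w (some l)) (W.u m) - w none) o) := by
    rintro (_ | l)
    · refine PolyFn.sub ?_ (PolyFn.coord hB1 none)
      have := (PolyFn.eval (W.u_degree m hm)).comp (K := 1)
        (fun l : Fin n => PolyFn.coord (ι := Option (Fin n)) le_rfl (some l))
      rw [mul_one] at this
      exact this
    · exact PolyFn.coord hB1 (some l)
  refine (((decided_idx hB1 (W.χ_degree m hm)).comp_polyFn hψ).mono ?_).of_fun_eq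
    fun w w' h => h
  calc 18 * B ^ 4 * B ≤ B * B ^ 4 * B := by gcongr; omega
    _ = B ^ 6 := by ring

variable (W) in
/-- Two points with the same signs, reachable from `z` and `z'`, where a common obstacle is
small. -/
def Exit (G : Set (MvPolynomial (Fin n) ℝ)) (m : ℕ) (τ : ℝ) (z z' : Fin n → ℝ) (c c' : ℝ) : Prop :=
  ∃ p p', SameSign G p p' ∧ W.Conn m z p c ∧ W.Conn m z' p' c' ∧
    ∃ j, eval p (W.h j) < τ ∧ eval p' (W.h j) < τ

variable (W) in
/-- Two critical points with the same signs, reachable from `z` and `z'`. -/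
def Meet (G : Set (MvPolynomial (Fin n) ℝ)) (m : ℕ) (z z' : Fin n → ℝ) (c c' : ℝ) : Prop :=
  ∃ p p', SameSign G p p' ∧ W.Conn m z p c ∧ W.Conn m z' p' c' ∧
    Crit (grad W.Q) m p ∧ Crit (grad W.Q) m p'

variable (W) in
/-- Two points with the same signs of suitable polynomials either both reach a small obstacle,
or both reach critical points, with prescribed signs. -/
def Claim (m a : ℕ) : Prop := ∀ D, 1 ≤ D → ∀ G : Set (MvPolynomial (Fin n) ℝ), FinDeg D G →
  ∃ F : Set (MvPolynomial (Fin n) ℝ), FinDeg (a * D) F ∧ ∀ z z', SameSign F z z' → W.Good m z →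
    W.Good m z' → W.Pos z → W.Pos z' → W.Coer z → W.Coer z' → ∀ τ > 0,
      W.Exit G m τ z z' (eval z W.Q + τ) (eval z' W.Q + τ) ∨
      W.Meet G m z z' (eval z W.Q + τ) (eval z' W.Q + τ)

lemma Coer.congr (h : W.Coer z) (hy : AgreeLT m₀ y z) : W.Coer y := by
  refine ⟨fun c => ?_, ?_⟩
  · obtain ⟨R, hR⟩ := h.1 c
    exact ⟨R, fun x hx => hR x (hx.trans hy)⟩
  · obtain ⟨b, hb⟩ := h.2
    exact ⟨b, fun x hx => hb x (hx.trans hy)⟩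

lemma Appr.mono {δ : MvPolynomial (Fin n) ℝ} {k j : ℕ} {σ r r' : ℝ} (h : W.Appr i δ k j σ z c r)
    (hc : c ≤ c') (hr : r ≤ r') : W.Appr i δ k j σ z c' r' := by
  obtain ⟨v, hv, h⟩ := h
  refine ⟨v, hv, h.mono ?_⟩
  rintro η ⟨q, h1, h2, h3, h4⟩
  exact ⟨q, h1, h2, h3.mono hc, h4.trans hr⟩

variable (W) in
/-- The labels of the branches that can be followed at level `i`. -/
def labels (i : Fin n) : Set (MvPolynomial (Fin n) ℝ × ℕ × ℕ × ℝ) :=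
  {s | s.1 ∈ W.V (i + 1) ∧ s.2.1 ≤ B ∧ s.2.2.1 ≤ B ∧ s.2.2.2 * s.2.2.2 = 1}

lemma finite_labels (hi : m₀ ≤ i) : (W.labels i).Finite := by
  refine Set.Finite.subset ((W.V_finDeg (i + 1) (hi.trans (Nat.le_succ _))).1.prod
    ((finite_Iic B).prod ((finite_Iic B).prod (Set.toFinite {(1 : ℝ), -1})))) ?_
  rintro ⟨δ, k, j, σ⟩ ⟨h1, h2, h3, h4⟩
  exact ⟨h1, h2, h3, mul_self_eq_one_iff.1 h4⟩

lemma launch [Finite J] (hi : m₀ ≤ i) {a D : ℕ} (hcl : W.Claim (i + 1) a) (hD : 1 ≤ D)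
    {G : Set (MvPolynomial (Fin n) ℝ)} (hG : FinDeg D G) :
    ∃ F : Set (MvPolynomial (Fin n) ℝ), FinDeg (a * (B ^ 20 * D)) F ∧ ∀ z z' y y' c c' τ τ₁ τ₁',
      SameSign F y y' → W.Good (i + 1) y → W.Good (i + 1) y' → W.Conn i z y c →
      W.Conn i z' y' c' → W.Coer z → W.Coer z' → 0 < τ → 0 < τ₁ → 0 < τ₁' →
      eval y W.Q + τ₁ ≤ c → eval y' W.Q + τ₁' ≤ c' → W.Exit G i τ z z' c c' ∨
        ∃ s ∈ W.labels i, W.Appr i s.1 s.2.1 s.2.2.1 s.2.2.2 z c (eval y W.Q + τ₁) ∧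
          W.Appr i s.1 s.2.1 s.2.2.1 s.2.2.2 z' c' (eval y' W.Q + τ₁') := by
  have hB := W.le_B
  have hB1 := W.one_le_B
  have hm : m₀ ≤ (i : ℕ) + 1 := hi.trans (Nat.le_succ _)
  have hfin := (finite_labels (W := W) hi).to_subtype
  choose Fn hFn1 hFn2 using fun s : W.labels i => W.decided_near hi s.2.1 s.1.2.1 s.1.2.2.2
  have hψ : ∀ o : Option (Fin n), PolyFn 1 (fun w : Fin n → ℝ => ext w 0 o) := by
    rintro (_ | l)
    · exact PolyFn.const 1 0
    · exact PolyFn.coord le_rfl l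
  obtain ⟨Fb, hFb1, hFb2⟩ := (decided_below (W := W) hm).comp_polyFn hψ
  have hBD : B ^ 20 ≤ B ^ 20 * D := Nat.le_mul_of_pos_right _ hD
  obtain ⟨F, hF, h⟩ := hcl (B ^ 20 * D) (Nat.one_le_iff_ne_zero.2 (by positivity))
    (G ∪ {grad W.Q i} ∪ Fb ∪ ⋃ s, Fn s) (((((hG.mono (Nat.le_mul_of_pos_left _ (by positivity))).union
      ⟨finite_singleton _, by
        rintro _ rfl
        exact (W.grad_degree i).trans ((Nat.le_self_pow (by norm_num) B).trans hBD)⟩).union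
      (hFb1.mono ((by rw [mul_one]; exact Nat.pow_le_pow_right hB1 (by norm_num) :
        B ^ 6 * 1 ≤ B ^ 20).trans hBD))).union (FinDeg.iUnion fun s => (hFn1 s).mono hBD)))
  refine ⟨F, hF, fun z z' y y' c c' τ τ₁ τ₁' hs hg hg' hzy hzy' hco hco' hτ hτ₁ hτ₁' hc hc' => ?_⟩
  have hm1 : min τ (min τ₁ τ₁') ≤ τ := min_le_left _ _
  have hm2 : min τ (min τ₁ τ₁') ≤ τ₁ := (min_le_right _ _).trans (min_le_left _ _)
  have hm3 : min τ (min τ₁ τ₁') ≤ τ₁' := (min_le_right _ _).trans (min_le_right _ _)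
  have hcoy := hco.congr (hzy.agree.mono hi)
  have hcoy' := hco'.congr (hzy'.agree.mono hi)
  rcases h y y' hs hg hg' hzy.pos hzy'.pos hcoy hcoy' _ (lt_min hτ (lt_min hτ₁ hτ₁')) with
    ⟨p, p', h1, h2, h3, j, h4, h5⟩ | ⟨p, p', h1, h2, h3, h4, h5⟩
  · refine Or.inl ⟨p, p', h1.mono ?_, hzy.trans ((h2.mono_level (Nat.le_succ _)).mono (by linarith)),
      hzy'.trans ((h3.mono_level (Nat.le_succ _)).mono (by linarith)), j, by linarith, by linarith⟩
    rw [union_assoc, union_assoc]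
    exact subset_union_left
  · right
    have k2 : W.Conn i z p c := hzy.trans ((h2.mono_level (Nat.le_succ _)).mono (by linarith))
    have k3 : W.Conn i z' p' c' := hzy'.trans ((h3.mono_level (Nat.le_succ _)).mono (by linarith))
    have hN := (hg.ns hm i.2).congr hm h2.agree.symm
    have hN' := (hg'.ns hm i.2).congr hm h3.agree.symm
    have hgr := W.ns_grad i hi p hN h4
    have hgs : SignType.sign (eval p (grad W.Q i)) = SignType.sign (eval p' (grad W.Q i)) :=
      h1 _ (Or.inl (Or.inl (Or.inr rfl)))
    obtain ⟨σ, hσ, hσp, hσp'⟩ : ∃ σ : ℝ, σ * σ = 1 ∧ 0 < σ * eval p (grad W.Q i) ∧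
        0 < σ * eval p' (grad W.Q i) := by
      rcases hgr.lt_or_gt with h6 | h6
      · refine ⟨-1, by norm_num, by linarith, ?_⟩
        rw [sign_neg h6, eq_comm, sign_eq_neg_one_iff] at hgs
        linarith
      · refine ⟨1, by norm_num, by linarith, ?_⟩
        rw [sign_pos h6, eq_comm, sign_eq_one_iff] at hgs
        linarith
    obtain ⟨δ, hδ, k, hk, hnear⟩ := exists_near hi hσ hN h4 hσp h2.pos
      (hcoy.congr (h2.agree.mono hm))
    obtain ⟨j, hj⟩ := exists_idx hm h4
    have hjB : j ≤ B := IsRootIdx.le (natDegree_slice_le (W.χ_degree _ hm) p) hj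
    have hs : (δ, k, j, σ) ∈ W.labels i := ⟨hδ, hk, hjB, hσ⟩
    have hnear' : W.Near i δ k σ p' := by
      have := hFn2 ⟨_, hs⟩ p p' (h1.mono ((subset_iUnion Fn ⟨_, hs⟩).trans subset_union_right))
      exact this.mp hnear
    have hj' : IsRootIdx (slice (W.χ (i + 1)) p') j (eval p' (W.u (i + 1))) := by
      refine ⟨(Polynomial.mem_roots (W.χ_ne _ hm p')).2 (W.crit_root _ hm p' h5), ?_⟩
      have := hFb2 p p' (h1.mono (subset_union_right.trans subset_union_left))
      change W.below _ p 0 = W.below _ p' 0 at this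
      simp only [below, sub_zero] at this
      exact this.symm.trans hj.2
    refine ⟨_, hs, (appr_of_near hi hσ hδ hnear hN h4 hj hσp k2).mono le_rfl ?_,
      (appr_of_near hi hσ hδ hnear' hN' h5 hj' hσp' k3).mono le_rfl ?_⟩
    · linarith [h2.lt]
    · linarith [h3.lt]

end Walk

end SemialgComp

namespace SemialgComp

open Filter Topology

namespace Walk

variable {n m₀ B : ℕ} {J : Type} {W : Walk n m₀ B J} {m : ℕ}
variable {i : Fin n} {z z' : Fin n → ℝ} {c c' τ : ℝ}

variable (W) in
/-- What is recorded about a point `w` of a branch, a small positive number and a displaced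
value of the `i`-th coordinate. -/
noncomputable def view (i : Fin n) (G F : Set (MvPolynomial (Fin n) ℝ)) (w : Fin n ⊕ Bool → ℝ) :
    (J → Prop) × Prop × ℕ × (G → SignType) × (F → SignType) :=
  (fun j => eval (fun l => w (.inl l)) (W.h j) < w (.inr true),
    eval (fun l => w (.inl l)) (grad W.Q i) ^ 2 < w (.inr true),
    W.below i (fun l => w (.inl l)) (w (.inr true)),
    fun f => SignType.sign (eval (fun l => w (.inl l)) f.1),
    fun f => SignType.sign (eval (Function.update (fun l => w (.inl l)) i (w (.inr false))) f.1))

lemma decided_lt {κ : Type} {f g : (κ → ℝ) → ℝ} {D : ℕ} (hf : PolyFn D f) (hg : PolyFn D g) :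
    Decided D (fun w => f w < g w) :=
  (decided_pos (hg.sub hf)).of_fun_eq fun z z' hz => by
    simpa only [sub_pos] using hz

lemma decided_view [Finite J] (hi : m₀ ≤ i) {D : ℕ} (hD : B ^ 6 ≤ D)
    {G F : Set (MvPolynomial (Fin n) ℝ)} (hG : FinDeg D G) (hF : FinDeg D F) :
    Decided D (W.view i G F) := by
  have hB := W.le_B
  have hB1 := W.one_le_B
  have hco : ∀ l : Fin n, PolyFn 1 (fun w : Fin n ⊕ Bool → ℝ => w (.inl l)) := fun l =>
    PolyFn.coord le_rfl _
  have hB6 : 2 * B ≤ D := by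
    refine le_trans ?_ hD
    calc 2 * B ≤ B * B := by gcongr; omega
      _ = B ^ 2 := by ring
      _ ≤ B ^ 6 := Nat.pow_le_pow_right hB1 (by norm_num)
  have hB1D : 1 ≤ D := by omega
  have hk : PolyFn D (fun w : Fin n ⊕ Bool → ℝ => w (.inr true)) := PolyFn.coord hB1D _
  refine (Decided.pi fun j => decided_lt (((PolyFn.eval (W.h_degree j)).comp hco).mono
    (by omega)) hk).prodMk ((decided_lt ((((PolyFn.eval (W.grad_degree i)).comp hco).pow 2).mono
    (by omega)) hk).prodMk (Decided.prodMk ?_ (Decided.prodMk ?_ ?_)))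
  · have hψ : ∀ o : Option (Fin n), PolyFn 1 (fun w : Fin n ⊕ Bool → ℝ =>
        ext (fun l => w (.inl l)) (w (.inr true)) o) := by
      rintro (_ | l)
      · exact PolyFn.coord le_rfl _
      · exact PolyFn.coord le_rfl _
    exact ((decided_below hi).comp_polyFn hψ).mono (by omega)
  · exact ((Decided.sameSign hG).comp_polyFn hco).mono (by omega)
  · have hψ : ∀ l : Fin n, PolyFn 1 (fun w : Fin n ⊕ Bool → ℝ =>
        Function.update (fun l => w (.inl l)) i (w (.inr false)) l) := fun l => by
      by_cases hl : l = i
      · subst hl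
        simp only [Function.update_self]
        exact PolyFn.coord le_rfl _
      · simp only [Function.update_of_ne hl]
        exact PolyFn.coord le_rfl _
    exact ((Decided.sameSign hF).comp_polyFn hψ).mono (by omega)

lemma outcome [Finite J] (hi : m₀ ≤ i) {δ : MvPolynomial (Fin n) ℝ} {k j : ℕ} {σ r : ℝ}
    (hσ : σ * σ = 1) (hz : W.Good i z) (hc : c' < c) (hap : W.Appr i δ k j σ z c' r)
    {G F : Set (MvPolynomial (Fin n) ℝ)}
    {st : (J → Prop) × Prop × ℕ × (G → SignType) × (F → SignType)}
    (hst : ∀ v, IsRootIdx (slice (along i δ) z) k v →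
      ∀ᶠ κ in 𝓝[>] (0 : ℝ), ∀ᶠ ξ in 𝓝[>] (0 : ℝ), ∀ᶠ η in 𝓝[>] (0 : ℝ), ∀ p,
        W.NS (i + 1) (Function.update z i (v + σ * η)) → W.Lab i j z (v + σ * η) p →
        W.view i G F (Sum.elim p fun e => if e then κ else v - σ * ξ) = st) :
    (∀ j', st.1 j' → ∀ τ > 0, ∃ p, W.Conn i z p c ∧ eval p (W.h j') < τ ∧
      ∀ f : G, SignType.sign (eval p f.1) = st.2.2.2.1 f) ∧
    ((∀ j', ¬ st.1 j') → st.2.1 → ∃ p₀, Crit (grad W.Q) i p₀ ∧ W.Conn i z p₀ c ∧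
      IsRootIdx (slice (W.χ i) p₀) st.2.2.1 (eval p₀ (W.u i))) ∧
    ((∀ j', ¬ st.1 j') → ¬ st.2.1 → ∃ y c'' τ₁, 0 < τ₁ ∧ c'' < c ∧ W.Conn i z y c'' ∧
      eval y W.Q + τ₁ ≤ c'' ∧ W.Good (i + 1) y ∧
      (∀ f : F, SignType.sign (eval y f.1) = st.2.2.2.2 f) ∧
      ∃ b, eval y W.Q + τ₁ < b ∧ ∀ c r, W.Appr i δ k j σ z c r → b ≤ r) := by
  obtain ⟨v, q, hv, hq⟩ := hap.exists_choice hi hσ hz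
  have hlab := hq.mono fun η h => h.2.1
  have hco := hq.mono fun η h => h.2.2.2.1
  have hvw : ∀ᶠ κ in 𝓝[>] (0 : ℝ), ∀ᶠ ξ in 𝓝[>] (0 : ℝ), ∀ᶠ η in 𝓝[>] (0 : ℝ),
      W.view i G F (Sum.elim (q η) fun e => if e then κ else v - σ * ξ) = st := by
    filter_upwards [hst v hv] with κ h1
    filter_upwards [h1] with ξ h2
    filter_upwards [h2, hq] with η h3 h4 using h3 _ h4.1 h4.2.1
  refine ⟨fun j' hj' τ hτ => ?_, fun hno hd => ?_, fun hno hd => ?_⟩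
  · obtain ⟨κ, h1, h2⟩ := (hvw.and (Ioo_mem_nhdsGT hτ)).exists
    obtain ⟨ξ, h3⟩ := h1.exists
    obtain ⟨η, h4, h5⟩ := (h3.and hco).exists
    refine ⟨q η, h5.mono hc.le, ?_, fun f => ?_⟩
    · have := congrArg (fun s => s.1 j') h4
      exact ((eq_iff_iff.1 this).2 hj').trans h2.2
    · exact congrArg (fun s => s.2.2.2.1 f) h4
  all_goals
    have hpos : ∃ κ₀ > 0, ∀ᶠ η in 𝓝[>] (0 : ℝ), ∀ j, κ₀ ≤ eval (q η) (W.h j) := by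
      obtain ⟨κ, h1, h2⟩ := (hvw.and self_mem_nhdsWithin).exists
      obtain ⟨ξ, h3⟩ := h1.exists
      refine ⟨κ, h2, h3.mono fun η h j' => not_lt.1 fun h' => hno j' ?_⟩
      exact (eq_iff_iff.1 (congrArg (fun s => s.1 j') h)).1 h'
    obtain ⟨κ₀, hκ₀, hpos⟩ := hpos
  · refine limit_crit hi hσ hc hlab hco hκ₀ hpos ?_ ?_
    · filter_upwards [hvw] with κ h1
      obtain ⟨ξ, h3⟩ := h1.exists
      exact h3.mono fun η h => (eq_iff_iff.1 (congrArg (fun s => s.2.1) h)).2 hd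
    · filter_upwards [hvw] with κ h1
      obtain ⟨ξ, h3⟩ := h1.exists
      exact h3.mono fun η h => congrArg (fun s => s.2.2.1) h
  · obtain ⟨κ, h1, h2⟩ := (hvw.and self_mem_nhdsWithin).exists
    obtain ⟨ξ₀, h3⟩ := h1.exists
    obtain ⟨p₀, k1, y, c'', τ₁, k2, k3, k4, k5, k6, k7, k8⟩ := jump hi hσ hz hc hlab
      (hq.mono fun η h => h.2.2.1) hco hκ₀ hpos (κ₁ := κ) h2
      (h3.mono fun η h => not_lt.1 fun h' =>
        hd ((eq_iff_iff.1 (congrArg (fun s => s.2.1) h)).1 h'))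
      (P := fun y => ∀ f : F, SignType.sign (eval y f.1) = st.2.2.2.2 f)
      (h1.mono fun ξ h => h.mono fun η h' f => congrArg (fun s => s.2.2.2.2 f) h')
    exact ⟨y, c'', τ₁, k2, k3, k4, k5, k7, k8, _, k6, fun c r hap' => cluster_le hi hv
      (hq.mono fun η h => ⟨h.1, h.2.1⟩) k1 hap'⟩

lemma step [Finite J] (hi : m₀ ≤ i) {D : ℕ} (hD : B ^ 6 ≤ D) {G F' : Set (MvPolynomial (Fin n) ℝ)}
    (hG : FinDeg D G) (hF' : FinDeg D F') :
    ∃ F : Set (MvPolynomial (Fin n) ℝ), FinDeg (B ^ 21 * D) F ∧ ∀ z z' s r r' c c' c₁ c₁' τ,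
      SameSign F z z' → W.Good i z → W.Good i z' → s ∈ W.labels i → c₁ < c → c₁' < c' → 0 < τ →
      W.Appr i s.1 s.2.1 s.2.2.1 s.2.2.2 z c₁ r → W.Appr i s.1 s.2.1 s.2.2.1 s.2.2.2 z' c₁' r' →
      W.Exit G i τ z z' c c' ∨ W.Meet G i z z' c c' ∨
      ∃ y y' c₂ c₂' τ₁ τ₁', SameSign F' y y' ∧ W.Good (i + 1) y ∧ W.Good (i + 1) y' ∧
        W.Conn i z y c₂ ∧ W.Conn i z' y' c₂' ∧ 0 < τ₁ ∧ 0 < τ₁' ∧ c₂ < c ∧ c₂' < c' ∧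
        eval y W.Q + τ₁ ≤ c₂ ∧ eval y' W.Q + τ₁' ≤ c₂' ∧ ∃ b, eval y W.Q + τ₁ < b ∧
        ∀ c r, W.Appr i s.1 s.2.1 s.2.2.1 s.2.2.2 z c r → b ≤ r := by
  have hB1 := W.one_le_B
  have hD1 : 1 ≤ D := (Nat.one_le_pow _ _ hB1).trans hD
  have hfin := (finite_labels (W := W) hi).to_subtype
  choose Φ hΦ hΦ' using fun s : W.labels i => W.stateTransfer hi
    (δ := along i s.1.1) ((along_degree i _).trans ((W.V_finDeg _ (hi.trans (Nat.le_succ _))).2 _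
      s.2.1)) s.1.2.1 s.1.2.2.1 s.1.2.2.2 (decided_view (W := W) hi hD hG hF') hD1
  choose Fs hFs hFs' using hΦ
  choose Ψ hΨ hΨ' using fun N : ℕ => W.critUp (E := Empty) hi (b := fun l (x : Fin n → ℝ) => x l)
    (fun l => PolyFn.coord le_rfl l) (c := fun e => e.elim) (fun e => e.elim)
    ((Decided.sameSign hG).comp_polyFn (ι := Fin n ⊕ Empty) (ψ := fun l w => w (.inl l))
      (fun l => PolyFn.coord (D := 1) le_rfl _)) (by omega) N
  choose Fn hFn hFn' using hΨ
  refine ⟨(⋃ s, Fs s) ∪ ⋃ N : Fin (B + 1), Fn N, (FinDeg.iUnion hFs).union (FinDeg.iUnion fun N =>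
    (hFn N).mono ?_), fun z z' s r r' c c' c₁ c₁' τ hs hg hg' hsl hc hc' hτ hap hap' => ?_⟩
  · rw [mul_one]
    exact Nat.mul_le_mul_right _ (Nat.pow_le_pow_right hB1 (by norm_num))
  have hσ : s.2.2.2 * s.2.2.2 = 1 := hsl.2.2.2
  have e1 : Φ ⟨s, hsl⟩ z = Φ ⟨s, hsl⟩ z' := hFs' ⟨s, hsl⟩ z z'
    (hs.mono ((subset_iUnion Fs ⟨s, hsl⟩).trans subset_union_left))
  obtain ⟨st, hst⟩ : ∃ st, Φ ⟨s, hsl⟩ z = some (some st) := by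
    obtain ⟨v, q, hv, hq⟩ := hap.exists_choice hi hσ hg
    obtain ⟨κ, h1⟩ := (hΦ' ⟨s, hsl⟩ z v hv).exists
    obtain ⟨ξ, h2⟩ := h1.exists
    obtain ⟨η, h3, h4⟩ := (h2.and hq).exists
    exact ⟨_, h3 _ h4.1 h4.2.1⟩
  have key : ∀ x, Φ ⟨s, hsl⟩ x = some (some st) → ∀ v,
      IsRootIdx (slice (along i s.1) x) s.2.1 v →
      ∀ᶠ κ in 𝓝[>] (0 : ℝ), ∀ᶠ ξ in 𝓝[>] (0 : ℝ), ∀ᶠ η in 𝓝[>] (0 : ℝ), ∀ p,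
        W.NS (i + 1) (Function.update x i (v + s.2.2.2 * η)) →
        W.Lab i s.2.2.1 x (v + s.2.2.2 * η) p →
        W.view i G F' (Sum.elim p fun e => if e then κ else v - s.2.2.2 * ξ) = st := by
    intro x hx v hv
    filter_upwards [hΦ' ⟨s, hsl⟩ x v hv] with κ h1
    filter_upwards [h1] with ξ h2
    filter_upwards [h2] with η h3 p h4 h5
    have := h3 p h4 h5
    rw [hx] at this
    exact (Option.some.inj (Option.some.inj this)).symm
  obtain ⟨a1, a2, a3⟩ := outcome hi hσ hg hc hap (key z hst)
  obtain ⟨b1, b2, b3⟩ := outcome hi hσ hg' hc' hap' (key z' (e1 ▸ hst))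
  by_cases hA : ∃ j', st.1 j'
  · obtain ⟨j', hj'⟩ := hA
    obtain ⟨p, h1, h2, h3⟩ := a1 j' hj' τ hτ
    obtain ⟨p', h1', h2', h3'⟩ := b1 j' hj' τ hτ
    exact Or.inl ⟨p, p', fun f hf => (h3 ⟨f, hf⟩).trans (h3' ⟨f, hf⟩).symm, h1, h1', j', h2, h2'⟩
  have hA' : ∀ j', ¬ st.1 j' := fun j' h => hA ⟨j', h⟩
  right
  by_cases hd : st.2.1
  · left
    obtain ⟨p, h1, h2, h3⟩ := a2 hA' hd
    obtain ⟨p', h1', h2', h3'⟩ := b2 hA' hd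
    have hNB : st.2.2.1 < B + 1 := Nat.lt_succ_of_le
      (IsRootIdx.le (natDegree_slice_le (W.χ_degree _ hi) p) h3)
    have e2 : Ψ st.2.2.1 z = Ψ st.2.2.1 z' := hFn' _ z z'
      (hs.mono ((subset_iUnion (fun N : Fin (B + 1) => Fn N) ⟨_, hNB⟩).trans subset_union_right))
    rw [hΨ' _ z p ((hg.ns hi i.2.le).congr hi h2.agree.symm) h2.agree h1 h3,
      hΨ' _ z' p' ((hg'.ns hi i.2.le).congr hi h2'.agree.symm) h2'.agree h1' h3'] at e2
    exact ⟨p, p', fun f hf => congrFun (Option.some.inj e2) ⟨f, hf⟩, h2, h2', h1, h1'⟩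
  · right
    obtain ⟨y, c₂, τ₁, h1, h2, h3, h4, h5, h6, b, h7, h8⟩ := a3 hA' hd
    obtain ⟨y', c₂', τ₁', h1', h2', h3', h4', h5', h6', -⟩ := b3 hA' hd
    exact ⟨y, y', c₂, c₂', τ₁, τ₁', fun f hf => (h6 ⟨f, hf⟩).trans (h6' ⟨f, hf⟩).symm, h5, h5', h3,
      h3', h1, h1', h2, h2', h4, h4', b, h7, h8⟩

end Walk

end SemialgComp

namespace SemialgComp

open Filter Topology

namespace Walk

variable {n m₀ B : ℕ} {J : Type} {W : Walk n m₀ B J} {m : ℕ}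
variable {i : Fin n} {z z' : Fin n → ℝ} {c c' d d' τ : ℝ} {G : Set (MvPolynomial (Fin n) ℝ)}

lemma Exit.mono (h : W.Exit G m τ z z' c c') (hc : c ≤ d) (hc' : c' ≤ d') :
    W.Exit G m τ z z' d d' := by
  obtain ⟨p, p', h1, h2, h3, h4⟩ := h
  exact ⟨p, p', h1, h2.mono hc, h3.mono hc', h4⟩

lemma Appr.exists_le {δ : MvPolynomial (Fin n) ℝ} {k j : ℕ} {σ r : ℝ}
    (h : W.Appr i δ k j σ z c r) : ∃ q, AgreeLT i q z ∧ eval q W.Q ≤ r := by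
  obtain ⟨v, -, h⟩ := h
  obtain ⟨η, q, h1, -, -, h2⟩ := h.exists
  exact ⟨q, h1.agree, h2⟩

lemma exists_displaced [Finite J] (hi : m₀ ≤ i) (hg : W.Good i z) (hp : W.Pos z) (hτ : 0 < τ)
    {P : (Fin n → ℝ) → Prop} (hP : ∀ᶠ ξ in 𝓝[>] (0 : ℝ), P (Function.update z i (z i + ξ))) :
    ∃ y, P y ∧ W.Good (i + 1) y ∧ W.Conn i z y (eval z W.Q + 2 * τ) ∧
      eval y W.Q + τ ≤ eval z W.Q + 2 * τ := by
  have h1 := hg.eventually_right hi (z i) (one_ne_zero (α := ℝ))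
  have hc : Continuous fun ξ : ℝ => Function.update z i (z i + ξ) :=
    continuous_const.update i (by fun_prop)
  have hc0 := hc.tendsto 0
  simp only [add_zero, Function.update_eq_self] at hc0
  have h2 := (hc0.eventually (conn_nhds (m := i) hp
    (show eval z W.Q < eval z W.Q + 2 * τ by linarith))).filter_mono
    (nhdsWithin_le_nhds (s := Ioi 0))
  have h3 := (hc0.eventually (((continuous_eval W.Q).tendsto z).eventually (gt_mem_nhds
    (show eval z W.Q < eval z W.Q + τ by linarith)))).filter_mono
    (nhdsWithin_le_nhds (s := Ioi 0))
  obtain ⟨ξ, k0, k1, k2, k3⟩ := (hP.and (h1.and (h2.and h3))).exists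
  rw [one_mul] at k1
  exact ⟨_, k0, k1, k2 (agreeLT_update i le_rfl _ _), by linarith⟩

lemma claim_step [Finite J] (hi : m₀ ≤ i) {a : ℕ} (ha : 1 ≤ a) (hcl : W.Claim (i + 1) a) :
    W.Claim i (B ^ 41 * a) := by
  intro D hD G hG
  have hB1 := W.one_le_B
  set D' := a * (B ^ 20 * D) with hD'
  have hDD : D ≤ D' := by
    rw [hD', ← mul_assoc]
    exact Nat.le_mul_of_pos_left _ (by positivity)
  have hBD : B ^ 6 ≤ D' := by
    calc B ^ 6 ≤ B ^ 20 := Nat.pow_le_pow_right hB1 (by norm_num)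
      _ ≤ B ^ 20 * D := Nat.le_mul_of_pos_right _ hD
      _ ≤ D' := Nat.le_mul_of_pos_left _ ha
  obtain ⟨F', hF', hlaunch⟩ := launch hi hcl hD hG
  obtain ⟨F₁, hF₁, hstep⟩ := step (W := W) hi hBD (hG.mono hDD) hF'
  have hψ : ∀ l : Fin n, PolyFn 1 (fun w : Option (Fin n) → ℝ =>
      Function.update (fun l => w (some l)) i (w (some i) + w none) l) := fun l => by
    by_cases hl : l = i
    · subst hl
      simp only [Function.update_self]
      exact (PolyFn.coord le_rfl _).add (PolyFn.coord le_rfl _)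
    · simp only [Function.update_of_ne hl]
      exact PolyFn.coord le_rfl _
  obtain ⟨Φ, ⟨F₂, hF₂, hΦ⟩, hsmall⟩ := ((Decided.sameSign hF').comp_polyFn hψ).small
  have hdeg : D' * 1 ≤ B ^ 41 * a * D := by
    rw [mul_one, hD']
    calc a * (B ^ 20 * D) = B ^ 20 * a * D := by ring
      _ ≤ B ^ 41 * a * D := by gcongr <;> omega
  refine ⟨F₁ ∪ F₂, (hF₁.mono (le_of_eq (by rw [hD']; ring))).union (hF₂.mono hdeg),
    fun z z' hs hg hg' hp hp' hco hco' τ hτ => ?_⟩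
  have h4 : 0 < τ / 4 := by linarith
  obtain ⟨y, y1, y2, y3, y4⟩ := exists_displaced (τ := τ / 4) hi hg hp h4
    (P := fun y => (fun f : F' => SignType.sign (eval y f.1)) = Φ z) (hsmall z)
  obtain ⟨y', y1', y2', y3', y4'⟩ := exists_displaced (τ := τ / 4) hi hg' hp' h4
    (P := fun y => (fun f : F' => SignType.sign (eval y f.1)) = Φ z') (hsmall z')
  have hyy : SameSign F' y y' := fun f hf => congrFun
    (y1.trans ((hΦ z z' (hs.mono subset_union_right)).trans y1'.symm)) ⟨f, hf⟩
  rcases hlaunch z z' y y' _ _ τ _ _ hyy y2 y2' y3 y3' hco hco' hτ h4 h4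
    y4 y4' with h | ⟨s, hsl, ap, ap'⟩
  · exact Or.inl (h.mono (by linarith) (by linarith))
  set R : Set (MvPolynomial (Fin n) ℝ × ℕ × ℕ × ℝ) := {s | s ∈ W.labels i ∧
    (∃ c < eval z W.Q + τ, ∃ r, W.Appr i s.1 s.2.1 s.2.2.1 s.2.2.2 z c r) ∧
    ∃ c < eval z' W.Q + τ, ∃ r, W.Appr i s.1 s.2.1 s.2.2.1 s.2.2.2 z' c r} with hR
  have hRf : R.Finite := (finite_labels (W := W) hi).subset fun s h => h.1
  obtain ⟨s, ⟨hsl, ⟨c₁, hc₁, r, ap⟩, c₁', hc₁', r', ap'⟩, hmin⟩ := hRf.exists_minimalFor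
    (fun s => sInf {r | ∃ c, W.Appr i s.1 s.2.1 s.2.2.1 s.2.2.2 z c r}) R
    ⟨s, hsl, ⟨_, by linarith, _, ap⟩, _, by linarith, _, ap'⟩
  rcases hstep z z' s r r' _ _ c₁ c₁' τ (hs.mono subset_union_left) hg hg' hsl hc₁ hc₁' hτ ap ap'
    with h | h | ⟨y, y', c₂, c₂', τ₁, τ₁', k1, k2, k2', k3, k3', k4, k4', k5, k5', k6, k6', b, k7, k8⟩
  · exact Or.inl h
  · exact Or.inr h
  rcases hlaunch z z' y y' _ _ τ _ _ k1 k2 k2' k3 k3' hco hco' hτ k4 k4' k6 k6' with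
    h | ⟨s', hsl', ap₂, ap₂'⟩
  · exact Or.inl (h.mono k5.le k5'.le)
  exfalso
  obtain ⟨bd, hbd⟩ := hco.2
  have hbb : BddBelow {r | ∃ c, W.Appr i s'.1 s'.2.1 s'.2.2.1 s'.2.2.2 z c r} := by
    refine ⟨bd, ?_⟩
    rintro x ⟨c, hx⟩
    obtain ⟨q, h1, h2⟩ := hx.exists_le
    exact (hbd q (h1.mono hi)).trans h2
  have l1 : sInf {r | ∃ c, W.Appr i s'.1 s'.2.1 s'.2.2.1 s'.2.2.2 z c r} ≤ eval y W.Q + τ₁ :=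
    csInf_le hbb ⟨_, ap₂⟩
  have l2 : b ≤ sInf {r | ∃ c, W.Appr i s.1 s.2.1 s.2.2.1 s.2.2.2 z c r} :=
    le_csInf ⟨r, _, ap⟩ fun x hx => by
      obtain ⟨c, hx⟩ := hx
      exact k8 c x hx
  have l3 := hmin (show s' ∈ R from ⟨hsl', ⟨_, k5, _, ap₂⟩, _, k5', _, ap₂'⟩) (by
    exact l1.trans (k7.le.trans l2))
  dsimp only at l3
  linarith

lemma claim_top : W.Claim n 1 := by
  intro D _ G hG
  refine ⟨G, by rwa [one_mul], fun z z' hs _ _ hp hp' _ _ τ hτ => Or.inr ⟨z, z', hs,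
    Conn.refl hp (by linarith), Conn.refl hp' (by linarith), ?_, ?_⟩⟩
  all_goals exact fun l hl => absurd l.2 (not_lt.2 hl)

lemma claim_base [Finite J] (W : Walk n m₀ B J) (hm₀ : m₀ ≤ n) :
    W.Claim m₀ ((B ^ 41) ^ (n - m₀)) := by
  have hB1 := W.one_le_B
  have key : ∀ k ≤ n - m₀, W.Claim (n - k) ((B ^ 41) ^ k) := by
    intro k
    induction k with
    | zero => exact fun _ => by simpa using claim_top
    | succ k ih =>
      intro hk
      have h1 := ih (by omega)
      have h2 : n - (k + 1) + 1 = n - k := by omega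
      have h3 := claim_step (W := W) (i := ⟨n - (k + 1), by omega⟩)
        (show m₀ ≤ n - (k + 1) by omega) (Nat.one_le_pow _ _ (by positivity) : 1 ≤ (B ^ 41) ^ k)
        (by rw [← h2] at h1; exact h1)
      rw [pow_succ, mul_comm]
      exact h3
  have := key (n - m₀) le_rfl
  rwa [Nat.sub_sub_self hm₀] at this

end Walk

end SemialgComp

namespace SemialgComp

open Filter Topology

variable {n : ℕ} {J : Type}

lemma totalDegree_pderiv_le_pred {ι : Type} (l : ι) (q : MvPolynomial ι ℝ) :
    (pderiv l q).totalDegree ≤ q.totalDegree - 1 := by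
  classical
  conv_lhs => rw [q.as_sum, map_sum]
  refine totalDegree_finsetSum_le fun s hs => ?_
  rw [pderiv_monomial]
  by_cases h : s l = 0
  · simp [h]
  refine (totalDegree_monomial_le _ _).trans ?_
  have h1 : s.sum (fun _ e => e) ≤ q.totalDegree := le_totalDegree hs
  have h2 : s = (s - Finsupp.single l 1) + Finsupp.single l 1 := by
    ext i
    rcases eq_or_ne l i with rfl | hi
    · simp
      omega
    · simp [Finsupp.single_eq_of_ne hi.symm]
  have h3 : s.sum (fun _ e => e) = (s - Finsupp.single l 1).sum (fun _ e => e) + 1 := by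
    conv_lhs => rw [h2]
    rw [Finsupp.sum_add_index' (fun _ => rfl) (fun _ _ _ => rfl), Finsupp.sum_single_index rfl]
  have h4 : (s - Finsupp.single l 1).sum (fun _ => id) = (s - Finsupp.single l 1).sum fun _ e => e := rfl
  omega

lemma totalDegree_pderiv_le {ι : Type} (l : ι) (q : MvPolynomial ι ℝ) :
    (pderiv l q).totalDegree ≤ q.totalDegree :=
  (totalDegree_pderiv_le_pred l q).trans (Nat.sub_le _ _)

lemma continuous_of_polyFn {D : ℕ} {g : (Fin n → ℝ) → ℝ} (h : PolyFn D g) : Continuous g := by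
  obtain ⟨q, -, hq⟩ := h
  rw [funext hq]
  exact continuous_eval q

lemma Leading.mono {f : Fin n → MvPolynomial (Fin n) ℝ} {m m' e : ℕ} (h : Leading f m e)
    (hm : m ≤ m') : Leading f m' e := ⟨h.1, fun l hl => h.2 l (hm.trans hl)⟩

/-- The value at `z` of none of the polynomials in `V` vanishes as soon as the critical points over
`z` form a grid on which the obstacles, the Jacobian and the previous derivative do not vanish. -/
def GridNS (Q : MvPolynomial (Fin n) ℝ) (h : J → MvPolynomial (Fin n) ℝ) (m₀ e m : ℕ)
    (V : Set (MvPolynomial (Fin n) ℝ)) : Prop :=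
  ∀ (s : ℝ) (z : Fin n → ℝ), (∀ b : Idx n m e, Crit (grad Q) m (gridPt m e s z b) ∧
    (jacMat Q m (gridPt m e s z b)).det ≠ 0 ∧ (∀ j, eval (gridPt m e s z b) (h j) ≠ 0) ∧
    ∀ i : Fin n, (i : ℕ) + 1 = m → m₀ ≤ i → eval (gridPt m e s z b) (grad Q i) ≠ 0) →
  ∀ δ ∈ V, eval z δ ≠ 0

lemma exists_specials [Finite J] {Q : MvPolynomial (Fin n) ℝ} {h : J → MvPolynomial (Fin n) ℝ}
    {m₀ m e D B : ℕ} (hf : Leading (grad Q) m e) (hQ : ∀ l, (grad Q l).totalDegree ≤ D)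
    (hh : ∀ j, (h j).totalDegree ≤ D) (hB₁ : e ^ n * (n * D + D + n * e) ≤ B)
    (hB₂ : e ^ n * (2 * elimDeg n e) ≤ B) :
    ∃ V : Set (MvPolynomial (Fin n) ℝ), FinDeg B V ∧
      (∀ y z, AgreeLT m y z → ∀ δ ∈ V, eval y δ = eval z δ) ∧
      (∀ z, (∀ δ ∈ V, eval z δ ≠ 0) → (Polynomial.aeval (mulMat hf (sepForm n m e) z)
        (mulMat hf (sepForm n m e) z).charpoly.derivative).det ≠ 0) ∧
      (∀ z, (∀ δ ∈ V, eval z δ ≠ 0) → Crit (grad Q) m z → (jacMat Q m z).det ≠ 0) ∧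
      (∀ z, (∀ δ ∈ V, eval z δ ≠ 0) → Crit (grad Q) m z → ∀ j, eval z (h j) ≠ 0) ∧
      (∀ i : Fin n, (i : ℕ) + 1 = m → m₀ ≤ i → ∀ z, (∀ δ ∈ V, eval z δ ≠ 0) →
        Crit (grad Q) m z → eval z (grad Q i) ≠ 0) ∧
      GridNS Q h m₀ e m V := by
  classical
  have he : 1 ≤ e := by have := hf.1; omega
  obtain ⟨N, hN1, hN2⟩ := exists_disc hf
  have hjac : PolyFn (n * D) (fun z => (jacMat Q m z).det) := by
    have := PolyFn.det (M := fun z => jacMat Q m z) (D := D) fun l l' => by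
      by_cases hl : (l : ℕ) < m
      · simp only [jacMat, Matrix.of_apply, if_pos hl]
        exact PolyFn.const _ _
      · simp only [jacMat, Matrix.of_apply, if_neg hl]
        exact PolyFn.eval ((totalDegree_pderiv_le _ _).trans (hQ l))
    simpa using this
  obtain ⟨q, hq1, hq2⟩ := hjac
  choose Nm hNm1 hNm2 using fun r : MvPolynomial (Fin n) ℝ => exists_norm hf r
  let R : Set (MvPolynomial (Fin n) ℝ) :=
    {q} ∪ (range h ∪ (grad Q) '' {i | (i : ℕ) + 1 = m ∧ m₀ ≤ i})
  have hRf : R.Finite := (finite_singleton q).union ((finite_range h).union (toFinite _))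
  have hRd : ∀ r ∈ R, r.totalDegree ≤ n * D + D := by
    rintro r (rfl | ⟨j, rfl⟩ | ⟨i, -, rfl⟩)
    · exact hq1.trans (Nat.le_add_right _ _)
    · exact (hh j).trans (Nat.le_add_left _ _)
    · exact (hQ i).trans (Nat.le_add_left _ _)
  have hnorm : ∀ z, (∀ δ ∈ insert N (Nm '' R), eval z δ ≠ 0) → Crit (grad Q) m z →
      ∀ r ∈ R, eval z r ≠ 0 := fun z hz hc r hr => by
    refine ne_zero_of_norm hf hc ?_
    rw [← hNm2]
    exact hz _ (Or.inr ⟨r, hr, rfl⟩)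
  refine ⟨insert N (Nm '' R), ⟨(hRf.image _).insert _, ?_⟩, ?_, ?_, ?_, ?_, ?_, ?_⟩
  · rintro δ (rfl | ⟨r, hr, rfl⟩)
    · exact hN1.trans hB₂
    · exact (hNm1 r).trans ((Nat.mul_le_mul_left _ (Nat.add_le_add_right (hRd r hr) _)).trans hB₁)
  · rintro y z hyz δ (rfl | ⟨r, hr, rfl⟩)
    · rw [hN2, hN2, mulMat_base hf _ y z hyz]
    · rw [hNm2, hNm2, mulMat_base hf _ y z hyz]
  · intro z hz
    rw [← hN2]
    exact hz _ (Or.inl rfl)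
  · intro z hz hc
    have := hnorm z hz hc _ (Or.inl rfl)
    rwa [← hq2] at this
  · intro z hz hc j
    exact hnorm z hz hc _ (Or.inr (Or.inl ⟨j, rfl⟩))
  · intro i hi hi2 z hz hc
    exact hnorm z hz hc _ (Or.inr (Or.inr ⟨i, ⟨hi, hi2⟩, rfl⟩))
  · rintro s z hz δ (rfl | ⟨r, hr, rfl⟩)
    · rw [hN2]
      exact disc_ne_zero_of_grid hf fun b => (hz b).1
    · rw [hNm2]
      refine norm_ne_zero_of_grid hf (fun b => (hz b).1) fun b => ?_
      obtain ⟨-, h2, h3, h4⟩ := hz b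
      rcases hr with rfl | ⟨j, rfl⟩ | ⟨i, hi, rfl⟩
      · rwa [← hq2]
      · exact h3 j
      · exact h4 i hi.1 hi.2

/-- The elimination data attached to a polynomial whose partial derivatives have pure leading
terms. -/
theorem exists_walk [Finite J] {Q : MvPolynomial (Fin n) ℝ} {h : J → MvPolynomial (Fin n) ℝ}
    {m₀ e D B : ℕ} (hf : Leading (grad Q) m₀ e) (hQ : ∀ l, (grad Q l).totalDegree ≤ D)
    (hh : ∀ j, (h j).totalDegree ≤ D) (hB : 10000 ≤ B) (hD : D ≤ B)
    (hB₁ : e ^ n * (n * D + D + n * e) ≤ B) (hB₂ : e ^ n * (2 * elimDeg n e) ≤ B) :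
    ∃ W : Walk n m₀ B J, W.Q = Q ∧ W.h = h ∧
      ∀ m, m₀ ≤ m → GridNS Q h m₀ e m (W.V m) := by
  classical
  have he : 1 ≤ e := by have := hf.1; omega
  have hel : elimDeg n e ≤ B := by
    refine le_trans ?_ hB₂
    nlinarith [Nat.one_le_pow n e he, Nat.zero_le (elimDeg n e),
      Nat.mul_le_mul_right (elimDeg n e) (Nat.one_le_pow n e he)]
  choose χ num den h1 h2 h3 h4 h5 h6 h7 using
    fun m => fun hm : m₀ ≤ m => exists_elimination (hf.mono hm)
  choose V hV1 hV2 hV3 hV4 hV5 hV6 hV7 using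
    fun m => fun hm : m₀ ≤ m => exists_specials (m₀ := m₀) (hf.mono hm) hQ hh hB₁ hB₂
  let M : ∀ m, m₀ ≤ m → MvPolynomial (Fin n) ℝ → (Fin n → ℝ) →
    Matrix (Idx n m e) (Idx n m e) ℝ := fun m hm => mulMat (hf.mono hm)
  let bd : ∀ m, m₀ ≤ m → (Fin n → ℝ) → ℝ := fun m hm z =>
    (∑ i, ∑ j, |M m hm (sepForm n m e) z i j|) +
      ∑ l : Fin n, ∑ i, ∑ j, |M m hm (MvPolynomial.X l) z i j|
  have hMc : ∀ m hm q i j, Continuous fun z => M m hm q z i j := fun m hm q i j =>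
    continuous_of_polyFn (mulMat_polyFn (hf.mono hm) q i j)
  have hMb : ∀ m hm q y z, AgreeLT m y z → M m hm q y = M m hm q z := fun m hm q y z hyz =>
    mulMat_base (hf.mono hm) q y z hyz
  have hs0 : ∀ m hm z, 0 ≤ ∑ i, ∑ j, |M m hm (sepForm n m e) z i j| := fun m hm z =>
    Finset.sum_nonneg fun i _ => Finset.sum_nonneg fun j _ => abs_nonneg _
  have hl0 : ∀ m hm (l : Fin n) z, 0 ≤ ∑ i, ∑ j, |M m hm (MvPolynomial.X l) z i j| :=
    fun m hm l z => Finset.sum_nonneg fun i _ => Finset.sum_nonneg fun j _ => abs_nonneg _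
  have hroot : ∀ m hm z, Crit (grad Q) m z →
      (slice (χ m hm) z).eval (eval z (sepForm n m e)) = 0 := fun m hm z hz => by
    rw [h4]
    exact charpoly_root_of_mulVec (redMono_ne_zero (hf.mono hm) z)
      (mulMat_mulVec (hf.mono hm) _ hz)
  refine ⟨{
    Q := Q
    h := h
    u := fun m => sepForm n m e
    χ := fun m => if hm : m₀ ≤ m then χ m hm else 0
    num := fun m => if hm : m₀ ≤ m then num m hm else 0
    den := fun m => if hm : m₀ ≤ m then den m hm else 0
    V := fun m => if hm : m₀ ≤ m then V m hm else ∅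
    bd := fun m => if hm : m₀ ≤ m then bd m hm else 0
    le_B := hB
    grad_degree := fun l => (hQ l).trans hD
    h_degree := fun j => (hh j).trans hD
    u_degree := fun m _ => (sepForm_degree n m e).trans (by omega)
    χ_degree := fun m hm => ?_
    num_degree := fun m hm l => ?_
    den_degree := fun m hm => ?_
    V_finDeg := fun m hm => ?_
    bd_cont := fun m hm => ?_
    bd_base := fun m hm y z hyz => ?_
    χ_ne := fun m hm z => ?_
    χ_base := fun m hm y z hyz => ?_
    num_base := fun m hm y z hyz l r => ?_
    V_base := fun m hm y z hyz => ?_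
    bd_root := fun m hm z r => ?_
    den_eq := fun m hm z => ?_
    crit_root := fun m hm z hz => ?_
    crit_coord := fun m hm z hz l => ?_
    crit_bd := fun m hm z hz l hl => ?_
    ns_simple := fun m hm z => ?_
    ns_jac := fun m hm z => ?_
    ns_h := fun m hm z => ?_
    ns_grad := fun i hi z => ?_ }, rfl, rfl, fun m hm => ?_⟩
  · rw [dif_pos hm]
    exact (h1 m hm).trans hel
  · rw [dif_pos hm]
    exact (h2 m hm l).trans hel
  · rw [dif_pos hm]
    exact (h3 m hm).trans hel
  · rw [dif_pos hm]
    exact hV1 m hm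
  · rw [dif_pos hm]
    exact (continuous_finsetSum _ fun i _ => continuous_finsetSum _ fun j _ =>
      (hMc m hm _ i j).abs).add (continuous_finsetSum _ fun l _ =>
        continuous_finsetSum _ fun i _ => continuous_finsetSum _ fun j _ => (hMc m hm _ i j).abs)
  · simp only [dif_pos hm, bd, hMb m hm _ y z hyz]
  · simp only [dif_pos hm, h4]
    exact (Matrix.charpoly_monic _).ne_zero
  · simp only [dif_pos hm, h4]
    rw [mulMat_base (hf.mono hm) _ y z hyz]
  · simp only [dif_pos hm]
    exact h6 m hm y z hyz l r
  · simp only [dif_pos hm]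
    exact hV2 m hm y z hyz
  · simp only [dif_pos hm, h4]
    intro hr
    obtain ⟨b, hb, hb2⟩ := exists_mulVec_of_charpoly_root hr
    exact (abs_eigenvalue_le hb hb2).trans (le_add_of_nonneg_right
      (Finset.sum_nonneg fun l _ => hl0 m hm l z))
  · simp only [dif_pos hm]
    exact h5 m hm z
  · simp only [dif_pos hm]
    exact hroot m hm z hz
  · simp only [dif_pos hm]
    exact h7 m hm z hz l
  · simp only [dif_pos hm]
    have := abs_eigenvalue_le (redMono_ne_zero (hf.mono hm) z)
      (mulMat_mulVec (hf.mono hm) (MvPolynomial.X l) hz)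
    rw [eval_X] at this
    refine this.trans ((Finset.single_le_sum (f := fun l : Fin n =>
      ∑ i, ∑ j, |M m hm (MvPolynomial.X l) z i j|) (fun l _ => hl0 m hm l z)
      (Finset.mem_univ l)).trans (le_add_of_nonneg_left (hs0 m hm z)))
  · simp only [dif_pos hm, h4]
    exact fun hz r => derivative_ne_zero_of_disc _ (hV3 m hm z hz)
  · simp only [dif_pos hm]
    exact hV4 m hm z
  · simp only [dif_pos hm]
    exact hV5 m hm z
  · have hm : m₀ ≤ (i : ℕ) + 1 := hi.trans (Nat.le_succ _)
    simp only [dif_pos hm]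
    exact hV6 _ hm i rfl hi z
  · simp only [dif_pos hm]
    exact hV7 m hm

end SemialgComp

namespace SemialgComp

open Filter Topology


lemma exists_antiderivative (w : Polynomial ℝ) :
    ∃ g : Polynomial ℝ, g.derivative = w ∧ g.natDegree ≤ w.natDegree + 1 := by
  refine ⟨∑ i ∈ Finset.range (w.natDegree + 1),
    Polynomial.monomial (i + 1) (w.coeff i / ((i : ℝ) + 1)), ?_, ?_⟩
  · rw [Polynomial.derivative_sum]
    conv_rhs => rw [w.as_sum_range]
    refine Finset.sum_congr rfl fun i _ => ?_
    have : (i : ℝ) + 1 ≠ 0 := by positivity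
    rw [Polynomial.derivative_monomial]
    simp [this]
  · refine Polynomial.natDegree_sum_le_of_forall_le _ _ fun i hi => ?_
    refine (Polynomial.natDegree_monomial_le _).trans ?_
    have := Finset.mem_range.1 hi
    omega

/-- The monic polynomial with roots `0, …, e - 1`. -/
noncomputable def gridPoly (e : ℕ) : Polynomial ℝ :=
  ∏ i ∈ Finset.range e, (Polynomial.X - Polynomial.C (i : ℝ))

lemma gridPoly_monic (e : ℕ) : (gridPoly e).Monic :=
  Polynomial.monic_prod_of_monic _ _ fun _ _ => Polynomial.monic_X_sub_C _

lemma gridPoly_natDegree (e : ℕ) : (gridPoly e).natDegree = e := by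
  rw [gridPoly, Polynomial.natDegree_prod_of_monic _ _ fun _ _ => Polynomial.monic_X_sub_C _]
  simp only [Polynomial.natDegree_X_sub_C, Finset.sum_const, Finset.card_range, smul_eq_mul, mul_one]

lemma gridPoly_eval (e : ℕ) (x : ℝ) : (gridPoly e).eval x = ∏ i ∈ Finset.range e, (x - i) := by
  simp [gridPoly, Polynomial.eval_prod]

lemma gridPoly_root {e b : ℕ} (hb : b < e) : (gridPoly e).eval (b : ℝ) = 0 := by
  rw [gridPoly_eval]
  exact Finset.prod_eq_zero (Finset.mem_range.2 hb) (sub_self _)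

lemma gridPoly_half_ne (e : ℕ) : (gridPoly e).eval (1 / 2) ≠ 0 := by
  rw [gridPoly_eval, Finset.prod_ne_zero_iff]
  intro i _ h
  have h1 : ((2 * i : ℕ) : ℝ) = ((1 : ℕ) : ℝ) := by
    push_cast
    linarith
  have := Nat.cast_injective h1
  omega

lemma gridPoly_derivative_ne {e b : ℕ} (hb : b < e) :
    (gridPoly e).derivative.eval (b : ℝ) ≠ 0 := by
  have h : gridPoly e = (Polynomial.X - Polynomial.C (b : ℝ)) *
      ∏ i ∈ (Finset.range e).erase b, (Polynomial.X - Polynomial.C (i : ℝ)) :=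
    (Finset.mul_prod_erase _ _ (Finset.mem_range.2 hb)).symm
  rw [h, Polynomial.derivative_mul]
  simp only [Polynomial.derivative_sub, Polynomial.derivative_X, Polynomial.derivative_C, sub_zero,
    one_mul, Polynomial.eval_add, Polynomial.eval_mul, Polynomial.eval_sub, Polynomial.eval_X,
    Polynomial.eval_C, sub_self, zero_mul, add_zero, Polynomial.eval_prod]
  rw [Finset.prod_ne_zero_iff]
  intro i hi h
  exact (Finset.mem_erase.1 hi).1 (Nat.cast_injective (sub_eq_zero.1 h).symm)

lemma gridPoly_sub_natDegree {e : ℕ} (he : 1 ≤ e) :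
    (gridPoly e - Polynomial.X ^ e).natDegree < e := by
  rcases eq_or_ne (gridPoly e - Polynomial.X ^ e) 0 with h | h
  · rw [h, Polynomial.natDegree_zero]
    omega
  have h1 : (gridPoly e).degree = e := by
    rw [Polynomial.degree_eq_natDegree (gridPoly_monic e).ne_zero, gridPoly_natDegree]
  have h2 : (gridPoly e - Polynomial.X ^ e).degree < (gridPoly e).degree :=
    Polynomial.degree_sub_lt_left (by rw [h1, Polynomial.degree_X_pow]) (gridPoly_monic e).ne_zero
      (by rw [(gridPoly_monic e).leadingCoeff, Polynomial.leadingCoeff_X_pow])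
  rw [h1] at h2
  exact (Polynomial.natDegree_lt_iff_degree_lt h).2 h2

lemma tendsto_cocompact_of_even {p : Polynomial ℝ} (h0 : 0 < p.natDegree)
    (he : Even p.natDegree) (hl : 0 < p.leadingCoeff) :
    Tendsto (fun x => p.eval x) (cocompact ℝ) atTop := by
  rw [cocompact_eq_atBot_atTop, tendsto_sup]
  refine ⟨?_, Polynomial.tendsto_atTop_of_leadingCoeff_nonneg _
    (Polynomial.natDegree_pos_iff_degree_pos.1 h0) hl.le⟩
  have h1 : (p.comp (-Polynomial.X)).natDegree = p.natDegree := by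
    rw [Polynomial.natDegree_comp]
    simp
  have h2 : (p.comp (-Polynomial.X)).leadingCoeff = p.leadingCoeff := by
    rw [Polynomial.leadingCoeff_comp (by simp)]
    simp [he.neg_one_pow]
  have h3 := Polynomial.tendsto_atTop_of_leadingCoeff_nonneg (p.comp (-Polynomial.X))
    (Polynomial.natDegree_pos_iff_degree_pos.1 (h1 ▸ h0)) (h2 ▸ hl.le)
  refine (h3.comp tendsto_neg_atBot_atTop).congr fun x => ?_
  simp

/-- A nonnegative coercive polynomial with critical points `0, …, e - 1`. -/
lemma exists_potential {e : ℕ} (he : Odd e) :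
    ∃ g : Polynomial ℝ, g.derivative = gridPoly e ∧ (∀ x, 0 ≤ g.eval x) ∧
      ∀ c : ℝ, ∃ R : ℝ, ∀ x, g.eval x ≤ c → |x| ≤ R := by
  obtain ⟨r, hr1, hr2⟩ := exists_antiderivative (gridPoly e - Polynomial.X ^ e)
  have hr3 := gridPoly_sub_natDegree he.pos
  have hne : ((e : ℝ) + 1) ≠ 0 := by positivity
  set p : Polynomial ℝ := Polynomial.monomial (e + 1) (1 / ((e : ℝ) + 1)) + r with hp
  have hlt : r.natDegree <
      (Polynomial.monomial (e + 1) (1 / ((e : ℝ) + 1)) : Polynomial ℝ).natDegree := by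
    rw [Polynomial.natDegree_monomial_eq _ (by positivity)]
    omega
  have hdeg : p.natDegree = e + 1 := by
    rw [hp, Polynomial.natDegree_add_eq_left_of_natDegree_lt hlt,
      Polynomial.natDegree_monomial_eq _ (by positivity)]
  have hlead : p.leadingCoeff = 1 / ((e : ℝ) + 1) := by
    rw [Polynomial.leadingCoeff, hdeg, hp, Polynomial.coeff_add, Polynomial.coeff_monomial_same,
      Polynomial.coeff_eq_zero_of_natDegree_lt (by omega), add_zero]
  have hder : p.derivative = gridPoly e := by
    rw [hp, Polynomial.derivative_add, hr1, Polynomial.derivative_monomial]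
    simp [hne, Polynomial.X_pow_eq_monomial]
  have ht := tendsto_cocompact_of_even (p := p) (by omega) (by rw [hdeg]; exact he.add_one)
    (by rw [hlead]; positivity)
  obtain ⟨x₀, hx₀⟩ := p.continuous.exists_forall_le ht
  refine ⟨p - Polynomial.C (p.eval x₀), by simp [hder], fun x => ?_, fun c => ?_⟩
  · simpa using hx₀ x
  · have h1 := ht.eventually (eventually_gt_atTop (c + p.eval x₀))
    rw [cocompact_eq_atBot_atTop, eventually_sup] at h1
    obtain ⟨a, ha⟩ := eventually_atBot.1 h1.1
    obtain ⟨b, hb⟩ := eventually_atTop.1 h1.2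
    refine ⟨max (-a) b, fun x hx => ?_⟩
    simp only [Polynomial.eval_sub, Polynomial.eval_C] at hx
    rw [abs_le]
    constructor
    · by_contra h
      push Not at h
      have := ha x (by linarith [le_max_left (-a) b])
      linarith
    · by_contra h
      push Not at h
      have := hb x (by linarith [le_max_right (-a) b])
      linarith

end SemialgComp

namespace SemialgComp

open Filter Topology


variable {k : ℕ} {J : Type}

/-- The point with first coordinates `ε`, `θ` and remaining coordinates `x`. -/
def pt (ε θ : ℝ) (x : Fin k → ℝ) : Fin (k + 2) → ℝ :=
  Fin.cons ε (Fin.cons θ x : Fin (k + 1) → ℝ)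

@[simp] lemma pt_zero (ε θ : ℝ) (x : Fin k → ℝ) : pt ε θ x 0 = ε := rfl

@[simp] lemma pt_one (ε θ : ℝ) (x : Fin k → ℝ) : pt ε θ x 1 = θ := rfl

@[simp] lemma pt_succ (ε θ : ℝ) (x : Fin k → ℝ) (i : Fin k) : pt ε θ x i.succ.succ = x i := rfl

lemma exists_succ_succ {l : Fin (k + 2)} (hl : 2 ≤ (l : ℕ)) : ∃ i : Fin k, l = i.succ.succ :=
  ⟨⟨l - 2, by omega⟩, Fin.ext (by simp; omega)⟩

lemma lt_two_iff {l : Fin (k + 2)} : (l : ℕ) < 2 ↔ l = 0 ∨ l = 1 := by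
  constructor
  · intro h
    rcases Nat.lt_succ_iff_lt_or_eq.1 h with h | h
    · exact Or.inl (Fin.ext (Nat.lt_one_iff.1 h))
    · exact Or.inr (Fin.ext (by simp [h]))
  · rintro (rfl | rfl) <;> simp

lemma agreeLT_two_iff {y z : Fin (k + 2) → ℝ} : AgreeLT 2 y z ↔ y 0 = z 0 ∧ y 1 = z 1 := by
  constructor
  · exact fun h => ⟨h 0 (by simp), h 1 (by simp)⟩
  · rintro ⟨h0, h1⟩ i hi
    rcases lt_two_iff.1 hi with rfl | rfl
    · exact h0
    · exact h1

lemma eq_pt_of_agree {ε θ : ℝ} {x : Fin k → ℝ} {y : Fin (k + 2) → ℝ}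
    (h : AgreeLT 2 y (pt ε θ x)) : y = pt ε θ (fun i => y i.succ.succ) := by
  obtain ⟨h0, h1⟩ := agreeLT_two_iff.1 h
  funext l
  by_cases hl : (l : ℕ) < 2
  · rcases lt_two_iff.1 hl with rfl | rfl
    · exact h0
    · exact h1
  · obtain ⟨i, rfl⟩ := exists_succ_succ (not_lt.1 hl)
    rfl

/-- A polynomial in the last coordinates. -/
noncomputable def lift2 (q : MvPolynomial (Fin k) ℝ) : MvPolynomial (Fin (k + 2)) ℝ :=
  rename (fun i : Fin k => i.succ.succ) q

lemma eval_lift2 (z : Fin (k + 2) → ℝ) (q : MvPolynomial (Fin k) ℝ) :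
    eval z (lift2 q) = eval (fun i => z i.succ.succ) q := by
  rw [lift2, eval_rename]
  rfl

@[simp] lemma eval_pt_lift2 (ε θ : ℝ) (x : Fin k → ℝ) (q : MvPolynomial (Fin k) ℝ) :
    eval (pt ε θ x) (lift2 q) = eval x q := eval_lift2 _ _

lemma totalDegree_lift2_le (q : MvPolynomial (Fin k) ℝ) : (lift2 q).totalDegree ≤ q.totalDegree :=
  totalDegree_rename_le _ _

/-- A basic semi-algebraic set together with a generic perturbation and a coercive potential. -/
structure Sys (k : ℕ) (J : Type) where
  P0 : MvPolynomial (Fin k) ℝ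
  P : J → MvPolynomial (Fin k) ℝ
  g : J → ℝ
  pot : Polynomial ℝ
  e : ℕ
  d : ℕ
  e_eq : e = 2 * d + 1
  one_le_d : 1 ≤ d
  P0_degree : P0.totalDegree ≤ 2 * d
  P_degree : ∀ j, (P j).totalDegree ≤ d
  P0_nonneg : ∀ x, 0 ≤ eval x P0
  g_pos : ∀ j, 0 < g j
  pot_deriv : pot.derivative = gridPoly e
  pot_nonneg : ∀ x, 0 ≤ pot.eval x
  pot_coercive : ∀ c : ℝ, ∃ R : ℝ, ∀ x, pot.eval x ≤ c → |x| ≤ R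

lemma eval_aeval_X {ι : Type} (z : ι → ℝ) (l : ι) (p : Polynomial ℝ) :
    eval z (Polynomial.aeval (MvPolynomial.X l) p) = p.eval (z l) := by
  rw [Polynomial.aeval_eq_sum_range, Polynomial.eval_eq_sum_range]
  simp [MvPolynomial.smul_eval]

lemma totalDegree_aeval_X_le {ι : Type} (l : ι) (p : Polynomial ℝ) :
    (Polynomial.aeval (MvPolynomial.X l : MvPolynomial ι ℝ) p).totalDegree ≤ p.natDegree := by
  rw [Polynomial.aeval_eq_sum_range]
  refine totalDegree_finsetSum_le fun i hi => ?_
  refine (totalDegree_smul_le _ _).trans ?_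
  rw [totalDegree_X_pow]
  have := Finset.mem_range.1 hi
  omega

lemma pderiv_aeval_X {ι : Type} [DecidableEq ι] (l l' : ι) (p : Polynomial ℝ) :
    pderiv l' (Polynomial.aeval (MvPolynomial.X l : MvPolynomial ι ℝ) p) =
      if l = l' then Polynomial.aeval (MvPolynomial.X l) p.derivative else 0 := by
  rw [Derivation.map_aeval, pderiv_X, smul_eq_mul]
  split_ifs with h
  · subst h
    simp
  · rw [Pi.single_eq_of_ne h, mul_zero]

namespace Sys

variable (S : Sys k J)

/-- The perturbed obstacle. -/
noncomputable def obst (j : J) : MvPolynomial (Fin (k + 2)) ℝ :=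
  lift2 (S.P j) - MvPolynomial.C (S.g j) * MvPolynomial.X 0

/-- The penalty term of the active constraints. -/
noncomputable def sig (I : Finset J) : MvPolynomial (Fin (k + 2)) ℝ :=
  lift2 S.P0 + ∑ i ∈ I, S.obst i ^ 2

/-- The sum of the potentials of the last coordinates. -/
noncomputable def potSum (k : ℕ) (p : Polynomial ℝ) : MvPolynomial (Fin (k + 2)) ℝ :=
  ∑ l ∈ Finset.univ.filter (fun l : Fin (k + 2) => 2 ≤ (l : ℕ)), Polynomial.aeval (MvPolynomial.X l) p

/-- The function followed by the walk. -/
noncomputable def Q (I : Finset J) : MvPolynomial (Fin (k + 2)) ℝ :=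
  MvPolynomial.X 1 * S.sig I + potSum k S.pot

variable {S}

@[simp] lemma eval_obst (ε θ : ℝ) (x : Fin k → ℝ) (j : J) :
    eval (pt ε θ x) (S.obst j) = eval x (S.P j) - ε * S.g j := by
  simp [obst, mul_comm]

lemma eval_sig (ε θ : ℝ) (x : Fin k → ℝ) (I : Finset J) :
    eval (pt ε θ x) (S.sig I) = eval x S.P0 + ∑ i ∈ I, (eval x (S.P i) - ε * S.g i) ^ 2 := by
  simp [sig]

lemma eval_Q (ε θ : ℝ) (x : Fin k → ℝ) (I : Finset J) :
    eval (pt ε θ x) (S.Q I) = θ * eval (pt ε θ x) (S.sig I) + eval (pt ε θ x) (potSum k S.pot) := by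
  simp [Q]

lemma eval_potSum (z : Fin (k + 2) → ℝ) (p : Polynomial ℝ) : eval z (potSum k p) =
    ∑ l ∈ Finset.univ.filter (fun l : Fin (k + 2) => 2 ≤ (l : ℕ)), p.eval (z l) := by
  simp [potSum, eval_aeval_X]

lemma totalDegree_obst_le (j : J) : (S.obst j).totalDegree ≤ S.d := by
  refine (totalDegree_sub _ _).trans (max_le ?_ ?_)
  · exact (totalDegree_lift2_le _).trans (S.P_degree j)
  · refine (totalDegree_mul _ _).trans ?_
    rw [totalDegree_C, totalDegree_X]
    have := S.one_le_d
    omega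

lemma totalDegree_sig_le (I : Finset J) : (S.sig I).totalDegree ≤ 2 * S.d := by
  refine (totalDegree_add _ _).trans (max_le ?_ ?_)
  · exact (totalDegree_lift2_le _).trans S.P0_degree
  · refine totalDegree_finsetSum_le fun i _ => (totalDegree_pow _ _).trans ?_
    exact Nat.mul_le_mul_left 2 (totalDegree_obst_le i)

lemma grad_Q (I : Finset J) (l : Fin (k + 2)) : grad (S.Q I) l =
    pderiv l (MvPolynomial.X 1 * S.sig I) +
      if 2 ≤ (l : ℕ) then Polynomial.aeval (MvPolynomial.X l) (gridPoly S.e) else 0 := by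
  rw [grad, Q, map_add, potSum, map_sum]
  congr 1
  simp only [pderiv_aeval_X, S.pot_deriv, Finset.sum_ite_eq', Finset.mem_filter,
    Finset.mem_univ, true_and]

lemma totalDegree_pderiv_penalty_lt (I : Finset J) (l : Fin (k + 2)) :
    (pderiv l (MvPolynomial.X 1 * S.sig I)).totalDegree < S.e := by
  have h := (totalDegree_mul (MvPolynomial.X (R := ℝ) (1 : Fin (k + 2))) (S.sig I))
  rw [totalDegree_X] at h
  have h1 := totalDegree_sig_le (S := S) I
  have h2 := totalDegree_pderiv_le_pred l (MvPolynomial.X 1 * S.sig I)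
  have := S.e_eq
  omega

lemma leading (I : Finset J) : Leading (grad (S.Q I)) 2 S.e := by
  have he := S.e_eq
  have hd := S.one_le_d
  refine ⟨by omega, fun l hl => ?_⟩
  have h1 : grad (S.Q I) l - MvPolynomial.X l ^ S.e = pderiv l (MvPolynomial.X 1 * S.sig I) +
      Polynomial.aeval (MvPolynomial.X l) (gridPoly S.e - Polynomial.X ^ S.e) := by
    rw [grad_Q, if_pos hl]
    simp
    ring
  rw [h1]
  refine (totalDegree_add _ _).trans_lt (max_lt (totalDegree_pderiv_penalty_lt I l) ?_)
  exact (totalDegree_aeval_X_le _ _).trans_lt (gridPoly_sub_natDegree (by omega))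

lemma totalDegree_grad_le (I : Finset J) (l : Fin (k + 2)) :
    (grad (S.Q I) l).totalDegree ≤ S.e := by
  rw [grad_Q]
  refine (totalDegree_add _ _).trans (max_le (totalDegree_pderiv_penalty_lt I l).le ?_)
  split_ifs
  · exact (totalDegree_aeval_X_le _ _).trans (gridPoly_natDegree _).le
  · simp

/-- The degree bound for the elimination data. -/
def degB (k e : ℕ) : ℕ := 10000 * (e ^ (k + 2) * (e ^ (k + 2) * (1 + (k + 2) * e)))

lemma exists_walk (I : Finset J) [Finite J] :
    ∃ W : Walk (k + 2) 2 (degB k S.e) {j : J // j ∉ I}, W.Q = S.Q I ∧ (∀ j, W.h j = S.obst j) ∧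
      ∀ m, 2 ≤ m → GridNS (S.Q I) (fun j : {j : J // j ∉ I} => S.obst j) 2 S.e m (W.V m) := by
  have he : 1 ≤ S.e := by have := S.e_eq; omega
  have h1 : 1 ≤ S.e ^ (k + 2) := Nat.one_le_pow _ _ he
  have h2 : 1 + (k + 2) * S.e ≤ S.e ^ (k + 2) * (1 + (k + 2) * S.e) := Nat.le_mul_of_pos_left _ h1
  have h3 : S.e ^ (k + 2) * (1 + (k + 2) * S.e) ≤
      S.e ^ (k + 2) * (S.e ^ (k + 2) * (1 + (k + 2) * S.e)) := Nat.mul_le_mul_left _ h2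
  have h4 : S.e ≤ (k + 2) * S.e := Nat.le_mul_of_pos_left _ (by omega)
  have h5 : S.e ^ (k + 2) * ((k + 2) * S.e + S.e + (k + 2) * S.e) ≤
      S.e ^ (k + 2) * (10000 * (1 + (k + 2) * S.e)) := Nat.mul_le_mul_left _ (by omega)
  have h6 : S.e ^ (k + 2) * ((k + 2) * S.e + S.e + (k + 2) * S.e) ≤ degB k S.e := by
    unfold degB
    nlinarith
  obtain ⟨W, hQ, hh, hV⟩ := SemialgComp.exists_walk
    (h := fun j : {j : J // j ∉ I} => S.obst j) (D := S.e) (B := degB k S.e) (leading (S := S) I)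
    (totalDegree_grad_le I) (fun j => (totalDegree_obst_le _).trans (by have := S.e_eq; omega))
    (by unfold degB; nlinarith) (by unfold degB; nlinarith) h6 (by unfold degB elimDeg; nlinarith)
  exact ⟨W, hQ, fun j => by rw [hh], hV⟩

end Sys

end SemialgComp

namespace SemialgComp

open Filter Topology

variable {k : ℕ} {J : Type}

lemma eventually_eval_ne_zero {p : Polynomial ℝ} (hp : p ≠ 0) :
    (∀ᶠ t in 𝓝[>] (0 : ℝ), p.eval t ≠ 0) ∧ ∀ᶠ t in atTop, p.eval t ≠ 0 := by
  refine ⟨?_, (Polynomial.eventually_atTop_not_isRoot p hp).mono fun t ht => ht⟩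
  have hf : ((p.roots.toFinset : Set ℝ) \ {0}).Finite := p.roots.toFinset.finite_toSet.subset sdiff_subset
  have h : ((p.roots.toFinset : Set ℝ) \ {0})ᶜ ∈ 𝓝 (0 : ℝ) :=
    hf.isClosed.isOpen_compl.mem_nhds (by simp)
  filter_upwards [mem_nhdsWithin_of_mem_nhds h, self_mem_nhdsWithin] with t h1 h2 h3
  refine h1 ⟨?_, (ne_of_gt h2)⟩
  simp [hp, h3]

lemma exists_polynomial_curve {ι : Type} (c : ι → Polynomial ℝ) (q : MvPolynomial ι ℝ) :
    ∃ p : Polynomial ℝ, ∀ t, p.eval t = eval (fun i => (c i).eval t) q := by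
  refine ⟨aeval c q, fun t => ?_⟩
  induction q using MvPolynomial.induction_on with
  | C a => simp
  | add p q hp hq => simp [hp, hq]
  | mul_X p i hp => simp [hp]

lemma exists_polynomial_theta (ε : ℝ) (x : Fin k → ℝ) (q : MvPolynomial (Fin (k + 2)) ℝ) :
    ∃ p : Polynomial ℝ, ∀ t, p.eval t = eval (pt ε t x) q := by
  obtain ⟨p, hp⟩ := exists_polynomial_curve (Fin.cons (Polynomial.C ε)
    (Fin.cons Polynomial.X (fun i => Polynomial.C (x i)) : Fin (k + 1) → Polynomial ℝ)) q
  refine ⟨p, fun t => (hp t).trans ?_⟩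
  congr 2
  funext l
  by_cases hl : (l : ℕ) < 2
  · rcases lt_two_iff.1 hl with rfl | rfl
    · exact Polynomial.eval_C
    · exact Polynomial.eval_X
  · obtain ⟨i, rfl⟩ := exists_succ_succ (not_lt.1 hl)
    exact Polynomial.eval_C

namespace Sys

variable {S : Sys k J}

lemma jacMat_det_ne_zero (I : Finset J) {m : ℕ} (hm : 2 ≤ m) {z : Fin (k + 2) → ℝ}
    (h1 : z 1 = 0) (hz : ∀ l : Fin (k + 2), m ≤ l → (gridPoly S.e).derivative.eval (z l) ≠ 0) :
    (jacMat (S.Q I) m z).det ≠ 0 := by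
  have key : ∀ l l' : Fin (k + 2), m ≤ (l : ℕ) → l' ≠ 1 → eval z (pderiv l' (pderiv l (S.Q I))) =
      if l = l' then (gridPoly S.e).derivative.eval (z l) else 0 := by
    intro l l' hl hl'
    have hl1 : l ≠ 1 := by
      rintro rfl
      simp at hl
      omega
    have e1 : pderiv l (MvPolynomial.X 1 * S.sig I) = MvPolynomial.X 1 * pderiv l (S.sig I) := by
      rw [Derivation.leibniz, pderiv_X_of_ne hl1.symm]
      simp
    have e2 := grad_Q (S := S) I l
    rw [grad, e1, if_pos (hm.trans hl)] at e2
    rw [e2, map_add, Derivation.leibniz, pderiv_X_of_ne hl'.symm, pderiv_aeval_X]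
    split_ifs with h
    · simp [h1, eval_aeval_X]
    · simp [h1]
  have htri : (jacMat (S.Q I) m z).BlockTriangular OrderDual.toDual := by
    intro l l' hll'
    have hlt : l < l' := hll'
    simp only [jacMat, Matrix.of_apply]
    split_ifs with h1 h2 <;> try rfl
    · exact absurd h2 hlt.ne
    · have hl2 : l' ≠ 1 := by
        rintro rfl
        have : (l : ℕ) < 1 := hlt
        omega
      rw [key l l' (not_lt.1 h1) hl2, if_neg hlt.ne]
  rw [Matrix.det_of_lowerTriangular _ htri, Finset.prod_ne_zero_iff]
  intro l _
  simp only [jacMat, Matrix.of_apply]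
  split_ifs with h
  · exact one_ne_zero
  · have hl1 : l ≠ 1 := by
      rintro rfl
      simp at h
      omega
    rw [key l l (not_lt.1 h) hl1, if_pos rfl]
    exact hz l (not_lt.1 h)

lemma eval_grad_of_theta_zero (I : Finset J) {l : Fin (k + 2)} (hl : 2 ≤ (l : ℕ))
    {z : Fin (k + 2) → ℝ} (h1 : z 1 = 0) :
    eval z (grad (S.Q I) l) = (gridPoly S.e).eval (z l) := by
  have hl1 : l ≠ 1 := by
    rintro rfl
    simp at hl
  rw [grad_Q, if_pos hl, Derivation.leibniz, pderiv_X_of_ne hl1.symm]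
  simp [h1, eval_aeval_X]

lemma gridNS_eventually [Finite J] (I : Finset J) {m : ℕ} (hm : 2 ≤ m)
    {V : Set (MvPolynomial (Fin (k + 2)) ℝ)}
    (hV : GridNS (S.Q I) (fun j : {j : J // j ∉ I} => S.obst j) 2 S.e m V) :
    ∀ᶠ ε in 𝓝[>] (0 : ℝ), ∀ δ ∈ V, eval (pt ε 0 (fun _ => 1 / 2)) δ ≠ 0 := by
  have hz0 : ∀ (ε : ℝ) (b : Idx (k + 2) m S.e),
      gridPt m S.e 0 (pt ε 0 (fun _ => 1 / 2)) b 0 = ε := fun ε b => by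
    have : ¬ m ≤ ((0 : Fin (k + 2)) : ℕ) := by simp; omega
    simp only [gridPt, dif_neg this]
    rfl
  have hz1 : ∀ (ε : ℝ) (b : Idx (k + 2) m S.e),
      gridPt m S.e 0 (pt ε 0 (fun _ => 1 / 2)) b 1 = 0 := fun ε b => by
    have : ¬ m ≤ ((1 : Fin (k + 2)) : ℕ) := by simp; omega
    simp only [gridPt, dif_neg this]
    rfl
  have hx : ∀ (ε : ℝ) (b : Idx (k + 2) m S.e) (i : Fin k),
      gridPt m S.e 0 (pt ε 0 (fun _ => 1 / 2)) b i.succ.succ =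
        gridPt m S.e 0 (pt 0 0 (fun _ => 1 / 2)) b i.succ.succ := fun ε b i => by
    simp only [gridPt]
    rfl
  have hobst : ∀ᶠ ε in 𝓝[>] (0 : ℝ), ∀ (b : Idx (k + 2) m S.e) (j : J),
      eval (gridPt m S.e 0 (pt ε 0 (fun _ => 1 / 2)) b) (S.obst j) ≠ 0 := by
    rw [eventually_all]
    intro b
    rw [eventually_all]
    intro j
    let a := eval (fun i : Fin k => gridPt m S.e 0 (pt 0 0 (fun _ => 1 / 2)) b i.succ.succ) (S.P j)
    have hp : (Polynomial.C a - Polynomial.C (S.g j) * Polynomial.X : Polynomial ℝ) ≠ 0 := by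
      intro h
      have := congrArg (fun p => Polynomial.coeff p 1) h
      simp [Polynomial.coeff_C] at this
      exact (S.g_pos j).ne' this
    refine (eventually_eval_ne_zero hp).1.mono fun ε hε => ?_
    simp only [obst, map_sub, map_mul, eval_C, eval_X, eval_lift2, hz0, hx]
    simpa [a] using hε
  filter_upwards [hobst] with ε hε
  refine hV 0 _ fun b => ⟨fun l hl => ?_, ?_, fun j => hε b j, fun i hi hi2 => ?_⟩
  · rw [eval_grad_of_theta_zero I (hm.trans hl) (hz1 ε b)]
    simp only [gridPt, dif_pos hl, sub_zero]
    exact gridPoly_root (b _).2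
  · refine jacMat_det_ne_zero I hm (hz1 ε b) fun l hl => ?_
    simp only [gridPt, dif_pos hl, sub_zero]
    exact gridPoly_derivative_ne (b _).2
  · rw [eval_grad_of_theta_zero I hi2 (hz1 ε b)]
    have : ¬ m ≤ (i : ℕ) := by omega
    simp only [gridPt, dif_neg this]
    obtain ⟨i, rfl⟩ := exists_succ_succ hi2
    exact gridPoly_half_ne _

lemma good_eventually [Finite J] (I : Finset J) {B : ℕ} {W : Walk (k + 2) 2 B {j : J // j ∉ I}}
    (hV : ∀ m, 2 ≤ m →
      GridNS (S.Q I) (fun j : {j : J // j ∉ I} => S.obst j) 2 S.e m (W.V m)) :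
    ∀ᶠ ε in 𝓝[>] (0 : ℝ), ∀ᶠ θ in atTop, ∀ x, W.Good 2 (pt ε θ x) := by
  have h1 : ∀ᶠ ε in 𝓝[>] (0 : ℝ), ∀ m ∈ Set.Icc 2 (k + 2), ∀ δ ∈ W.V m,
      eval (pt ε 0 (fun _ => 1 / 2)) δ ≠ 0 := by
    rw [eventually_all_finite (Set.finite_Icc _ _)]
    exact fun m hm => gridNS_eventually I hm.1 (hV m hm.1)
  filter_upwards [h1] with ε hε
  have h2 : ∀ᶠ θ in atTop, ∀ m ∈ Set.Icc 2 (k + 2), ∀ δ ∈ W.V m,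
      eval (pt ε θ (fun _ => 1 / 2)) δ ≠ 0 := by
    rw [eventually_all_finite (Set.finite_Icc _ _)]
    intro m hm
    rw [eventually_all_finite (W.V_finDeg m hm.1).1]
    intro δ hδ
    obtain ⟨p, hp⟩ := exists_polynomial_theta ε (fun _ : Fin k => 1 / 2) δ
    simp only [← hp]
    refine (eventually_eval_ne_zero fun h0 => ?_).2
    refine hε m hm δ hδ ?_
    rw [← hp, h0, Polynomial.eval_zero]
  filter_upwards [h2] with θ hθ x
  exact ⟨pt ε θ (fun _ => 1 / 2), agreeLT_two_iff.2 ⟨rfl, rfl⟩, fun m hm hm2 => hθ m ⟨hm, hm2⟩⟩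

end Sys

end SemialgComp

namespace SemialgComp

open Filter Topology

variable {k : ℕ} {J : Type}

namespace Sys

variable (S : Sys k J)

/-- The potential of a point. -/
noncomputable def pen (x : Fin k → ℝ) : ℝ := ∑ i, S.pot.eval (x i)

/-- The region in which the walks take place. -/
def core (ε θ β : ℝ) : Set (Fin k → ℝ) :=
  {x | S.pen x ≤ β ∧ θ * eval x S.P0 ≤ β ∧ ∀ j, ε * S.g j / 2 ≤ eval x (S.P j)}

/-- Two points can be joined inside the region. -/
def Joined (ε θ β : ℝ) (a a' : Fin k → ℝ) : Prop :=
  ∃ T : Set (Fin k → ℝ), IsPreconnected T ∧ T ⊆ S.core ε θ β ∧ a ∈ T ∧ a' ∈ T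

variable {S}

lemma eval_potSum_pt (ε θ : ℝ) (x : Fin k → ℝ) :
    eval (pt ε θ x) (potSum k S.pot) = S.pen x := by
  rw [eval_potSum, Finset.sum_filter, Fin.sum_univ_succ, Fin.sum_univ_succ, pen]
  simp

lemma pen_nonneg (x : Fin k → ℝ) : 0 ≤ S.pen x := Finset.sum_nonneg fun _ _ => S.pot_nonneg _

lemma pen_coercive (c : ℝ) : ∃ R : ℝ, ∀ x : Fin k → ℝ, S.pen x ≤ c → ∀ i, |x i| ≤ R := by
  obtain ⟨R, hR⟩ := S.pot_coercive c
  refine ⟨R, fun x hx i => hR _ (le_trans ?_ hx)⟩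
  exact Finset.single_le_sum (f := fun i => S.pot.eval (x i)) (fun _ _ => S.pot_nonneg _)
    (Finset.mem_univ i)

lemma continuous_pen : Continuous S.pen :=
  continuous_finsetSum _ fun i _ => S.pot.continuous.comp (continuous_apply i)

lemma sig_nonneg (ε θ : ℝ) (x : Fin k → ℝ) (I : Finset J) : 0 ≤ eval (pt ε θ x) (S.sig I) := by
  rw [eval_sig]
  exact add_nonneg (S.P0_nonneg x) (Finset.sum_nonneg fun _ _ => sq_nonneg _)

lemma pen_le_Q {ε θ : ℝ} (hθ : 0 ≤ θ) (x : Fin k → ℝ) (I : Finset J) :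
    S.pen x ≤ eval (pt ε θ x) (S.Q I) := by
  rw [eval_Q, eval_potSum_pt]
  exact le_add_of_nonneg_left (mul_nonneg hθ (sig_nonneg _ _ _ _))

lemma sig_le_Q (ε θ : ℝ) (x : Fin k → ℝ) (I : Finset J) :
    θ * eval (pt ε θ x) (S.sig I) ≤ eval (pt ε θ x) (S.Q I) := by
  rw [eval_Q, eval_potSum_pt]
  exact le_add_of_nonneg_right (pen_nonneg x)

lemma Q_insert [DecidableEq J] {ε θ : ℝ} {x : Fin k → ℝ} {I : Finset J} {j : J} (hj : j ∉ I) :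
    eval (pt ε θ x) (S.Q (insert j I)) =
      eval (pt ε θ x) (S.Q I) + θ * eval (pt ε θ x) (S.obst j) ^ 2 := by
  rw [eval_Q, eval_Q, eval_sig, eval_sig, Finset.sum_insert hj, eval_obst]
  ring

lemma Joined.trans {ε θ β : ℝ} {a b c : Fin k → ℝ} (h : S.Joined ε θ β a b)
    (h' : S.Joined ε θ β b c) : S.Joined ε θ β a c := by
  obtain ⟨T, h1, h2, h3, h4⟩ := h
  obtain ⟨T', h1', h2', h3', h4'⟩ := h'
  exact ⟨T ∪ T', h1.union b h4 h3' h1', union_subset h2 h2', Or.inl h3, Or.inr h4'⟩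

lemma Joined.symm {ε θ β : ℝ} {a b : Fin k → ℝ} (h : S.Joined ε θ β a b) : S.Joined ε θ β b a := by
  obtain ⟨T, h1, h2, h3, h4⟩ := h
  exact ⟨T, h1, h2, h4, h3⟩

variable {B : ℕ} {W : ∀ I : Finset J, Walk (k + 2) 2 B {j : J // j ∉ I}}

variable (S W) in
/-- Parameters for which the walks behave well. -/
structure GoodPar (ε θ β : ℝ) : Prop where
  ε_pos : 0 < ε
  one_le_θ : 1 ≤ θ
  good : ∀ I x, (W I).Good 2 (pt ε θ x)
  close : ∀ i, 4 * β ≤ θ * (ε * S.g i) ^ 2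
  full : ∀ I : Finset J, I.card = k + 1 → ∀ x, β < eval (pt ε θ x) (S.Q I)

lemma joined_of_conn (hQ : ∀ I, (W I).Q = S.Q I) (hh : ∀ I j, (W I).h j = S.obst j)
    {ε θ β c : ℝ} (hp : S.GoodPar W ε θ β) (hc : c ≤ β) {I : Finset J} {a : Fin k → ℝ}
    {p : Fin (k + 2) → ℝ} (h : (W I).Conn 2 (pt ε θ a) p c) :
    S.Joined ε θ β a (fun i => p i.succ.succ) := by
  have hθ : 0 < θ := zero_lt_one.trans_le hp.one_le_θ
  obtain ⟨T, h1, h2, h3, h4⟩ := h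
  refine ⟨(fun y : Fin (k + 2) → ℝ => fun i : Fin k => y i.succ.succ) '' T,
    h1.image _ (by fun_prop), ?_, ⟨_, h2, rfl⟩, ⟨_, h3, rfl⟩⟩
  rintro _ ⟨y, hy, rfl⟩
  obtain ⟨k1, k2, k3⟩ := h4 y hy
  have hy' := eq_pt_of_agree k1
  set x : Fin k → ℝ := fun i => y i.succ.succ with hx
  rw [hy'] at k2 k3
  rw [hQ] at k3
  have k4 : θ * eval (pt ε θ x) (S.sig I) ≤ β := (sig_le_Q ε θ x I).trans (k3.le.trans hc)
  have k5 : 0 ≤ ∑ i ∈ I, (eval x (S.P i) - ε * S.g i) ^ 2 := Finset.sum_nonneg fun _ _ => sq_nonneg _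
  refine ⟨(pen_le_Q hθ.le x I).trans (k3.le.trans hc), ?_, fun j => ?_⟩
  · refine le_trans (mul_le_mul_of_nonneg_left ?_ hθ.le) k4
    rw [eval_sig]
    linarith
  · have hg := mul_pos hp.ε_pos (S.g_pos j)
    by_cases hj : j ∈ I
    · have k6 : (eval x (S.P j) - ε * S.g j) ^ 2 ≤ eval (pt ε θ x) (S.sig I) := by
        rw [eval_sig]
        have := Finset.single_le_sum (f := fun i => (eval x (S.P i) - ε * S.g i) ^ 2)
          (fun _ _ => sq_nonneg _) hj
        have := S.P0_nonneg x
        linarith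
      have k7 : θ * (4 * (eval x (S.P j) - ε * S.g j) ^ 2) ≤ θ * (ε * S.g j) ^ 2 := by
        have := hp.close j
        have := mul_le_mul_of_nonneg_left k6 hθ.le
        linarith
      have k8 := le_of_mul_le_mul_left k7 hθ
      have k9 : |2 * (eval x (S.P j) - ε * S.g j)| ≤ ε * S.g j :=
        abs_le_of_sq_le_sq (by rw [mul_pow]; linarith) hg.le
      have := (abs_le.1 k9).1
      linarith
    · have := k2 ⟨j, hj⟩
      rw [hh, eval_obst] at this
      linarith

lemma coer (hQ : ∀ I, (W I).Q = S.Q I) {ε θ : ℝ} (hθ : 0 ≤ θ) (I : Finset J) (a : Fin k → ℝ) :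
    (W I).Coer (pt ε θ a) := by
  constructor
  · intro c
    obtain ⟨R, hR⟩ := S.pen_coercive c
    refine ⟨max R (max |ε| |θ|), fun y hy hc l => ?_⟩
    rw [eq_pt_of_agree hy, hQ] at hc
    have h1 := hR _ ((pen_le_Q hθ _ I).trans hc)
    obtain ⟨h2, h3⟩ := agreeLT_two_iff.1 hy
    by_cases hl : (l : ℕ) < 2
    · rcases lt_two_iff.1 hl with rfl | rfl
      · rw [h2, pt_zero]
        exact (le_max_left _ _).trans (le_max_right _ _)
      · rw [h3, pt_one]
        exact (le_max_right _ _).trans (le_max_right _ _)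
    · obtain ⟨i, rfl⟩ := exists_succ_succ (not_lt.1 hl)
      exact (h1 i).trans (le_max_left _ _)
  · refine ⟨0, fun y hy => ?_⟩
    rw [eq_pt_of_agree hy, hQ]
    exact (pen_nonneg _).trans (pen_le_Q hθ _ I)

/-- Points with the same signs on suitable polynomials can be joined. -/
lemma stage [Finite J] (hB : 1 ≤ B) (hQ : ∀ I, (W I).Q = S.Q I)
    (hh : ∀ I j, (W I).h j = S.obst j) (t : ℕ) : ∀ I : Finset J, I.card + t = k + 1 →
    ∃ F : Set (MvPolynomial (Fin (k + 2)) ℝ), FinDeg (((B ^ 41) ^ k) ^ t * B ^ 6) F ∧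
      ∀ ε θ β, S.GoodPar W ε θ β → ∀ a a', SameSign F (pt ε θ a) (pt ε θ a') →
        (W I).Pos (pt ε θ a) → (W I).Pos (pt ε θ a') →
        eval (pt ε θ a) (S.Q I) ≤ β - 2 * t → eval (pt ε θ a') (S.Q I) ≤ β - 2 * t →
        S.Joined ε θ β a a' := by
  classical
  induction t with
  | zero =>
    intro I hI
    refine ⟨∅, ⟨finite_empty, by simp⟩, fun ε θ β hp a a' _ _ _ h _ => ?_⟩
    have := hp.full I hI a
    simp at h
    linarith
  | succ t ih =>
    intro I hI
    choose Fj hFj1 hFj2 using fun j : {j : J // j ∉ I} => ih (insert j.1 I)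
      (by rw [Finset.card_insert_of_notMem j.2]; omega)
    have hψ : ∀ o : Option (Fin (k + 2)), PolyFn 1 (fun w : Fin (k + 2) → ℝ => ext w 0 o) := by
      rintro (_ | l)
      · exact PolyFn.const 1 0
      · exact PolyFn.coord le_rfl l
    obtain ⟨Fb, hFb1, hFb2⟩ := (Walk.decided_below (W := W I) le_rfl).comp_polyFn hψ
    have hD : 1 ≤ ((B ^ 41) ^ k) ^ t := Nat.one_le_pow _ _ (by positivity)
    obtain ⟨F, hF1, hF2⟩ := Walk.claim_base (W I) (by omega) (((B ^ 41) ^ k) ^ t * B ^ 6)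
      (Nat.one_le_iff_ne_zero.2 (by positivity)) (Fb ∪ ⋃ j, Fj j)
      ((hFb1.mono (by rw [mul_one]; exact Nat.le_mul_of_pos_left _ hD)).union (FinDeg.iUnion hFj1))
    refine ⟨F, by rw [pow_succ', mul_assoc]; exact hF1, fun ε θ β hp a a' hs ha ha' hq hq' => ?_⟩
    have hθ1 := hp.one_le_θ
    have hθ : 0 < θ := zero_lt_one.trans_le hθ1
    have hτ : θ⁻¹ ≤ 1 := inv_le_one_of_one_le₀ hθ1
    have ht : (0 : ℝ) ≤ t := Nat.cast_nonneg t
    push_cast at hq hq'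
    rcases hF2 _ _ hs (hp.good I a) (hp.good I a') ha ha' (coer hQ hθ.le I a) (coer hQ hθ.le I a')
      θ⁻¹ (inv_pos.2 hθ) with ⟨p, p', h1, h2, h3, j, h4, h5⟩ | ⟨p, p', h1, h2, h3, h4, h5⟩
    · rw [hQ] at h2 h3
      have k2 := joined_of_conn hQ hh hp (by linarith) h2
      have k3 := joined_of_conn hQ hh hp (by linarith) h3
      have aux : ∀ (b : Fin k → ℝ) (q : Fin (k + 2) → ℝ) (c : ℝ), c ≤ β - 2 * t - 2 + 1 →
          (W I).Conn 2 (pt ε θ b) q c → eval q ((W I).h j) < θ⁻¹ →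
          ∃ y : Fin k → ℝ, y = (fun i => q i.succ.succ) ∧ q = pt ε θ y ∧
            (W (insert j.1 I)).Pos (pt ε θ y) ∧
            eval (pt ε θ y) (S.Q (insert j.1 I)) ≤ β - 2 * t := by
        intro b q c hc hconn hlt
        refine ⟨_, rfl, eq_pt_of_agree hconn.agree, ?_⟩
        have l1 := hconn.lt
        have l2 := hconn.pos
        rw [← eq_pt_of_agree hconn.agree]
        constructor
        · intro i
          have := l2 ⟨i.1, fun h => i.2 (Finset.mem_insert_of_mem h)⟩
          rwa [hh] at this ⊢
        · have l3 := l2 j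
          rw [hh] at l3 hlt
          rw [hQ] at l1
          have l4 : θ * eval q (S.obst j.1) ^ 2 ≤ 1 := by
            have m1 : θ * eval q (S.obst j.1) ≤ 1 := by
              have := mul_le_mul_of_nonneg_left hlt.le hθ.le
              rwa [mul_inv_cancel₀ hθ.ne'] at this
            have m2 : eval q (S.obst j.1) ≤ 1 := hlt.le.trans hτ
            nlinarith
          have l5 := eq_pt_of_agree hconn.agree
          rw [l5] at l1 l4 ⊢
          rw [Q_insert j.2]
          linarith
      obtain ⟨y, hy1, hy2, hy3, hy4⟩ := aux a p _ (by linarith) h2 h4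
      obtain ⟨y', hy1', hy2', hy3', hy4'⟩ := aux a' p' _ (by linarith) h3 h5
      rw [← hy1] at k2
      rw [← hy1'] at k3
      rw [hy2, hy2'] at h1
      exact k2.trans ((hFj2 j ε θ β hp y y' (h1.mono ((subset_iUnion Fj j).trans subset_union_right))
        hy3 hy3' hy4 hy4').trans k3.symm)
    · rw [hQ] at h2 h3
      have k2 := joined_of_conn hQ hh hp (by linarith) h2
      have k3 := joined_of_conn hQ hh hp (by linarith) h3
      have hag : AgreeLT 2 p' p := by
        refine h3.agree.trans (AgreeLT.trans ?_ h2.agree.symm)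
        exact agreeLT_two_iff.2 ⟨rfl, rfl⟩
      have hN : (W I).NS 2 p :=
        ((hp.good I a).ns le_rfl (by omega)).congr le_rfl h2.agree.symm
      have hidx := hFb2 p p' (h1.mono subset_union_left)
      change (W I).below _ p 0 = (W I).below _ p' 0 at hidx
      simp only [Walk.below, sub_zero] at hidx
      have hsl : slice ((W I).χ 2) p' = slice ((W I).χ 2) p :=
        (W I).χ_base 2 le_rfl _ _ hag
      have hpp : p' = p := by
        refine Walk.crit_unique le_rfl hN h4 h5 hag ?_
        have r1 := (Polynomial.mem_roots ((W I).χ_ne _ le_rfl p)).2 ((W I).crit_root _ le_rfl p h4)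
        have r2 := (Polynomial.mem_roots ((W I).χ_ne _ le_rfl p')).2 ((W I).crit_root _ le_rfl p' h5)
        exact IsRootIdx.unique (i := _) ⟨by rwa [hsl] at r2, by rw [hsl] at hidx; exact hidx.symm⟩ ⟨r1, rfl⟩
      rw [hpp] at k3
      exact k2.trans k3.symm

end Sys

end SemialgComp

namespace SemialgComp

open Filter Topology

/-- Points joined in all members of a decreasing sequence of compact sets are joined in the
intersection. -/
lemma mem_component_iInter {X : Type} [TopologicalSpace X] [T2Space X] {K : ℕ → Set X}
    (hK : Antitone K) (hc : ∀ n, IsCompact (K n)) {a a' : X}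
    (h : ∀ᶠ n in atTop, ∃ T, IsPreconnected T ∧ T ⊆ K n ∧ a ∈ T ∧ a' ∈ T) :
    a' ∈ connectedComponentIn (⋂ n, K n) a := by
  have hmem : ∀ b, (∀ᶠ n in atTop, b ∈ K n) → b ∈ ⋂ n, K n := by
    intro b hb
    refine mem_iInter.2 fun n => ?_
    obtain ⟨m, hm, hnm⟩ := (hb.and (eventually_ge_atTop n)).exists
    exact hK hnm hm
  have ha : a ∈ ⋂ n, K n := hmem a (h.mono fun n ⟨T, _, h2, h3, _⟩ => h2 h3)
  have ha' : a' ∈ ⋂ n, K n := hmem a' (h.mono fun n ⟨T, _, h2, _, h3⟩ => h2 h3)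
  have hKc : IsCompact (⋂ n, K n) := (hc 0).of_isClosed_subset
    (isClosed_iInter fun n => (hc n).isClosed) (iInter_subset K 0)
  have := isCompact_iff_compactSpace.1 hKc
  rw [connectedComponentIn_eq_image ha]
  refine ⟨⟨a', ha'⟩, ?_, rfl⟩
  rw [connectedComponent_eq_iInter_isClopen, mem_iInter]
  rintro ⟨U, hU, haU⟩
  by_contra haU'
  obtain ⟨u, v, hu, hv, hUu, hVv, huv⟩ := SeparatedNhds.of_isCompact_isCompact
    (hU.isClosed.isCompact.image continuous_subtype_val)
    (hU.compl.isClosed.isCompact.image continuous_subtype_val)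
    ((disjoint_image_iff Subtype.val_injective).2 disjoint_compl_right)
  obtain ⟨n₀, hn₀⟩ := exists_subset_nhds_of_isCompact (U := u ∪ v) hK.directed_ge hc (by
    intro x hx
    refine (hu.union hv).mem_nhds ?_
    by_cases hxU : (⟨x, hx⟩ : (⋂ n, K n : Set X)) ∈ U
    · exact Or.inl (hUu ⟨_, hxU, rfl⟩)
    · exact Or.inr (hVv ⟨_, hxU, rfl⟩))
  obtain ⟨n, ⟨T, h1, h2, h3, h4⟩, hn⟩ := (h.and (eventually_ge_atTop n₀)).exists
  have h5 : a ∈ u := hUu ⟨_, haU, rfl⟩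
  have h6 : a' ∈ v := hVv ⟨_, haU', rfl⟩
  rcases h1.subset_or_subset hu hv huv ((h2.trans (hK hn)).trans hn₀) with h7 | h7
  · exact disjoint_left.1 huv (h7 h4) h6
  · exact disjoint_left.1 huv h5 (h7 h3)

variable {k : ℕ} {J : Type}

/-- `g` is generic for `P`: any `k + 1` of the polynomials are related by an equation that `g`
does not satisfy. -/
def Generic (P : J → MvPolynomial (Fin k) ℝ) (g : J → ℝ) : Prop :=
  ∀ I : Finset J, I.card = k + 1 → ∃ R : MvPolynomial I ℝ,
    aeval (fun i : I => P i) R = 0 ∧ eval (fun i : I => g i) R ≠ 0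

lemma exists_generic [Finite J] (P : J → MvPolynomial (Fin k) ℝ) :
    ∃ g : J → ℝ, (∀ j, 0 < g j) ∧ Generic P g := by
  classical
  have := Fintype.ofFinite J
  have h1 : ∀ I : {I : Finset J // I.card = k + 1}, ∃ R : MvPolynomial I.1 ℝ,
      aeval (fun i : I.1 => P i) R = 0 ∧ R ≠ 0 := by
    rintro ⟨I, hI⟩
    by_contra! hcon
    have hind : AlgebraicIndependent ℝ (fun i : I => P i) := algebraicIndependent_iff.2 hcon
    have h2 := hind.lift_cardinalMk_le_trdeg
    rw [MvPolynomial.trdeg_of_isDomain] at h2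
    simp [hI] at h2
  choose R hR1 hR2 using h1
  have h3 : (∏ I, rename (fun i : {j : J // j ∈ I.1} => i.1) (R I) : MvPolynomial J ℝ) ≠ 0 := by
    refine Finset.prod_ne_zero_iff.2 fun I _ h => hR2 I ?_
    exact rename_injective _ Subtype.val_injective (by rw [h, map_zero])
  obtain ⟨g, hg1, hg2⟩ : ∃ g ∈ Set.pi univ (fun _ : J => Ioi (0 : ℝ)),
      eval g (∏ I, rename (fun i : {j : J // j ∈ I.1} => i.1) (R I)) ≠ 0 := by
    by_contra! hcon
    refine h3 (funext_set (fun _ : J => Ioi (0 : ℝ)) (fun _ => Ioi_infinite 0) fun x hx => ?_)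
    rw [hcon x hx, map_zero]
  refine ⟨g, fun j => hg1 j trivial, fun I hI => ⟨R ⟨I, hI⟩, hR1 _, ?_⟩⟩
  rw [map_prod] at hg2
  have := Finset.prod_ne_zero_iff.1 hg2 ⟨I, hI⟩ (Finset.mem_univ _)
  rwa [eval_rename] at this

lemma Generic.eventually [Finite J] {P : J → MvPolynomial (Fin k) ℝ} {g : J → ℝ}
    (h : Generic P g) : ∀ᶠ ε in 𝓝[>] (0 : ℝ), ∀ I : Finset J, I.card = k + 1 →
      ∀ x : Fin k → ℝ, ∃ i ∈ I, eval x (P i) ≠ ε * g i := by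
  rw [eventually_all]
  intro I
  by_cases hI : I.card = k + 1
  swap
  · exact Eventually.of_forall fun _ h => absurd h hI
  obtain ⟨R, hR1, hR2⟩ := h I hI
  obtain ⟨p, hp⟩ := exists_polynomial_curve
    (fun i : I => Polynomial.X * Polynomial.C (g i)) R
  have hp0 : p ≠ 0 := by
    rintro rfl
    have := hp 1
    simp at this
    exact hR2 this.symm
  filter_upwards [(eventually_eval_ne_zero hp0).1] with ε hε _ x
  by_contra! hcon
  refine hε ?_
  rw [hp]
  simp only [Polynomial.eval_mul, Polynomial.eval_X, Polynomial.eval_C]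
  have h1 : (fun i : I => ε * g i) = fun i : I => eval x (P i) := by
    funext i
    exact (hcon i i.2).symm
  rw [h1]
  have h2 := congrArg (eval x) hR1
  rw [map_zero] at h2
  rw [← h2]
  have h3 : ((aeval x : MvPolynomial (Fin k) ℝ →ₐ[ℝ] ℝ).comp (aeval fun i : I => P i)) R =
      aeval (fun i : I => eval x (P i)) R := by
    rw [comp_aeval]
    rfl
  rw [AlgHom.comp_apply] at h3
  exact h3.symm

namespace Sys

variable {S : Sys k J}

lemma isCompact_pen_le (c : ℝ) : IsCompact {x | S.pen x ≤ c} := by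
  obtain ⟨R, hR⟩ := S.pen_coercive c
  refine (isCompact_univ_pi fun _ : Fin k => isCompact_Icc (a := -R) (b := R)).of_isClosed_subset
    (isClosed_le S.continuous_pen continuous_const) fun x hx i _ => ?_
  exact abs_le.1 (hR x hx i)

lemma isCompact_core (ε θ β : ℝ) : IsCompact (S.core ε θ β) := by
  have h : S.core ε θ β = {x | S.pen x ≤ β} ∩ ({x | θ * eval x S.P0 ≤ β} ∩
      ⋂ j, {x | ε * S.g j / 2 ≤ eval x (S.P j)}) := by
    ext x
    simp [core]
  rw [h]
  refine (isCompact_pen_le β).inter_right (IsClosed.inter ?_ (isClosed_iInter fun j => ?_))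
  · exact isClosed_le (continuous_const.mul (SemialgComp.continuous_eval _)) continuous_const
  · exact isClosed_le continuous_const (SemialgComp.continuous_eval _)

variable {B : ℕ} {W : ∀ I : Finset J, Walk (k + 2) 2 B {j : J // j ∉ I}}

lemma goodPar_eventually [Finite J] (hg : Generic S.P S.g)
    (hV : ∀ I : Finset J, ∀ m, 2 ≤ m →
      GridNS (S.Q I) (fun j : {j : J // j ∉ I} => S.obst j) 2 S.e m ((W I).V m)) :
    ∀ᶠ ε in 𝓝[>] (0 : ℝ), ∀ β, ∀ᶠ θ in atTop, S.GoodPar W ε θ β := by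
  have h1 : ∀ᶠ ε in 𝓝[>] (0 : ℝ), ∀ I, ∀ᶠ θ in atTop, ∀ x, (W I).Good 2 (pt ε θ x) :=
    eventually_all.2 fun I => good_eventually I (hV I)
  filter_upwards [h1, hg.eventually, self_mem_nhdsWithin] with ε hε1 hε2 hε β
  have hε0 : (0 : ℝ) < ε := hε
  have h2 : ∀ᶠ θ in atTop, ∀ i, 4 * β ≤ θ * (ε * S.g i) ^ 2 := by
    refine eventually_all.2 fun i => ?_
    have := mul_pos hε0 (S.g_pos i)
    exact (tendsto_id.atTop_mul_const (by positivity)).eventually_ge_atTop _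
  have h3 : ∀ᶠ θ in atTop, ∀ I : Finset J, I.card = k + 1 → ∀ x, β < eval (pt ε θ x) (S.Q I) := by
    refine eventually_all.2 fun I => ?_
    by_cases hI : I.card = k + 1
    swap
    · exact Eventually.of_forall fun _ h => absurd h hI
    have hcont : Continuous fun x : Fin k → ℝ => ∑ i ∈ I, (eval x (S.P i) - ε * S.g i) ^ 2 :=
      continuous_finsetSum _ fun i _ =>
        ((SemialgComp.continuous_eval _).sub continuous_const).pow 2
    have hpos : ∀ x : Fin k → ℝ, 0 < ∑ i ∈ I, (eval x (S.P i) - ε * S.g i) ^ 2 := by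
      intro x
      obtain ⟨i, hi, hne⟩ := hε2 I hI x
      exact Finset.sum_pos' (fun _ _ => sq_nonneg _)
        ⟨i, hi, by have := sub_ne_zero.2 hne; positivity⟩
    obtain ⟨μ, hμ, hμ2⟩ : ∃ μ > 0, ∀ x, S.pen x ≤ β →
        μ ≤ ∑ i ∈ I, (eval x (S.P i) - ε * S.g i) ^ 2 := by
      rcases {x | S.pen x ≤ β}.eq_empty_or_nonempty with h0 | h0
      · refine ⟨1, one_pos, fun x hx => ?_⟩
        have : x ∈ {x | S.pen x ≤ β} := hx
        rw [h0] at this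
        exact this.elim
      · obtain ⟨x₀, -, hx₀⟩ := (isCompact_pen_le β).exists_isMinOn h0 hcont.continuousOn
        exact ⟨_, hpos x₀, fun x hx => hx₀ hx⟩
    filter_upwards [(tendsto_id.atTop_mul_const hμ).eventually_gt_atTop β, eventually_ge_atTop 0]
      with θ hθ hθ0 _ x
    by_cases hx : S.pen x ≤ β
    · refine lt_of_lt_of_le hθ (le_trans ?_ (sig_le_Q ε θ x I))
      refine mul_le_mul_of_nonneg_left ?_ hθ0
      rw [eval_sig]
      have := hμ2 x hx
      have := S.P0_nonneg x
      linarith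
    · exact (not_le.1 hx).trans_le (pen_le_Q hθ0 x I)
  filter_upwards [eventually_all.2 hε1, h2, h3, eventually_ge_atTop 1] with θ k1 k2 k3 k4
  exact ⟨hε0, k4, k1, k2, k3⟩

end Sys

end SemialgComp

namespace SemialgComp

open Filter Topology

variable {k : ℕ} {J : Type}

/-- The signs at `pt ε θ x` for `θ` large and `ε` small. -/
lemma exists_limit_signs {D : ℕ} {F : Set (MvPolynomial (Fin (k + 2)) ℝ)} (hF : FinDeg D F) :
    ∃ F' : Set (MvPolynomial (Fin k) ℝ), FinDeg D F' ∧ ∀ a a', SameSign F' a a' →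
      ∀ᶠ ε in 𝓝[>] (0 : ℝ), ∀ᶠ θ in atTop, SameSign F (pt ε θ a) (pt ε θ a') := by
  have hψ : ∀ l, PolyFn 1 (fun w : Option (Option (Fin k)) → ℝ =>
      pt (w (some none)) (w none) (fun i => w (some (some i))) l) := by
    intro l
    by_cases hl : (l : ℕ) < 2
    · rcases lt_two_iff.1 hl with rfl | rfl
      · exact PolyFn.coord le_rfl (some none)
      · exact PolyFn.coord le_rfl none
    · obtain ⟨i, rfl⟩ := exists_succ_succ (not_lt.1 hl)
      exact PolyFn.coord le_rfl (some (some i))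
  have h1 := (Decided.sameSign hF).comp_polyFn hψ
  rw [mul_one] at h1
  obtain ⟨Φ, h2, h3⟩ := h1.large
  obtain ⟨Ψ, h4, h5⟩ := h2.small
  obtain ⟨F', h6, h7⟩ := h4
  refine ⟨F', h6, fun a a' h => ?_⟩
  filter_upwards [h5 a, h5 a'] with ε k1 k2
  filter_upwards [h3 (ext a ε), h3 (ext a' ε)] with θ l1 l2
  intro f hf
  have := l1.trans (k1.trans ((h7 a a' h).trans (k2.symm.trans l2.symm)))
  exact congrFun this ⟨f, hf⟩

namespace Sys

variable {S : Sys k J}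

/-- The degree of the polynomials describing the components. -/
def degA (k e : ℕ) : ℕ := ((degB k e ^ 41) ^ k) ^ (k + 1) * degB k e ^ 6

lemma exists_component_signs [Finite J] (hg : Generic S.P S.g) :
    ∃ F : Set (MvPolynomial (Fin k) ℝ), FinDeg (degA k S.e) F ∧ ∀ a a', SameSign F a a' →
      eval a S.P0 = 0 → eval a' S.P0 = 0 → (∀ j, 0 < eval a (S.P j)) →
      (∀ j, 0 < eval a' (S.P j)) →
      a' ∈ connectedComponentIn {x | eval x S.P0 = 0 ∧ ∀ j, 0 < eval x (S.P j)} a := by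
  choose W hQ hh hV using fun I : Finset J => S.exists_walk I
  have hB : 1 ≤ degB k S.e := (W ∅).one_le_B
  obtain ⟨F, hF1, hF2⟩ := stage hB hQ hh (k + 1) ∅ (by simp)
  obtain ⟨F', hF3, hF4⟩ := exists_limit_signs hF1
  refine ⟨F', hF3, fun a a' hs ha ha' hp hp' => ?_⟩
  have hsmall : ∀ b : Fin k → ℝ, (∀ j, 0 < eval b (S.P j)) →
      ∀ᶠ ε in 𝓝[>] (0 : ℝ), ∀ j, ε * S.g j < eval b (S.P j) := by
    intro b hb
    refine eventually_all.2 fun j => ?_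
    have : Tendsto (fun ε : ℝ => ε * S.g j) (𝓝[>] 0) (𝓝 (0 * S.g j)) :=
      ((continuous_id.mul continuous_const).tendsto 0).mono_left nhdsWithin_le_nhds
    rw [zero_mul] at this
    exact this.eventually_lt_const (hb j)
  obtain ⟨ε, hε1, hε2, hε3, hε4, hε0⟩ := ((goodPar_eventually hg hV).and ((hF4 a a' hs).and
    ((hsmall a hp).and ((hsmall a' hp').and self_mem_nhdsWithin)))).exists
  have hε : (0 : ℝ) < ε := hε0
  have hpos : ∀ (b : Fin k → ℝ) (θ : ℝ), (∀ j, ε * S.g j < eval b (S.P j)) →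
      (W ∅).Pos (pt ε θ b) := by
    intro b θ hb j
    rw [hh, eval_obst]
    linarith [hb j.1]
  have hval : ∀ (b : Fin k → ℝ) (θ : ℝ), eval b S.P0 = 0 → eval (pt ε θ b) (S.Q ∅) = S.pen b := by
    intro b θ hb
    rw [eval_Q, eval_sig, eval_potSum_pt, hb]
    simp
  set β := max (S.pen a) (S.pen a') + 2 * ((k + 1 : ℕ) : ℝ) with hβ
  have hj : ∀ᶠ θ in atTop, S.Joined ε θ β a a' := by
    filter_upwards [hε1 β, hε2] with θ h1 h2
    refine hF2 ε θ β h1 a a' h2 (hpos a θ hε3) (hpos a' θ hε4) ?_ ?_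
    · rw [hval a θ ha, hβ]
      linarith [le_max_left (S.pen a) (S.pen a')]
    · rw [hval a' θ ha', hβ]
      linarith [le_max_right (S.pen a) (S.pen a')]
  have hanti : Antitone fun n : ℕ => S.core ε n β := by
    intro m n hmn x hx
    refine ⟨hx.1, le_trans ?_ hx.2.1, hx.2.2⟩
    exact mul_le_mul_of_nonneg_right (Nat.cast_le.2 hmn) (S.P0_nonneg x)
  have := mem_component_iInter hanti (fun n => isCompact_core ε n β)
    (tendsto_natCast_atTop_atTop.eventually hj)
  refine connectedComponentIn_mono a ?_ this
  intro x hx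
  rw [mem_iInter] at hx
  refine ⟨?_, fun j => lt_of_lt_of_le (by have := S.g_pos j; positivity) ((hx 0).2.2 j)⟩
  by_contra hne
  have hpos : 0 < eval x S.P0 := (S.P0_nonneg x).lt_of_ne' hne
  obtain ⟨n, hn⟩ := exists_nat_gt (β / eval x S.P0)
  rw [div_lt_iff₀ hpos] at hn
  exact absurd (hx n).2.1 (not_le.2 hn)

end Sys

end SemialgComp

namespace SemialgComp

open Filter Topology

variable {k : ℕ}

/-- In every cell of a family of polynomials, points with the same signs on suitable polynomials
can be joined. -/
def SignsJoin {s : ℕ} (P : Fin s → MvPolynomial (Fin k) ℝ) (D : ℕ) : Prop :=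
  ∀ σ : Fin s → SignType, ∃ F : Set (MvPolynomial (Fin k) ℝ), FinDeg D F ∧
    ∀ a ∈ signRealization P σ, ∀ a' ∈ signRealization P σ, SameSign F a a' →
      a' ∈ connectedComponentIn (signRealization P σ) a

lemma signsJoin_degA {s d : ℕ} (hd : 1 ≤ d) (P : Fin s → MvPolynomial (Fin k) ℝ)
    (hP : ∀ i, (P i).totalDegree ≤ d) : SignsJoin P (Sys.degA k (2 * d + 1)) := by
  classical
  intro σ
  let P' : {j : Fin s // σ j ≠ 0} → MvPolynomial (Fin k) ℝ := fun j => (σ j : ℝ) • P j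
  obtain ⟨g, hg, hgen⟩ := exists_generic P'
  obtain ⟨pot, hp1, hp2, hp3⟩ := exists_potential (e := 2 * d + 1) ⟨d, rfl⟩
  let S : Sys k {j : Fin s // σ j ≠ 0} :=
    { P0 := ∑ i ∈ Finset.univ.filter (fun i => σ i = 0), P i ^ 2
      P := P'
      g := g
      pot := pot
      e := 2 * d + 1
      d := d
      e_eq := rfl
      one_le_d := hd
      P0_degree := totalDegree_finsetSum_le fun i _ =>
        (totalDegree_pow _ _).trans (Nat.mul_le_mul_left 2 (hP i))
      P_degree := fun j => (totalDegree_smul_le _ _).trans (hP j)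
      P0_nonneg := fun x => by
        rw [map_sum]
        exact Finset.sum_nonneg fun i _ => by rw [map_pow]; exact sq_nonneg _
      g_pos := hg
      pot_deriv := hp1
      pot_nonneg := hp2
      pot_coercive := hp3 }
  have key : signRealization P σ = {x | eval x S.P0 = 0 ∧ ∀ j, 0 < eval x (S.P j)} := by
    ext x
    have h0 : eval x S.P0 = 0 ↔ ∀ i, σ i = 0 → eval x (P i) = 0 := by
      change eval x (∑ i ∈ Finset.univ.filter (fun i => σ i = 0), P i ^ 2) = 0 ↔ _
      rw [map_sum, Finset.sum_eq_zero_iff_of_nonneg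
        fun i _ => by rw [map_pow]; exact sq_nonneg _]
      simp
    have h1 : (∀ j, 0 < eval x (S.P j)) ↔ ∀ i, σ i ≠ 0 → 0 < (σ i : ℝ) * eval x (P i) := by
      change (∀ j : {j : Fin s // σ j ≠ 0}, 0 < eval x ((σ j : ℝ) • P j)) ↔ _
      simp [MvPolynomial.smul_eval]
    rw [mem_ofPred_eq, h0, h1, signRealization, mem_ofPred_eq, ← forall_and]
    refine forall_congr' fun i => ?_
    rcases h : σ i with _ | _ | _
    · simp [sign_eq_zero_iff]
    · simp [sign_eq_neg_one_iff]
    · simp [sign_eq_one_iff]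
  obtain ⟨F, hF, h⟩ := S.exists_component_signs hgen
  refine ⟨F, hF, fun a ha a' ha' hs => ?_⟩
  rw [key] at ha ha' ⊢
  exact h a a' hs ha.1 ha'.1 ha.2 ha'.2

lemma eval_combo {p : MvPolynomial (Fin k) ℝ} (hp : p.totalDegree ≤ 1) {a b : ℝ} (hab : a + b = 1)
    (x y : Fin k → ℝ) : eval (a • x + b • y) p = a * eval x p + b * eval y p := by
  rw [eval_eq, eval_eq, eval_eq, Finset.mul_sum, Finset.mul_sum, ← Finset.sum_add_distrib]
  refine Finset.sum_congr rfl fun m hm => ?_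
  have hm1 : m.degree ≤ 1 := (le_totalDegree hm).trans hp
  rcases Nat.le_one_iff_eq_zero_or_eq_one.1 hm1 with h | h
  · rw [Finsupp.degree_eq_zero_iff] at h
    subst h
    simp
    rw [← add_mul, hab, one_mul]
  · have h' : m.sum (fun _ e => e) = 1 := h
    obtain ⟨i, rfl⟩ := (Finsupp.sum_eq_one_iff m).1 h'
    have hmon : ∀ z : Fin k → ℝ, ∏ j ∈ (Finsupp.single i 1).support,
        z j ^ (Finsupp.single i 1 : Fin k →₀ ℕ) j = z i := by
      intro z
      rw [Finsupp.support_single, Finset.prod_singleton,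
        Finsupp.single_eq_same, pow_one]
      exact one_ne_zero
    rw [hmon, hmon, hmon]
    simp only [Pi.add_apply, Pi.smul_apply, smul_eq_mul]
    ring

lemma signsJoin_of_le_one {s : ℕ} (P : Fin s → MvPolynomial (Fin k) ℝ)
    (hP : ∀ i, (P i).totalDegree ≤ 1) : SignsJoin P 0 := by
  intro σ
  refine ⟨∅, ⟨finite_empty, by simp⟩, fun a ha a' ha' _ => ?_⟩
  have hconv : Convex ℝ (signRealization P σ) := by
    intro x hx y hy u v hu hv huv i
    rw [eval_combo (hP i) huv]
    have h1 := hx i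
    have h2 := hy i
    rcases hu.eq_or_lt with rfl | hu
    · rw [zero_add] at huv
      subst huv
      simpa using h2
    rcases hv.eq_or_lt with rfl | hv
    · rw [add_zero] at huv
      subst huv
      simpa using h1
    rcases h : σ i with _ | _ | _
    · change SignType.sign _ = 0
      change σ i = 0 at h
      rw [h, sign_eq_zero_iff] at h1 h2
      simp [h1, h2]
    · change SignType.sign _ = -1
      change σ i = -1 at h
      rw [h, sign_eq_neg_one_iff] at h1 h2
      rw [sign_eq_neg_one_iff]
      nlinarith
    · change SignType.sign _ = 1
      change σ i = 1 at h
      rw [h, sign_eq_one_iff] at h1 h2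
      rw [sign_eq_one_iff]
      positivity
  exact hconv.isPreconnected.subset_connectedComponentIn ha Subset.rfl ha'

lemma SignsJoin.description {s D : ℕ} {P : Fin s → MvPolynomial (Fin k) ℝ} (h : SignsJoin P D)
    (hP : ∀ i, (P i).totalDegree ≤ D) {S : Set (Fin k → ℝ)} {Sgns0 : Set (Fin s → SignType)}
    (hS : S = ⋃ σ ∈ Sgns0, signRealization P σ) (x : Fin k → ℝ) :
    ∃ (n : ℕ) (A : Fin n → MvPolynomial (Fin k) ℝ) (Sgns : Set (Fin n → SignType)),
      (∀ i, (A i).totalDegree ≤ D) ∧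
      connectedComponentIn S x = ⋃ σ ∈ Sgns, signRealization A σ := by
  choose F hF1 hF2 using h
  have hF : FinDeg D (range P ∪ ⋃ σ, F σ) :=
    FinDeg.union ⟨finite_range P, by rintro _ ⟨i, rfl⟩; exact hP i⟩ (FinDeg.iUnion hF1)
  obtain ⟨n, A, hA⟩ : ∃ (n : ℕ) (A : Fin n → MvPolynomial (Fin k) ℝ),
      range A = range P ∪ ⋃ σ, F σ := by
    obtain ⟨n, A, -, hA⟩ := hF.1.fin_param
    exact ⟨n, A, hA⟩
  refine ⟨n, A, {τ | ∃ y ∈ connectedComponentIn S x, y ∈ signRealization A τ}, fun i => ?_, ?_⟩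
  · exact hF.2 _ (hA ▸ mem_range_self i)
  ext y'
  simp only [mem_iUnion, mem_ofPred_eq, exists_prop]
  constructor
  · exact fun hy => ⟨fun i => SignType.sign (eval y' (A i)), ⟨y', hy, fun i => rfl⟩, fun i => rfl⟩
  · rintro ⟨τ, ⟨y, hy, hyτ⟩, hyτ'⟩
    have hsame : SameSign (range P ∪ ⋃ σ, F σ) y y' := by
      rw [← hA]
      rintro _ ⟨i, rfl⟩
      exact (hyτ i).trans (hyτ' i).symm
    have hyS := connectedComponentIn_subset _ _ hy
    rw [hS] at hyS
    simp only [mem_iUnion, exists_prop] at hyS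
    obtain ⟨σ, hσ, hyσ⟩ := hyS
    have hyσ' : y' ∈ signRealization P σ := fun i =>
      (hsame _ (Or.inl (mem_range_self i))).symm.trans (hyσ i)
    have h1 := hF2 σ y hyσ y' hyσ' fun f hf => hsame f (Or.inr (mem_iUnion.2 ⟨σ, hf⟩))
    rw [connectedComponentIn_eq hy]
    refine connectedComponentIn_mono y ?_ h1
    rw [hS]
    exact subset_biUnion_of_mem hσ

lemma degA_le {d : ℕ} (hd : 2 ≤ d) (hk : 1 ≤ k) :
    Sys.degA k (2 * d + 1) ≤ d ^ (3344 * k ^ 3) := by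
  have hd1 : 1 ≤ d := by omega
  have he : 2 * d + 1 ≤ d ^ 3 := by nlinarith [sq_nonneg d, Nat.mul_le_mul hd hd]
  have h1 : (2 * d + 1) ^ (k + 2) ≤ d ^ (3 * (k + 2)) := by
    rw [pow_mul]
    exact Nat.pow_le_pow_left he _
  have h2 : 10000 ≤ d ^ 14 := le_trans (by norm_num) (Nat.pow_le_pow_left hd 14)
  have h3 : k + 3 ≤ d ^ (k + 2) :=
    le_trans (Nat.lt_two_pow_self (n := k + 2)) (Nat.pow_le_pow_left hd _)
  have h4 : 1 + (k + 2) * (2 * d + 1) ≤ d ^ (k + 2) * d ^ 3 :=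
    le_trans (by nlinarith) (Nat.mul_le_mul h3 he)
  have h5 : Sys.degB k (2 * d + 1) ≤ d ^ (38 * k) := by
    unfold Sys.degB
    refine (Nat.mul_le_mul h2 (Nat.mul_le_mul h1 (Nat.mul_le_mul h1 h4))).trans ?_
    rw [← pow_add, ← pow_add, ← pow_add, ← pow_add]
    exact Nat.pow_le_pow_right hd1 (by omega)
  unfold Sys.degA
  rw [← pow_mul, ← pow_mul, ← pow_add]
  refine (Nat.pow_le_pow_left h5 _).trans ?_
  rw [← pow_mul]
  refine Nat.pow_le_pow_right hd1 ?_
  have h6 : k ≤ k ^ 2 := Nat.le_self_pow (by norm_num) k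
  calc 38 * k * (41 * (k * (k + 1)) + 6) ≤ 38 * k * (88 * k ^ 2) :=
        Nat.mul_le_mul_left _ (by nlinarith)
    _ = 3344 * k ^ 3 := by ring

end SemialgComp

/-- There is a universal constant `c > 0` such that for every `k ≥ 1`, every family
`P = {P_1,…,P_s} ⊆ ℝ[X_1,…,X_k]` of polynomials of degree at most `d` and every
`P`-semi-algebraic set `S` (a finite union of realizations of sign conditions on `P`),
each connected component of `S` is a finite union of realizations of sign conditions on a
finite family of polynomials of degree at most `d^{c·k³}`. -/
theorem connected_components_of_semialgebraic_set_description :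
    ∃ c : ℕ, 0 < c ∧
      ∀ (k s d : ℕ), 1 ≤ k →
      ∀ P : Fin s → MvPolynomial (Fin k) ℝ, (∀ i, (P i).totalDegree ≤ d) →
      ∀ (S : Set (Fin k → ℝ)) (Sgns0 : Set (Fin s → SignType)),
        S = ⋃ σ ∈ Sgns0, signRealization P σ →
        ∀ x ∈ S,
          ∃ (n : ℕ) (A : Fin n → MvPolynomial (Fin k) ℝ)
            (Sgns : Set (Fin n → SignType)),
            (∀ i, (A i).totalDegree ≤ d ^ (c * k ^ 3)) ∧
            connectedComponentIn S x = ⋃ σ ∈ Sgns, signRealization A σ := by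
  refine ⟨3344, by norm_num, fun k s d hk P hP S Sgns0 hS x _ => ?_⟩
  have hexp : d ≤ d ^ (3344 * k ^ 3) := Nat.le_self_pow (by positivity) d
  refine SemialgComp.SignsJoin.description (fun σ => ?_) (fun i => (hP i).trans hexp) hS x
  rcases le_or_gt d 1 with hd | hd
  · obtain ⟨F, hF, h⟩ := SemialgComp.signsJoin_of_le_one P (fun i => (hP i).trans hd) σ
    exact ⟨F, hF.mono (Nat.zero_le _), h⟩
  · obtain ⟨F, hF, h⟩ := SemialgComp.signsJoin_degA hd.le P hP σ
    exact ⟨F, hF.mono (SemialgComp.degA_le hd hk), h⟩
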